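/- arXiv:2405.15147 — 2 statements merged into one kernel-verified Lean document; each statement's English description precedes it below -/
import Mathlib

section
/- Let n ≥ 4, let m be an integer with 4 ≤ m ≤ n, and let S be a set of four distinct vertices of the godan graph EA_n such that for some distinct i, j ∈ {1,…,n} exactly two vertices of S have m-th symbol i and exactly two vertices of S have m-th symbol j (i.e., |S ∩ V(EA_n^{m:i})| = |S ∩ V(EA_n^{m:j})| = 2). Then there exist n − 1 pairwise internally edge disjoint S-trees in EA_n. -/
namespace Godan

/-- The transposition (12), using 0-based indices 0,1 for symbols 1,2. -/
def perm12 (n : ℕ) (hn : 3 ≤ n) : Equiv.Perm (Fin n) :=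
  Equiv.swap ⟨0, by omega⟩ ⟨1, by omega⟩

/-- The 3-cycle (123): symbol 1 ↦ 2 ↦ 3 ↦ 1, i.e. index 0 ↦ 1 ↦ 2 ↦ 0. -/
def perm123 (n : ℕ) (hn : 3 ≤ n) : Equiv.Perm (Fin n) :=
  Equiv.swap ⟨0, by omega⟩ ⟨2, by omega⟩ * Equiv.swap ⟨0, by omega⟩ ⟨1, by omega⟩

/-- The 3-cycle (132): symbol 1 ↦ 3 ↦ 2 ↦ 1, i.e. index 0 ↦ 2 ↦ 1 ↦ 0. -/
def perm132 (n : ℕ) (hn : 3 ≤ n) : Equiv.Perm (Fin n) :=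
  Equiv.swap ⟨0, by omega⟩ ⟨1, by omega⟩ * Equiv.swap ⟨0, by omega⟩ ⟨2, by omega⟩

/-- Ω* = {(12), (123), (132)} ∪ {(12)(3i) : 4 ≤ i ≤ n}; symbol i has index i - 1,
so the transposition (3i) is `Equiv.swap ⟨2,_⟩ k` with 3 ≤ k = i - 1 ≤ n - 1. -/
def OmegaStar (n : ℕ) (hn : 3 ≤ n) : Set (Equiv.Perm (Fin n)) :=
  {perm12 n hn, perm123 n hn, perm132 n hn} ∪
    {s | ∃ k : Fin n, 3 ≤ (k : ℕ) ∧ s = perm12 n hn * Equiv.swap ⟨2, by omega⟩ k}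

/-- The godan graph EA_n: vertices are the permutations of {1,…,n}, and u,v are
adjacent iff u = v ∘ s for some s ∈ Ω* (note `(v * s) i = v (s i)` in Mathlib).
Since Ω* is closed under inverses, `fromRel` yields exactly this adjacency. -/
def godanGraph (n : ℕ) (hn : 3 ≤ n) : SimpleGraph (Equiv.Perm (Fin n)) :=
  SimpleGraph.fromRel (fun u v => ∃ s ∈ OmegaStar n hn, u = v * s)

/-- `T 0, …, T (r-1)` is a family of r pairwise internally edge disjoint S-trees:
each `T i` is a subgraph of `G` which is a tree containing all vertices of `S`,
and for i ≠ j, `V(T i) ∩ V(T j) = S` and `E(T i) ∩ E(T j) = ∅`. -/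
def IsIDSTFamily {V : Type*} (G : SimpleGraph V) (S : Set V) {r : ℕ}
    (T : Fin r → G.Subgraph) : Prop :=
  (∀ i, S ⊆ (T i).verts ∧ ((T i).coe).IsTree) ∧
    ∀ i j, i ≠ j → (T i).verts ∩ (T j).verts = S ∧ (T i).edgeSet ∩ (T j).edgeSet = ∅

/-- The maximum number of pairwise internally edge disjoint S-trees in G. -/
noncomputable def maxIDST {V : Type*} (G : SimpleGraph V) (S : Set V) : ℕ :=
  sSup {r : ℕ | ∃ T : Fin r → G.Subgraph, IsIDSTFamily G S T}

/-- The generalized k-connectivity κ_k(G): the minimum over all k-element vertex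
sets S of the maximum number of pairwise internally edge disjoint S-trees. -/
noncomputable def genConn {V : Type*} [Fintype V] (G : SimpleGraph V) (k : ℕ) : ℕ :=
  sInf {m : ℕ | ∃ S : Finset V, S.card = k ∧ maxIDST G (↑S : Set V) = m}

section Menger

variable {V : Type*}

/-- `u` and `v` are joined by a walk of `G` all of whose vertices lie in `W`. -/
def Linked (G : SimpleGraph V) (W : Set V) (u v : V) : Prop :=
  ∃ p : G.Walk u v, ∀ w ∈ p.support, w ∈ W

namespace Linked

variable {G G' : SimpleGraph V} {W W' : Set V} {u v w : V}

lemma refl (hu : u ∈ W) : Linked G W u u := ⟨.nil, by simpa using hu⟩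

lemma symm (h : Linked G W u v) : Linked G W v u := by
  obtain ⟨p, hp⟩ := h
  exact ⟨p.reverse, by simpa using hp⟩

lemma trans (h : Linked G W u v) (h' : Linked G W v w) : Linked G W u w := by
  obtain ⟨p, hp⟩ := h
  obtain ⟨q, hq⟩ := h'
  refine ⟨p.append q, fun x hx => ?_⟩
  rcases SimpleGraph.Walk.mem_support_append_iff .. |>.1 hx with hx | hx
  exacts [hp x hx, hq x hx]

lemma mono (h : Linked G W u v) (hG : G ≤ G') (hW : W ⊆ W') : Linked G' W' u v := by
  obtain ⟨p, hp⟩ := h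
  exact ⟨p.mapLe hG, by simpa using fun w hw => hW (hp w hw)⟩

lemma of_adj (h : G.Adj u v) (hu : u ∈ W) (hv : v ∈ W) : Linked G W u v :=
  ⟨h.toWalk, by simp [hu, hv]⟩

lemma right_mem (h : Linked G W u v) : v ∈ W := h.choose_spec _ (SimpleGraph.Walk.end_mem_support _)

end Linked

/-- There are `k` pairwise disjoint paths of `G` from `A` to `B`. -/
def HasDisjointPaths (G : SimpleGraph V) (A B : Set V) (k : ℕ) : Prop :=
  ∃ (a b : Fin k → V) (p : ∀ i, G.Walk (a i) (b i)), (∀ i, a i ∈ A) ∧ (∀ i, b i ∈ B) ∧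
    (∀ i, (p i).IsPath) ∧ ∀ i j v, v ∈ (p i).support → v ∈ (p j).support → i = j

lemma exists_linked_insert {G G' : SimpleGraph V} {x y : V}
    (hG : ∀ u v, G.Adj u v → G'.Adj u v ∨ (u = x ∧ v = y) ∨ (u = y ∧ v = x))
    {A B T F : Set V} (hAB : ∀ a ∈ A, ∀ b ∈ B, ¬ Linked G' Tᶜ a b)
    (hy : ∀ a ∈ A, ¬ Linked G' Tᶜ a y) {u b : V} (p : G.Walk u b) (hb : b ∈ B)
    (hp : ∀ w ∈ p.support, w ∈ Fᶜ) {a : V} (ha : a ∈ A) (hau : Linked G' Fᶜ a u)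
    (hau' : u ∉ insert x T → Linked G' (F ∪ insert x T)ᶜ a u) :
    ∃ a ∈ A, ∃ c ∈ insert x T, Linked G' Fᶜ a c := by
  have hsub : (F ∪ insert x T)ᶜ ⊆ Tᶜ := fun w hw hwT => hw (Or.inr (Or.inr hwT))
  induction p with
  | nil =>
    rename_i u
    by_cases hu : u ∈ insert x T
    · exact ⟨a, ha, _, hu, hau⟩
    · exact absurd ((hau' hu).mono le_rfl hsub) (hAB _ ha _ hb)
  | cons h p ih =>
    rename_i u w b
    by_cases hu : u ∈ insert x T
    · exact ⟨a, ha, _, hu, hau⟩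
    · have hux : u ≠ x := fun e => hu (Or.inl e)
      have huy : u ≠ y := by
        rintro rfl
        exact hy _ ha ((hau' hu).mono le_rfl hsub)
      have hadj : G'.Adj u w := by
        rcases hG _ _ h with h | h | h
        · exact h
        · exact absurd h.1 hux
        · exact absurd h.1 huy
      have hw : w ∈ Fᶜ := hp w (by simp)
      refine ih hb (fun z hz => hp z (by simp [hz]))
        (hau.trans (.of_adj hadj hau.right_mem hw)) fun hwT => ?_
      refine (hau' hu).trans (.of_adj hadj (hau' hu).right_mem ?_)
      rintro (h | h)
      exacts [hw h, hwT h]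

lemma exists_exit {G : SimpleGraph V} (R : Set V) {a b : V} (p : G.Walk a b) (ha : a ∈ R)
    (hb : b ∉ R) : ∃ x y, G.Adj x y ∧ x ∈ R ∧ y ∉ R ∧ x ∈ p.support ∧ y ∈ p.support := by
  induction p with
  | nil => exact absurd ha hb
  | cons h p ih =>
    rename_i u w b
    by_cases hw : w ∈ R
    · obtain ⟨x, y, h1, h2, h3, h4, h5⟩ := ih hw hb
      exact ⟨x, y, h1, h2, h3, by simp [h4], by simp [h5]⟩
    · exact ⟨u, w, h, ha, hw, by simp, by simp⟩

/-- Menger's theorem. -/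
theorem hasDisjointPaths_of_separators [Finite V] (G : SimpleGraph V) (k : ℕ) (A B : Set V)
    (h : ∀ F : Finset V, F.card < k → ∃ a ∈ A, ∃ b ∈ B, Linked G (↑F : Set V)ᶜ a b) :
    HasDisjointPaths G A B k := by
  classical
  have := Fintype.ofFinite V
  induction G using WellFoundedLT.induction generalizing A B with
  | _ G ih =>
  by_cases hbot : ∀ u v, ¬ G.Adj u v
  · have hcard : k ≤ (A ∩ B).toFinset.card := by
      by_contra! hlt
      obtain ⟨a, ha, b, hb, p, hp⟩ := h _ hlt
      cases p with
      | nil => exact hp a (by simp) (by simp [ha, hb])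
      | cons h _ => exact hbot _ _ h
    obtain ⟨s, hs, hsk⟩ := Finset.exists_subset_card_eq hcard
    let e := s.equivFinOfCardEq hsk
    have hmem : ∀ i, (e.symm i : V) ∈ A ∩ B := fun i => by simpa using hs (e.symm i).2
    refine ⟨fun i => e.symm i, fun i => e.symm i, fun i => .nil, fun i => (hmem i).1,
      fun i => (hmem i).2, fun i => .nil, fun i j v hi hj => ?_⟩
    simp only [SimpleGraph.Walk.support_nil, List.mem_singleton] at hi hj
    exact e.symm.injective (Subtype.ext (hi.symm.trans hj))
  push Not at hbot
  obtain ⟨x₀, y₀, hxy₀⟩ := hbot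
  let G' := G.deleteEdges {s(x₀, y₀)}
  have hle : G' ≤ G := SimpleGraph.deleteEdges_le _
  have hlt : G' < G := by
    refine lt_of_le_of_ne hle fun he => ?_
    have : G'.Adj x₀ y₀ := he ▸ hxy₀
    simp [G'] at this
  by_cases hsep : ∀ F : Finset V, F.card < k → ∃ a ∈ A, ∃ b ∈ B, Linked G' (↑F : Set V)ᶜ a b
  · obtain ⟨a, b, p, ha, hb, hp, hd⟩ := ih G' hlt A B hsep
    refine ⟨a, b, fun i => (p i).mapLe hle, ha, hb, fun i => (hp i).mapLe hle, ?_⟩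
    simpa using hd
  push Not at hsep
  obtain ⟨T, hTk, hT⟩ := hsep
  obtain ⟨a₀, ha₀, b₀, hb₀, p₀, hp₀⟩ := h T hTk
  obtain ⟨x, y, hxy, ⟨a₁, ha₁, hx⟩, hy, -, hyp⟩ := exists_exit
    {w | ∃ a ∈ A, Linked G' (↑T : Set V)ᶜ a w} p₀
    ⟨a₀, ha₀, .refl (hp₀ _ (by simp))⟩ (fun ⟨a, ha, hl⟩ => hT a ha _ hb₀ hl)
  simp only [Set.mem_ofPred_eq, not_exists, not_and] at hy
  have hxT : x ∉ T := by simpa using hx.right_mem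
  have hyT : y ∉ T := by simpa using hp₀ _ hyp
  have hedge : s(x, y) = s(x₀, y₀) := by
    by_contra hne
    refine hy a₁ ha₁ (hx.trans (.of_adj ?_ (by simpa using hxT) (by simpa using hyT)))
    simp only [G', SimpleGraph.deleteEdges_adj, Set.mem_singleton_iff]
    exact ⟨hxy, hne⟩
  have hG : ∀ u v, G.Adj u v → G'.Adj u v ∨ (u = x ∧ v = y) ∨ (u = y ∧ v = x) := by
    intro u v huv
    by_cases he : s(u, v) = s(x, y)
    · right
      simpa using he
    · left
      simp only [G', SimpleGraph.deleteEdges_adj, Set.mem_singleton_iff]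
      exact ⟨huv, by rwa [← hedge]⟩
  have hx' : ∀ b ∈ B, ¬ Linked G' (↑T : Set V)ᶜ b x := fun b hb hl =>
    hT a₁ ha₁ b hb (hx.trans hl.symm)
  have hk : T.card + 1 = k := by
    by_contra hne
    obtain ⟨a, ha, b, hb, p, hp⟩ := h (insert x T)
      (by rw [Finset.card_insert_of_notMem hxT]; omega)
    have haF := hp a (by simp)
    obtain ⟨a', ha', c, hc, hl⟩ := exists_linked_insert hG hT hy p hb hp ha
      (.refl haF) (fun _ => .refl (by simpa using haF))
    have := hl.right_mem
    simp at this hc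
    tauto
  obtain ⟨a, t, p, ha, ht, hp, hpd⟩ := ih G' hlt A (insert x T) fun F hF => by
    obtain ⟨a, ha, b, hb, p, hp⟩ := h F hF
    have haF := hp a (by simp)
    exact exists_linked_insert hG hT hy p hb hp ha (.refl haF)
      (fun hn => .refl (by simp at haF hn ⊢; tauto))
  obtain ⟨t', b, q, ht', hb, hq, hqd⟩ := ih G' hlt (insert y T) B fun F hF => by
    obtain ⟨a, ha, b, hb, p, hp⟩ := h F hF
    have hbF := hp b (by simp)
    obtain ⟨b', hb', c, hc, hl⟩ := exists_linked_insert (x := y) (y := x) (A := B) (B := A)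
      (T := (T : Set V)) (F := (F : Set V))
      (fun u v huv => by have := hG u v huv; tauto)
      (fun b hb a ha hl => hT a ha b hb hl.symm) hx' p.reverse ha (by simpa using hp) hb
      (.refl hbF) (fun hn => .refl (by simp at hbF hn ⊢; tauto))
    exact ⟨c, hc, b', hb', hl.symm⟩
  have htinj : Function.Injective t := fun i j hij =>
    hpd i j (t i) (by simp) (by simp [hij])
  have ht'inj : Function.Injective t' := fun i j hij =>
    hqd i j (t' i) (by simp) (by simp [hij])
  have himt : Finset.univ.image t = insert x T := by
    refine Finset.eq_of_subset_of_card_le (fun v hv => ?_) ?_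
    · obtain ⟨i, -, rfl⟩ := Finset.mem_image.1 hv
      simpa using ht i
    · rw [Finset.card_image_of_injective _ htinj, Finset.card_insert_of_notMem hxT]
      simp [hk]
  have himt' : Finset.univ.image t' = insert y T := by
    refine Finset.eq_of_subset_of_card_le (fun v hv => ?_) ?_
    · obtain ⟨i, -, rfl⟩ := Finset.mem_image.1 hv
      simpa using ht' i
    · rw [Finset.card_image_of_injective _ ht'inj, Finset.card_insert_of_notMem hyT]
      simp [hk]
  have hcross : ∀ i j v, v ∈ (p i).support → v ∈ (q j).support → v ∈ T ∧ v = t i ∧ v = t' j := by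
    intro i j v hvi hvj
    have htT : ∀ i w, w ∈ T → w ∈ (p i).support → w = t i := by
      intro i w hwT hw
      obtain ⟨i', -, rfl⟩ := Finset.mem_image.1 (himt ▸ Finset.mem_insert_of_mem hwT)
      rw [hpd i i' _ hw (by simp)]
    have ht'T : ∀ j w, w ∈ T → w ∈ (q j).support → w = t' j := by
      intro j w hwT hw
      obtain ⟨j', -, rfl⟩ := Finset.mem_image.1 (himt' ▸ Finset.mem_insert_of_mem hwT)
      rw [hqd j j' _ hw (by simp)]
    by_cases hv : v ∈ T
    · exact ⟨hv, htT i v hv hvi, ht'T j v hv hvj⟩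
    exfalso
    have hvj' : v ∈ (q j).reverse.support := by simpa using hvj
    refine hT _ (ha i) _ (hb j) (.trans (v := v) ⟨(p i).takeUntil v hvi, fun w hw hwT => ?_⟩
      (.symm ⟨(q j).reverse.takeUntil v hvj', fun w hw hwT => ?_⟩))
    · have hwt := htT i w hwT ((p i).support_takeUntil_subset_support hvi hw)
      subst hwt
      exact SimpleGraph.Walk.endpoint_notMem_support_takeUntil (hp i) hvi
        (fun e => hv (e ▸ hwT)) hw
    · have hwt := ht'T j w hwT
        (by simpa using (q j).reverse.support_takeUntil_subset_support hvj' hw)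
      subst hwt
      exact SimpleGraph.Walk.endpoint_notMem_support_takeUntil (hq j).reverse hvj'
        (fun e => hv (e ▸ hwT)) hw
  let φ : V → V := fun v => if v = x then y else v
  have hφ : ∀ i, φ (t i) ∈ insert y T := fun i => by
    have := ht i
    by_cases hi : t i = x
    · simp [φ, hi]
    · simp only [φ, hi, if_false]
      exact Finset.mem_insert_of_mem (by simpa [hi] using this)
  have hφinj : ∀ i i', φ (t i) = φ (t i') → i = i' := by
    intro i i' he
    apply htinj
    have h1 := ht i
    have h2 := ht i'
    by_cases hi : t i = x <;> by_cases hi' : t i' = x <;> simp [φ, hi, hi'] at he h1 h2 ⊢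
    · exact absurd (he ▸ h2) hyT
    · exact absurd (he ▸ h1) hyT
    · exact he
  have hj : ∀ i, ∃ j, t' j = φ (t i) := fun i => by
    have := hφ i
    rw [← himt'] at this
    simpa using this
  choose j hj using hj
  have hjinj : Function.Injective j := fun i i' he => hφinj i i' (by rw [← hj, ← hj, he])
  have hr : ∀ i, ∃ r : G.Walk (a i) (b (j i)), r.IsPath ∧
      ∀ v ∈ r.support, v ∈ (p i).support ∨ v ∈ (q (j i)).support := by
    intro i
    have hmid : Linked G {v | v ∈ (p i).support ∨ v ∈ (q (j i)).support} (t i) (t' (j i)) := by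
      by_cases hi : t i = x
      · refine .of_adj ?_ (Or.inl (by simp)) (Or.inr (by simp))
        rw [hj, hi]
        simpa [φ] using hxy
      · have : t' (j i) = t i := by rw [hj]; simp [φ, hi]
        exact ⟨SimpleGraph.Walk.nil.copy rfl this.symm, by simp⟩
    have h1 : Linked G {v | v ∈ (p i).support ∨ v ∈ (q (j i)).support} (a i) (t i) :=
      ⟨(p i).mapLe hle, fun w hw => Or.inl (by simpa using hw)⟩
    have h2 : Linked G {v | v ∈ (p i).support ∨ v ∈ (q (j i)).support} (t' (j i)) (b (j i)) :=
      ⟨(q (j i)).mapLe hle, fun w hw => Or.inr (by simpa using hw)⟩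
    obtain ⟨r, hr⟩ := (h1.trans hmid).trans h2
    exact ⟨r.bypass, r.bypass_isPath, fun v hv => hr v (r.support_bypass_subset_support hv)⟩
  choose r hrp hr using hr
  refine ⟨a, fun i => b (j i), r, ha, fun i => hb _, hrp, fun i i' v hv hv' => ?_⟩
  have hc : ∀ i i', v ∈ (p i).support → v ∈ (q (j i')).support → i = i' := by
    intro i i' hv hv'
    obtain ⟨hvT, h1, h2⟩ := hcross _ _ _ hv hv'
    apply hφinj
    rw [← hj i', ← h2, h1]
    have : t i ≠ x := by
      rw [← h1]
      rintro rfl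
      exact hxT hvT
    simp [φ, this]
  rcases hr i v hv with h1 | h1 <;> rcases hr i' v hv' with h2 | h2
  · exact hpd _ _ _ h1 h2
  · exact hc _ _ h1 h2
  · exact (hc _ _ h2 h1).symm
  · exact hjinj (hqd _ _ _ h1 h2)

end Menger

section Trees

variable {V : Type*} {G : SimpleGraph V}

lemma exists_disjoint_subgraphs [Finite V] (G : SimpleGraph V) (W A B : Set V) (k : ℕ)
    (hA : A ⊆ W)
    (h : ∀ F : Finset V, F.card < k → ∃ a ∈ A, ∃ b ∈ B, Linked G (W \ F) a b) :
    ∃ (a b : Fin k → V) (R : Fin k → G.Subgraph), (∀ i, a i ∈ A) ∧ (∀ i, b i ∈ B) ∧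
      (∀ i, (R i).Connected) ∧ (∀ i, a i ∈ (R i).verts) ∧ (∀ i, b i ∈ (R i).verts) ∧
      (∀ i, (R i).verts ⊆ W) ∧ ∀ i j v, v ∈ (R i).verts → v ∈ (R j).verts → i = j := by
  let G' : SimpleGraph V :=
    { Adj := fun u v => G.Adj u v ∧ u ∈ W ∧ v ∈ W
      symm := ⟨fun u v h => ⟨h.1.symm, h.2.2, h.2.1⟩⟩
      loopless := ⟨fun u h => G.loopless.irrefl u h.1⟩ }
  have hle : G' ≤ G := fun u v h => h.1
  have hsub : ∀ {u v : V} (p : G'.Walk u v), u ∈ W → ∀ w ∈ p.support, w ∈ W := by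
    intro u v p
    induction p with
    | nil => intro hu; simpa using hu
    | cons h p ih =>
      intro hu w hw
      rcases List.mem_cons.1 hw with rfl | hw
      exacts [hu, ih h.2.2 w hw]
  have hlink : ∀ {u v : V} (F : Set V), Linked G (W \ F) u v → Linked G' Fᶜ u v := by
    rintro u v F ⟨p, hp⟩
    induction p with
    | nil => exact .refl (hp _ (by simp)).2
    | cons h p ih =>
      rename_i u w v
      have hu := hp u (by simp)
      have hw := hp w (by simp)
      exact (Linked.of_adj (G := G') ⟨h, hu.1, hw.1⟩ hu.2 hw.2).trans
        (ih fun z hz => hp z (by simp [hz]))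
  obtain ⟨a, b, p, ha, hb, -, hd⟩ := hasDisjointPaths_of_separators G' k A B fun F hF => by
    obtain ⟨a, ha, b, hb, hl⟩ := h F hF
    exact ⟨a, ha, b, hb, hlink _ hl⟩
  refine ⟨a, b, fun i => ((p i).mapLe hle).toSubgraph, ha, hb,
    fun i => SimpleGraph.Walk.toSubgraph_connected _, fun i => by simp, fun i => by simp,
    fun i w hw => hsub (p i) (hA (ha i)) w (by simpa using hw), fun i j v hi hj => ?_⟩
  exact hd i j v (by simpa using hi) (by simpa using hj)

lemma Linked.exists_last {W : Set V} {m y : V} (h : Linked G W m y) (hmy : m ≠ y) :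
    ∃ b, G.Adj b y ∧ Linked G (W \ {y}) m b := by
  classical
  obtain ⟨p, hp⟩ := h.symm
  have hpath := p.bypass_isPath
  have hsup : ∀ w ∈ p.bypass.support, w ∈ W :=
    fun w hw => hp w (p.support_bypass_subset_support hw)
  generalize p.bypass = q at hpath hsup
  cases q with
  | nil => exact absurd rfl hmy
  | cons hadj q =>
    rename_i b
    rw [SimpleGraph.Walk.cons_isPath_iff] at hpath
    refine ⟨b, hadj.symm, .symm ⟨q, fun w hw => ⟨hsup w (by simp [hw]), ?_⟩⟩⟩
    rintro rfl
    exact hpath.2 hw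

/-- Two subgraphs share no vertex outside `S`, and no edge. -/
def Compat (S : Set V) (K L : G.Subgraph) : Prop :=
  K.verts ∩ L.verts ⊆ S ∧ ∀ u v, K.Adj u v → ¬ L.Adj u v

namespace Compat

variable {S S' : Set V} {K K' L L' : G.Subgraph}

lemma symm (h : Compat S K L) : Compat S L K :=
  ⟨fun _ hv => h.1 ⟨hv.2, hv.1⟩, fun u v h1 h2 => h.2 u v h2 h1⟩

lemma mono (h : Compat S K L) (hS : S ⊆ S') : Compat S' K L := ⟨h.1.trans hS, h.2⟩

lemma sup_left (h : Compat S K L) (h' : Compat S K' L) : Compat S (K ⊔ K') L := by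
  refine ⟨?_, ?_⟩
  · rintro v ⟨hv | hv, hv'⟩
    exacts [h.1 ⟨hv, hv'⟩, h'.1 ⟨hv, hv'⟩]
  · rintro u v (huv | huv)
    exacts [h.2 u v huv, h'.2 u v huv]

lemma sup_right (h : Compat S K L) (h' : Compat S K L') : Compat S K (L ⊔ L') :=
  (h.symm.sup_left h'.symm).symm

lemma of_subsingleton (h : K.verts ∩ L.verts ⊆ S) (h' : (K.verts ∩ L.verts).Subsingleton) :
    Compat S K L :=
  ⟨h, fun _ _ hK hL => hK.ne
    (h' ⟨K.edge_vert hK, L.edge_vert hL⟩ ⟨K.edge_vert hK.symm, L.edge_vert hL.symm⟩)⟩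

lemma of_disjoint (h : ∀ v ∈ K.verts, v ∉ L.verts) : Compat S K L := by
  have : K.verts ∩ L.verts = ∅ := Set.eq_empty_of_forall_notMem fun v hv => h v hv.1 hv.2
  exact of_subsingleton (by simp [this]) (by simp [this])

lemma of_not_adj {x y : V} (h : K.verts ∩ L.verts ⊆ {x, y}) (h' : ¬ K.Adj x y) :
    Compat {x, y} K L := by
  refine ⟨h, fun u v hK hL => h' ?_⟩
  have hu := h ⟨K.edge_vert hK, L.edge_vert hL⟩
  have hv := h ⟨K.edge_vert hK.symm, L.edge_vert hL.symm⟩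
  have hne := hK.ne
  simp only [Set.mem_insert_iff, Set.mem_singleton_iff] at hu hv
  rcases hu with rfl | rfl <;> rcases hv with rfl | rfl
  exacts [absurd rfl hne, hK, hK.symm, absurd rfl hne]

end Compat

lemma connected_sup_of_mem {K L : G.Subgraph} {v : V} (hK : K.Connected) (hL : L.Connected)
    (hv : v ∈ K.verts) (hw : v ∈ L.verts) : (K ⊔ L).Connected :=
  SimpleGraph.Subgraph.connected_sup hK.preconnected hL.preconnected ⟨v, hv, hw⟩

/-- In a `d`-connected region `W`, the neighbours of a vertex `x` of degree `d` lie on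
internally disjoint connected subgraphs joining `x` to `y`. -/
lemma exists_internally_disjoint [Finite V] [DecidableEq V] (W : Set V) (d : ℕ)
    (hW : ∀ F : Finset V, F.card < d → ∀ u ∈ W \ ↑F, ∀ v ∈ W \ ↑F, Linked G (W \ F) u v)
    {x y : V} (hxy : x ≠ y) (hx : x ∈ W) (hy : y ∈ W) (N : Finset V)
    (hN : ∀ m, m ∈ N ↔ m ∈ W ∧ G.Adj x m) (hNd : N.card = d) :
    ∃ P : V → G.Subgraph, (∀ m ∈ N, (P m).Connected ∧ (P m).verts ⊆ W ∧ x ∈ (P m).verts ∧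
      y ∈ (P m).verts ∧ m ∈ (P m).verts) ∧
      ∀ m ∈ N, ∀ m' ∈ N, m ≠ m' → Compat {x, y} (P m) (P m') := by
  obtain ⟨a, b, R, ha, hb, hR, haR, hbR, hRW, hRd⟩ := exists_disjoint_subgraphs G (W \ {x, y})
    ↑(N.erase y) {b | G.Adj b y ∧ b ≠ x ∧ b ∈ W} (N.erase y).card (by
      intro m hm
      rw [Finset.mem_coe, Finset.mem_erase, hN] at hm
      simp only [Set.mem_sdiff, Set.mem_insert_iff, Set.mem_singleton_iff, not_or]
      exact ⟨hm.2.1, hm.2.2.ne', hm.1⟩) (by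
    intro F hF
    by_cases hyN : y ∈ N
    · have hlt : (insert x (F.erase y)).card < d := by
        have h1 := Finset.card_insert_le x (F.erase y)
        have h2 := Finset.card_erase_le (s := F) (a := y)
        have h3 := Finset.card_erase_add_one hyN
        omega
      obtain ⟨m, hm, hmF⟩ := Finset.exists_mem_notMem_of_card_lt_card hF
      have hm' := hm
      rw [Finset.mem_erase, hN] at hm'
      have hl := hW _ hlt m ⟨hm'.2.1, by simp [hm'.2.2.ne', hmF]⟩ y ⟨hy, by simp [hxy.symm]⟩
      obtain ⟨b, hb, hl⟩ := hl.exists_last hm'.1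
      have hbm := hl.right_mem
      simp only [Finset.coe_insert, Finset.coe_erase, Set.mem_sdiff, Set.mem_insert_iff,
        Set.mem_singleton_iff] at hbm
      refine ⟨m, hm, b, ⟨hb, by tauto, by tauto⟩, hl.mono le_rfl ?_⟩
      intro w hw
      simp only [Finset.coe_insert, Finset.coe_erase, Set.mem_sdiff, Set.mem_insert_iff,
        Set.mem_singleton_iff] at hw ⊢
      tauto
    · have hlt : (F \ {x, y}).card < d := by
        have h2 := Finset.card_le_card (Finset.sdiff_subset (s := F) (t := {x, y}))
        rw [Finset.erase_eq_of_notMem hyN] at hF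
        omega
      have hl := hW _ hlt y ⟨hy, by simp⟩ x ⟨hx, by simp⟩
      obtain ⟨m, hm, hl⟩ := hl.exists_last hxy.symm
      have hmm := hl.right_mem
      have hmN : m ∈ N := (hN m).2 ⟨hmm.1.1, hm.symm⟩
      have hmy : m ≠ y := fun e => hyN (e ▸ hmN)
      obtain ⟨b, hb, hl⟩ := hl.symm.exists_last hmy
      have hbm := hl.right_mem
      simp only [Finset.coe_sdiff, Finset.coe_insert, Finset.coe_singleton, Set.mem_sdiff,
        Set.mem_insert_iff, Set.mem_singleton_iff] at hbm
      refine ⟨m, by simp [hmN, hmy], b, ⟨hb, by tauto, by tauto⟩, hl.mono le_rfl ?_⟩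
      intro w hw
      simp only [Finset.coe_sdiff, Finset.coe_insert, Finset.coe_singleton, Set.mem_sdiff,
        Set.mem_insert_iff, Set.mem_singleton_iff] at hw ⊢
      tauto)
  have hainj : Function.Injective a := fun i j hij => hRd i j (a i) (haR i) (hij ▸ haR j)
  have himg : Finset.univ.image a = N.erase y := by
    refine Finset.eq_of_subset_of_card_le (fun v hv => ?_) ?_
    · obtain ⟨i, -, rfl⟩ := Finset.mem_image.1 hv
      exact ha i
    · rw [Finset.card_image_of_injective _ hainj]
      simp
  have hRxy : ∀ i v, v ∈ (R i).verts → v ≠ x ∧ v ≠ y := by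
    intro i v hv
    have := hRW i hv
    simp only [Set.mem_sdiff, Set.mem_insert_iff, Set.mem_singleton_iff] at this
    tauto
  have key : ∀ m ∈ N, ∃ P : G.Subgraph, (P.Connected ∧ P.verts ⊆ W ∧ x ∈ P.verts ∧
      y ∈ P.verts ∧ m ∈ P.verts) ∧ ((m = y ∧ P.verts = {x, y}) ∨
        (m ≠ y ∧ ¬ P.Adj x y ∧ ∃ i, a i = m ∧ P.verts ⊆ (R i).verts ∪ {x, y})) := by
    intro m hm
    have hm' := (hN m).1 hm
    by_cases hmy : m = y
    · subst hmy
      refine ⟨G.subgraphOfAdj hm'.2, ⟨SimpleGraph.Subgraph.subgraphOfAdj_connected _, ?_,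
        by simp, by simp, by simp⟩, Or.inl ⟨rfl, by simp⟩⟩
      simp [Set.insert_subset_iff, hx, hy]
    · have hmi : m ∈ Finset.univ.image a := by
        rw [himg]
        simp [hm, hmy]
      obtain ⟨i, -, rfl⟩ := Finset.mem_image.1 hmi
      have hxa : G.Adj x (a i) := hm'.2
      have hby : G.Adj (b i) y := (hb i).1
      have hbx : b i ≠ x := (hb i).2.1
      refine ⟨(G.subgraphOfAdj hxa ⊔ R i) ⊔ G.subgraphOfAdj hby, ⟨?_, ?_, ?_, ?_, ?_⟩,
        Or.inr ⟨hmy, ?_, i, rfl, ?_⟩⟩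
      · exact connected_sup_of_mem (connected_sup_of_mem
          (SimpleGraph.Subgraph.subgraphOfAdj_connected _) (hR i) (by simp) (haR i))
          (SimpleGraph.Subgraph.subgraphOfAdj_connected _) (Or.inr (hbR i)) (by simp)
      · have h1 := fun v hv => (hRW i (a := v) hv).1
        simp [Set.insert_subset_iff, hx, hy, hm'.1, (hb i).2.2]
        exact h1
      · simp
      · simp
      · simp
      · have h1 : ¬ (R i).Adj x y := fun h => (hRxy i x ((R i).edge_vert h)).1 rfl
        simp [h1, hxy, hxy.symm, hmy, hbx]
      · have h1 := haR i
        have h2 := hbR i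
        intro v hv
        simp only [SimpleGraph.Subgraph.verts_sup, SimpleGraph.subgraphOfAdj_verts, Set.mem_union,
          Set.mem_insert_iff, Set.mem_singleton_iff] at hv ⊢
        rcases hv with (((rfl | rfl) | hv) | (rfl | rfl)) <;> simp [*]
  choose! P hP hP' using key
  refine ⟨P, hP, fun m hm m' hm' hne => ?_⟩
  rcases hP' m hm with ⟨h1, h2⟩ | ⟨h1, h2, i, h3, h4⟩
  · rcases hP' m' hm' with ⟨h1', h2'⟩ | ⟨h1', h2', i', h3', h4'⟩
    · exact absurd (h1.trans h1'.symm) hne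
    · refine Compat.symm (.of_not_adj ?_ h2')
      rw [h2]
      exact Set.inter_subset_right
  · refine .of_not_adj ?_ h2
    rintro v ⟨hv, hv'⟩
    rcases hP' m' hm' with ⟨h1', h2'⟩ | ⟨h1', h2', i', h3', h4'⟩
    · rwa [h2'] at hv'
    · rcases h4 hv with hv | hv
      · rcases h4' hv' with hv' | hv'
        · exact absurd (h3.symm.trans ((congrArg a (hRd i i' v hv hv')).trans h3')) hne
        · exact hv'
      · exact hv

/-- Subgraphs `P t` and `Q t` are joined in pairs through the region `H`. -/
lemma exists_joined_family {H S : Set V} {ι ι' : Type*} {P R : ι → G.Subgraph}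
    {Q : ι' → G.Subgraph} {ρ src : ι → V} {ρ' snk : ι' → V} {π : ι → ι'}
    (hP : ∀ t, (P t).Connected) (hQ : ∀ t, (Q t).Connected) (hR : ∀ t, (R t).Connected)
    (hS : ∀ t u, S ⊆ (P t).verts ∪ (Q u).verts)
    (hρ : ∀ t, ρ t ∈ (P t).verts) (hρ' : ∀ t, ρ' t ∈ (Q t).verts)
    (hsrc : ∀ t, G.Adj (ρ t) (src t)) (hsnk : ∀ t, G.Adj (ρ' t) (snk t))
    (hPH : ∀ t, ∀ v ∈ (P t).verts, v ∉ H) (hQH : ∀ t, ∀ v ∈ (Q t).verts, v ∉ H)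
    (hPP : ∀ t u, t ≠ u → Compat S (P t) (P u)) (hQQ : ∀ t u, t ≠ u → Compat S (Q t) (Q u))
    (hPQ : ∀ t u, Compat S (P t) (Q u)) (hπ : Function.Injective π)
    (hRsrc : ∀ t, src t ∈ (R t).verts) (hRsnk : ∀ t, snk (π t) ∈ (R t).verts)
    (hRH : ∀ t, (R t).verts ⊆ H)
    (hRR : ∀ t u v, v ∈ (R t).verts → v ∈ (R u).verts → t = u) :
    ∃ T : ι → G.Subgraph, (∀ t, (T t).Connected ∧ S ⊆ (T t).verts) ∧
      (∀ t u, t ≠ u → Compat S (T t) (T u)) ∧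
      ∀ K : G.Subgraph, (∀ v ∈ K.verts, v ∉ H) → (∀ t, Compat S K (P t)) →
        (∀ t, Compat S K (Q t)) → ∀ t, Compat S K (T t) := by
  let L : ι → G.Subgraph := fun t =>
    (G.subgraphOfAdj (hsrc t) ⊔ R t) ⊔ G.subgraphOfAdj (hsnk (π t))
  have hL : ∀ t, (L t).Connected := fun t => connected_sup_of_mem (connected_sup_of_mem
    (SimpleGraph.Subgraph.subgraphOfAdj_connected _) (hR t) (by simp) (hRsrc t))
    (SimpleGraph.Subgraph.subgraphOfAdj_connected _) (Or.inr (hRsnk t)) (by simp)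
  have hLv : ∀ t v, v ∈ (L t).verts → v ∈ (R t).verts ∨ v = ρ t ∨ v = ρ' (π t) := by
    intro t v hv
    have h1 := hRsrc t
    have h2 := hRsnk t
    simp only [L, SimpleGraph.Subgraph.verts_sup, SimpleGraph.subgraphOfAdj_verts,
      Set.mem_union, Set.mem_insert_iff, Set.mem_singleton_iff] at hv
    rcases hv with (((rfl | rfl) | hv) | (rfl | rfl)) <;> simp [*]
  have hLe : ∀ t u v, (L t).Adj u v → u ∈ (R t).verts ∨ v ∈ (R t).verts := by
    intro t u v h
    have h1 := hRsrc t
    have h2 := hRsnk t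
    simp only [L, SimpleGraph.Subgraph.sup_adj] at h
    rcases h with ((h | h) | h)
    · simp at h
      rcases h with ⟨rfl, rfl⟩ | ⟨rfl, rfl⟩ <;> simp [*]
    · exact Or.inl ((R t).edge_vert h)
    · simp at h
      rcases h with ⟨rfl, rfl⟩ | ⟨rfl, rfl⟩ <;> simp [*]
  have hKL : ∀ K : G.Subgraph, (∀ v ∈ K.verts, v ∉ H) → ∀ t, Compat S K (P t) →
      Compat S K (Q (π t)) → Compat S K (L t) := by
    intro K hK t h1 h2
    refine ⟨?_, fun u v hKuv hLuv => ?_⟩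
    · rintro v ⟨hv, hv'⟩
      rcases hLv t v hv' with h | rfl | rfl
      · exact absurd (hRH t h) (hK v hv)
      · exact h1.1 ⟨hv, hρ t⟩
      · exact h2.1 ⟨hv, hρ' (π t)⟩
    · rcases hLe t u v hLuv with h | h
      · exact hK _ (K.edge_vert hKuv) (hRH t h)
      · exact hK _ (K.edge_vert hKuv.symm) (hRH t h)
  have hLH : ∀ t v, v ∈ (L t).verts → v ∈ H → v ∈ (R t).verts := by
    intro t v hv hvH
    rcases hLv t v hv with h | rfl | rfl
    · exact h
    · exact absurd hvH (hPH t _ (hρ t))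
    · exact absurd hvH (hQH _ _ (hρ' (π t)))
  have hLL : ∀ t u, t ≠ u → Compat S (L t) (L u) := by
    intro t u htu
    refine ⟨?_, fun v w h h' => ?_⟩
    · rintro v ⟨hv, hv'⟩
      by_cases hvH : v ∈ H
      · exact absurd (hRR t u v (hLH t v hv hvH) (hLH u v hv' hvH)) htu
      · rcases hLv t v hv with h | h | h
        · exact absurd (hRH t h) hvH
        · rcases hLv u v hv' with h' | h' | h'
          · exact absurd (hRH u h') hvH
          · exact (hPP t u htu).1 ⟨h ▸ hρ t, h' ▸ hρ u⟩
          · exact (hPQ t (π u)).1 ⟨h ▸ hρ t, h' ▸ hρ' (π u)⟩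
        · rcases hLv u v hv' with h' | h' | h'
          · exact absurd (hRH u h') hvH
          · exact (hPQ u (π t)).1 ⟨h' ▸ hρ u, h ▸ hρ' (π t)⟩
          · exact (hQQ _ _ (hπ.ne htu)).1 ⟨h ▸ hρ' (π t), h' ▸ hρ' (π u)⟩
    · rcases hLe t v w h with hv | hv
      · exact htu (hRR t u v hv (hLH u v ((L u).edge_vert h') (hRH t hv)))
      · exact htu (hRR t u w hv (hLH u w ((L u).edge_vert h'.symm) (hRH t hv)))
  have hT : ∀ K : G.Subgraph, (∀ v ∈ K.verts, v ∉ H) → ∀ t, Compat S K (P t) →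
      Compat S K (Q (π t)) → Compat S K ((P t ⊔ L t) ⊔ Q (π t)) :=
    fun K hK t h1 h2 => (h1.sup_right (hKL K hK t h1 h2)).sup_right h2
  refine ⟨fun t => (P t ⊔ L t) ⊔ Q (π t), fun t => ⟨?_, ?_⟩, fun t u htu => ?_,
    fun K hK h1 h2 t => hT K hK t (h1 t) (h2 _)⟩
  · exact connected_sup_of_mem (connected_sup_of_mem (hP t) (hL t) (hρ t) (by simp [L]))
      (hQ _) (v := ρ' (π t)) (Or.inr (by simp [L])) (hρ' _)
  · intro v hv
    rcases hS t (π t) hv with h | h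
    exacts [Or.inl (Or.inl h), Or.inr h]
  · refine Compat.sup_left (Compat.sup_left (hT _ (hPH t) u (hPP t u htu) (hPQ _ _)) ?_)
      (hT _ (hQH _) u (hPQ _ _).symm (hQQ _ _ (hπ.ne htu)))
    refine Compat.sup_right (Compat.sup_right ?_ (hLL t u htu)) ?_
    · exact (hKL _ (hPH u) t (hPP _ _ htu.symm) (hPQ _ _)).symm
    · exact (hKL _ (hQH _) t (hPQ _ _).symm (hQQ _ _ (hπ.ne htu.symm))).symm

lemma exists_spanning_tree (K : G.Subgraph) (hK : K.Connected) :
    ∃ T : G.Subgraph, T.verts = K.verts ∧ (∀ u v, T.Adj u v → K.Adj u v) ∧ T.coe.IsTree := by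
  obtain ⟨t, htK, ht⟩ := hK.coe.exists_isTree_le
  refine ⟨{ verts := K.verts
            Adj := fun u v => ∃ (hu : u ∈ K.verts) (hv : v ∈ K.verts), t.Adj ⟨u, hu⟩ ⟨v, hv⟩
            adj_sub := fun ⟨hu, hv, h⟩ => K.adj_sub (htK h)
            edge_vert := fun ⟨hu, hv, h⟩ => hu
            symm := ⟨fun u v ⟨hu, hv, h⟩ => ⟨hv, hu, h.symm⟩⟩ }, rfl,
    fun u v ⟨hu, hv, h⟩ => htK h, ?_⟩
  convert ht using 1
  ext ⟨u, hu⟩ ⟨v, hv⟩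
  simp [hu, hv]

lemma exists_isIDSTFamily_of_compat {S : Set V} {r : ℕ} (T : Fin r → G.Subgraph)
    (hT : ∀ t, (T t).Connected ∧ S ⊆ (T t).verts)
    (hTT : ∀ t u, t ≠ u → Compat S (T t) (T u)) :
    ∃ T : Fin r → G.Subgraph, (∀ i, S ⊆ (T i).verts ∧ ((T i).coe).IsTree) ∧
    ∀ i j, i ≠ j → (T i).verts ∩ (T j).verts = S ∧ (T i).edgeSet ∩ (T j).edgeSet = ∅ := by
  choose T' hv hadj htree using fun t => exists_spanning_tree (T t) (hT t).1
  refine ⟨T', fun t => ⟨hv t ▸ (hT t).2, htree t⟩, fun t u htu => ⟨?_, ?_⟩⟩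
  · rw [hv, hv]
    exact (hTT t u htu).1.antisymm fun v hv => ⟨(hT t).2 hv, (hT u).2 hv⟩
  · refine Set.eq_empty_of_forall_notMem fun e => ?_
    induction e with
    | _ v w =>
      rintro ⟨h, h'⟩
      exact (hTT t u htu).2 v w (hadj _ _ _ h) (hadj _ _ _ h')

end Trees

section

open Equiv

/-- Three distinct positions of a word. -/
structure Frame (α : Type*) where
  a : α
  b : α
  t : α
  hab : a ≠ b
  hat : a ≠ t
  hbt : b ≠ t

namespace Frame

variable {α : Type*} [DecidableEq α] (e : Frame α)

/-- The generator that brings the `q`-th symbol to position `t`. -/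
def gen (q : α) : Perm α :=
  if q = e.a then swap e.a e.t * swap e.a e.b
  else if q = e.b then swap e.a e.b * swap e.a e.t
  else swap e.a e.b * swap e.t q

lemma gen_t (q : α) : e.gen q e.t = q := by
  have := e.hab; have := e.hat; have := e.hbt
  unfold gen
  split_ifs with h1 h2
  · simp [*, swap_apply_of_ne_of_ne e.hat.symm e.hbt.symm]
  · simp [*]
  · simp [swap_apply_of_ne_of_ne h1 h2]

lemma gen_of_ne {q r : α} (ha : r ≠ e.a) (hb : r ≠ e.b) (ht : r ≠ e.t) (hq : r ≠ q) :
    e.gen q r = r := by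
  unfold gen
  split_ifs <;> simp [swap_apply_of_ne_of_ne, *]

lemma gen_self {q : α} (ha : q ≠ e.a) (hb : q ≠ e.b) : e.gen q q = e.t := by
  simp [gen, ha, hb, swap_apply_of_ne_of_ne e.hat.symm e.hbt.symm]

lemma gen_at : e.gen e.t = swap e.a e.b := by
  simp [gen, e.hat.symm, e.hbt.symm, ← Perm.one_def]

lemma exists_gen_mul_gen (q : α) : ∃ q', e.gen q * e.gen q' = 1 := by
  by_cases ha : q = e.a
  · refine ⟨e.b, ?_⟩
    rw [gen, if_pos ha, gen, if_neg e.hab.symm, if_pos rfl]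
    rw [mul_assoc, swap_mul_self_mul, swap_mul_self]
  by_cases hb : q = e.b
  · refine ⟨e.a, ?_⟩
    rw [gen, if_neg ha, if_pos hb, gen, if_pos rfl]
    rw [mul_assoc, swap_mul_self_mul, swap_mul_self]
  · refine ⟨q, ?_⟩
    rw [gen, if_neg ha, if_neg hb]
    have : swap e.a e.b * swap e.t q = swap e.t q * swap e.a e.b := by
      ext r
      have h1 := e.hab
      have h2 := e.hat
      have h3 := e.hbt
      simp only [Perm.mul_apply, swap_apply_def]
      grind
    rw [mul_assoc, this, swap_mul_self_mul, swap_mul_self]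

/-- The Cayley graph of the generators `gen q`. -/
def graph : SimpleGraph (Perm α) where
  Adj u v := ∃ q, v = u * e.gen q
  symm := ⟨by
    rintro u v ⟨q, rfl⟩
    obtain ⟨q', h⟩ := e.exists_gen_mul_gen q
    exact ⟨q', by rw [mul_assoc, h, mul_one]⟩⟩
  loopless := ⟨by
    rintro u ⟨q, h⟩
    have h1 : e.gen q = 1 := by simpa using h.symm
    have h2 := e.gen_t q
    rw [h1] at h2
    rw [← show e.t = q from h2, gen_at, swap_eq_one_iff] at h1
    exact e.hab h1⟩

/-- The neighbour of `u` whose third symbol is `c`. -/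
def nb (u : Perm α) (c : α) : Perm α := u * e.gen (u⁻¹ c)

@[simp] lemma nb_t (u : Perm α) (c : α) : e.nb u c e.t = c := by
  simp [nb, gen_t]

lemma adj_nb (u : Perm α) (c : α) : e.graph.Adj u (e.nb u c) := ⟨_, rfl⟩

lemma eq_nb_of_adj {u v : Perm α} (h : e.graph.Adj u v) : v = e.nb u (v e.t) := by
  obtain ⟨q, rfl⟩ := h
  simp [nb, gen_t]

lemma nb_nb (u : Perm α) (c : α) : e.nb (e.nb u c) (u e.t) = u :=
  (e.eq_nb_of_adj (e.adj_nb u c).symm).symm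

lemma nb_ne (u : Perm α) (c : α) : e.nb u c ≠ u := (e.adj_nb u c).symm.ne

/-- A position outside the frame. -/
def Free (q : α) : Prop := q ≠ e.a ∧ q ≠ e.b ∧ q ≠ e.t

variable {e}

lemma nb_apply {q : α} (hq : e.Free q) {u : Perm α} {c : α} (hc : c ≠ u q) :
    e.nb u c q = u q := by
  rw [nb, Perm.mul_apply, gen_of_ne e hq.1 hq.2.1 hq.2.2]
  rintro rfl
  simp at hc

lemma nb_apply_self {q : α} (hq : e.Free q) (u : Perm α) : e.nb u (u q) q = u e.t := by
  simp [nb, gen_self e hq.1 hq.2.1]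

variable (e) in
/-- The neighbour of `u` with the same third symbol. -/
def sw (u : Perm α) : Perm α := e.nb u (u e.t)

lemma sw_eq (u : Perm α) : e.sw u = u * swap e.a e.b := by
  simp [sw, nb, gen_at]

@[simp] lemma sw_t (u : Perm α) : e.sw u e.t = u e.t := nb_t e u _

lemma sw_apply {q : α} (hq : e.Free q) (u : Perm α) : e.sw u q = u q :=
  nb_apply hq fun h => hq.2.2 (u.injective h).symm

@[simp] lemma sw_sw (u : Perm α) : e.sw (e.sw u) = u := by
  simp [sw_eq, mul_assoc]

lemma sw_ne (u : Perm α) : e.sw u ≠ u := nb_ne e u _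

lemma adj_sw (u : Perm α) : e.graph.Adj u (e.sw u) := adj_nb e u _

lemma nb_nb_self {q : α} (hq : e.Free q) (u : Perm α) :
    e.nb (e.nb u (u q)) (e.nb u (u q) q) = u := by
  rw [nb_apply_self hq, nb_nb]

lemma eq_or_eq_sw {v w : Perm α} (ht : v e.t = w e.t) (h : ∀ q, e.Free q → v q = w q) :
    v = w ∨ v = e.sw w := by
  have h' : ∀ q, q ≠ e.a → q ≠ e.b → v q = w q := by
    intro q ha hb
    by_cases hq : q = e.t
    · rw [hq, ht]
    · exact h q ⟨ha, hb, hq⟩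
  have hcase : ∀ q, w⁻¹ (v q) ≠ q → w⁻¹ (v q) = e.a ∨ w⁻¹ (v q) = e.b := by
    intro q hq
    by_contra! hcon
    have := h' _ hcon.1 hcon.2
    exact hq (v.injective (this.trans (w.apply_symm_apply _)))
  rw [sw_eq]
  by_cases ha : v e.a = w e.a
  · left
    ext q
    by_cases hqa : q = e.a
    · rw [hqa, ha]
    by_cases hqb : q = e.b
    · subst hqb
      by_contra hne
      rcases hcase e.b (fun h => hne (by rw [Perm.inv_eq_iff_eq] at h; exact h)) with h | h
      · rw [Perm.inv_eq_iff_eq, ← ha] at h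
        exact e.hab (v.injective h).symm
      · rw [Perm.inv_eq_iff_eq] at h
        exact hne h
    · exact h' q hqa hqb
  · right
    have h1 : v e.a = w e.b := by
      rcases hcase e.a (fun h => ha (by rw [Perm.inv_eq_iff_eq] at h; exact h)) with h | h
      · rw [Perm.inv_eq_iff_eq] at h
        exact absurd h ha
      · rwa [Perm.inv_eq_iff_eq] at h
    ext q
    by_cases hqa : q = e.a
    · simp [hqa, h1]
    by_cases hqb : q = e.b
    · subst hqb
      by_contra hne
      have hb : w⁻¹ (v e.b) ≠ e.b := by
        intro h
        rw [Perm.inv_eq_iff_eq, ← h1] at h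
        exact e.hab (v.injective h).symm
      rcases hcase e.b hb with h | h
      · rw [Perm.inv_eq_iff_eq] at h
        simp [h] at hne
      · exact hb h
    · rw [h' q hqa hqb, Perm.mul_apply, swap_apply_of_ne_of_ne hqa hqb]

end Frame

/-- A permutation with two prescribed values, close to a given one. -/
lemma exists_perm_apply_eq {α : Type*} [DecidableEq α] (τ : Perm α) {k t c d : α} (hkt : k ≠ t)
    (hcd : c ≠ d) : ∃ σ : Perm α, σ k = c ∧ σ t = d ∧
      ∀ q, q ≠ k → q ≠ t → τ q ≠ c → τ q ≠ d → σ q = τ q := by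
  have h0 : τ k ≠ τ t := τ.injective.ne hkt
  refine ⟨swap (swap (τ k) c (τ t)) d * (swap (τ k) c * τ), ?_, ?_, ?_⟩
  · simp only [Perm.mul_apply, swap_apply_def]
    grind
  · simp only [Perm.mul_apply, swap_apply_def]
    grind
  · intro q hk ht hc hd
    have h1 : τ q ≠ τ k := τ.injective.ne hk
    have h2 : τ q ≠ τ t := τ.injective.ne ht
    simp only [Perm.mul_apply, swap_apply_def]
    grind

namespace Frame

variable {α : Type*}

/-- The permutations that agree with `τ` outside `M`. -/
def Coset (M : Finset α) (τ : Perm α) : Set (Perm α) := {σ | ∀ q ∉ M, σ q = τ q}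

lemma mem_coset_self (M : Finset α) (τ : Perm α) : τ ∈ Coset M τ := fun _ _ => rfl

lemma coset_mono {M M' : Finset α} (h : M ⊆ M') {τ σ : Perm α} (hσ : σ ∈ Coset M' τ) :
    Coset M σ ⊆ Coset M' τ := fun _ hρ q hq => (hρ q fun h' => hq (h h')).trans (hσ q hq)

variable [DecidableEq α] {e : Frame α}

lemma nb_sw_self {q : α} (hq : e.Free q) (u : Perm α) :
    e.nb (e.sw u) (u q) q = u e.t ∧ e.nb (e.sw u) (u q) e.t = u q := by
  have h := sw_apply hq u
  refine ⟨?_, nb_t e _ _⟩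
  rw [← h, nb_apply_self hq, sw_t]

/-- Connected clusters, any two of which are joined by two disjoint edges, form a
connected region as long as fewer than `2 * (#Γ - 1)` vertices are removed. -/
lemma linked_of_clusters {k : α} (hk : e.Free k) {C : Set (Perm α)} {Γ : Finset α}
    {F : Finset (Perm α)}
    (hlink : ∀ u ∈ C \ F, ∀ v ∈ C \ F, u k = v k → u k ∈ Γ → Linked e.graph (C \ F) u v)
    (hcross : ∀ c ∈ Γ, ∀ d ∈ Γ, c ≠ d → ∃ σ ∈ C, σ k = c ∧ σ e.t = d)
    (hnb : ∀ σ ∈ C, σ k ∈ Γ → σ e.t ∈ Γ → e.sw σ ∈ C ∧ e.nb σ (σ k) ∈ C)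
    (hF : (F.filter fun σ => σ e.t ∈ Γ).card < 2 * (Γ.card - 1))
    {u v : Perm α} (hu : u ∈ C \ F) (hv : v ∈ C \ F) (huΓ : u k ∈ Γ) (hvΓ : v k ∈ Γ) :
    Linked e.graph (C \ F) u v := by
  classical
  let X := Γ.filter fun c => ∀ w ∈ C \ F, w k = c → Linked e.graph (C \ F) u w
  let Y := Γ.filter fun c => ¬ ∀ w ∈ C \ F, w k = c → Linked e.graph (C \ F) u w
  have hXY : X.card + Y.card = Γ.card := Finset.card_filter_add_card_filter_not _
  have huX : u k ∈ X := Finset.mem_filter.2 ⟨huΓ, fun w hw hwu => hlink u hu w hw hwu.symm huΓ⟩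
  suffices hY : Y = ∅ by
    have : v k ∈ X := by
      by_contra hvX
      have : v k ∈ Y := by
        rw [Finset.mem_filter] at hvX ⊢
        tauto
      simp [hY] at this
    exact (Finset.mem_filter.1 this).2 v hv rfl
  by_contra hY
  choose! σ hσC hσk hσt using hcross
  let s : (α × α) × Bool → Perm α := fun p => bif p.2 then σ p.1.1 p.1.2 else e.sw (σ p.1.1 p.1.2)
  have hdisj : ∀ c ∈ X, c ∉ Y := fun c hc hc' =>
    (Finset.mem_filter.1 hc').2 (Finset.mem_filter.1 hc).2
  have hs : ∀ p ∈ (X ×ˢ Y) ×ˢ (Finset.univ : Finset Bool),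
      s p ∈ C ∧ s p k = p.1.1 ∧ s p e.t = p.1.2 := by
    rintro ⟨⟨c, d⟩, i⟩ hp
    simp only [Finset.mem_product, Finset.mem_univ, and_true] at hp
    have hc := (Finset.mem_filter.1 hp.1).1
    have hd := (Finset.mem_filter.1 hp.2).1
    have hcd : c ≠ d := fun h => hdisj c hp.1 (h ▸ hp.2)
    have h1 := hσC c hc d hd hcd
    have h2 := hσk c hc d hd hcd
    have h3 := hσt c hc d hd hcd
    cases i
    · simp only [s, cond_false]
      exact ⟨(hnb _ h1 (h2.symm ▸ hc) (h3.symm ▸ hd)).1, (sw_apply hk _).trans h2, (sw_t _).trans h3⟩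
    · exact ⟨h1, h2, h3⟩
  have hblock : ∀ p ∈ (X ×ˢ Y) ×ˢ (Finset.univ : Finset Bool),
      ∃ w ∈ F, w = s p ∨ w = e.nb (s p) (s p k) := by
    intro p hp
    obtain ⟨h1, h2, h3⟩ := hs p hp
    simp only [Finset.mem_product, Finset.mem_univ, and_true] at hp
    have hc := Finset.mem_filter.1 hp.1
    have hd := Finset.mem_filter.1 hp.2
    by_contra! hcon
    have hsF : s p ∉ F := fun h => (hcon _ h).1 rfl
    have hoF : e.nb (s p) (s p k) ∉ F := fun h => (hcon _ h).2 rfl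
    have hoC := (hnb _ h1 (h2.symm ▸ hc.1) (h3.symm ▸ hd.1)).2
    have hok : e.nb (s p) (s p k) k = p.1.2 := (nb_apply_self hk _).trans h3
    refine hd.2 fun w hw hwk => ?_
    refine ((hc.2 (s p) ⟨h1, hsF⟩ h2).trans (.of_adj (adj_nb e _ _) ⟨h1, hsF⟩ ⟨hoC, hoF⟩)).trans ?_
    exact hlink _ ⟨hoC, hoF⟩ w hw (hok.trans hwk.symm) (hok.symm ▸ hd.1)
  choose! f hfF hf using hblock
  have hcard : ((X ×ˢ Y) ×ˢ (Finset.univ : Finset Bool)).card ≤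
      (F.filter fun σ => σ e.t ∈ Γ).card := by
    refine Finset.card_le_card_of_injOn f (fun p hp => ?_) fun p hp p' hp' hpp => ?_
    · obtain ⟨h1, h2, h3⟩ := hs p hp
      have hp' := hp
      simp only [Finset.coe_product, Set.mem_prod, Finset.mem_coe] at hp'
      refine Finset.mem_coe.2 (Finset.mem_filter.2 ⟨hfF p hp, ?_⟩)
      rcases hf p hp with h | h
      · rw [h, h3]
        exact (Finset.mem_filter.1 hp'.1.2).1
      · rw [h, nb_t, h2]
        exact (Finset.mem_filter.1 hp'.1.1).1
    · obtain ⟨h1, h2, h3⟩ := hs p hp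
      obtain ⟨h1', h2', h3'⟩ := hs p' hp'
      have hX : p.1.1 ∈ X := by simp at hp; exact hp.1
      have hX' : p'.1.1 ∈ X := by simp at hp'; exact hp'.1
      have hY : p.1.2 ∈ Y := by simp at hp; exact hp.2
      have hY' : p'.1.2 ∈ Y := by simp at hp'; exact hp'.2
      have hss : s p = s p' := by
        rcases hf p hp with h | h <;> rcases hf p' hp' with h' | h'
        · rw [← h, ← h', hpp]
        · have : s p k = p'.1.2 := by rw [← h, hpp, h', nb_apply_self hk, h3']
          exact absurd (this ▸ h2 ▸ hX) fun h => hdisj _ h hY'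
        · have : s p' k = p.1.2 := by rw [← h', ← hpp, h, nb_apply_self hk, h3]
          exact absurd (this ▸ h2' ▸ hX') fun h => hdisj _ h hY
        · rw [← nb_nb_self hk (s p), ← nb_nb_self hk (s p'), ← h, ← h', hpp]
      have h11 : p.1 = p'.1 := Prod.ext (by rw [← h2, ← h2', hss]) (by rw [← h3, ← h3', hss])
      refine Prod.ext h11 ?_
      simp only [s, h11] at hss
      cases h : p.2 <;> cases h' : p'.2 <;> simp only [h, h', cond_true, cond_false] at hss ⊢
      · exact absurd hss (sw_ne _)
      · exact absurd hss.symm (sw_ne _)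
  rw [Finset.card_product, Finset.card_product, Finset.card_univ, Fintype.card_bool] at hcard
  have hX1 : 0 < X.card := Finset.card_pos.2 ⟨_, huX⟩
  have hY1 : 0 < Y.card := Finset.card_pos.2 (Finset.nonempty_iff_ne_empty.2 hY)
  have : X.card + Y.card ≤ X.card * Y.card + 1 := by nlinarith
  omega

lemma apply_mem_image_of_mem_coset {M : Finset α} {τ σ : Perm α} (hσ : σ ∈ Coset M τ)
    {q : α} (hq : q ∈ M) : σ q ∈ M.image τ := by
  by_contra h
  have h1 : τ⁻¹ (σ q) ∉ M := fun h' => h (Finset.mem_image.2 ⟨_, h', τ.apply_symm_apply _⟩)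
  have h2 := hσ _ h1
  have h3 : τ⁻¹ (σ q) = q := σ.injective (h2.trans (τ.apply_symm_apply _))
  exact h1 (h3.symm ▸ hq)

lemma nb_mem_coset {M : Finset α} (ha : e.a ∈ M) (hb : e.b ∈ M) (ht : e.t ∈ M) {τ σ : Perm α}
    (hσ : σ ∈ Coset M τ) {c : α} (hc : c ∈ M.image τ) : e.nb σ c ∈ Coset M τ := by
  intro q hq
  have hfree : e.Free q := ⟨fun h => hq (h ▸ ha), fun h => hq (h ▸ hb), fun h => hq (h ▸ ht)⟩
  rw [nb_apply hfree, hσ q hq]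
  rw [hσ q hq]
  rintro rfl
  obtain ⟨r, hr, hrq⟩ := Finset.mem_image.1 hc
  exact hq (τ.injective hrq ▸ hr)

/-- The subgraph on a coset of `Perm M` is `#M`-connected, up to complete graphs. -/
lemma linked_coset (N : Finset α) (hN : ∀ q ∈ N, e.Free q) :
    ∀ (τ : Perm α) (F : Finset (Perm α)), F.card < N.card + 3 →
      ∀ u ∈ Coset ({e.a, e.b, e.t} ∪ N) τ \ F, ∀ v ∈ Coset ({e.a, e.b, e.t} ∪ N) τ \ F,
        Linked e.graph (Coset ({e.a, e.b, e.t} ∪ N) τ \ F) u v := by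
  have hab := e.hab
  have hat := e.hat
  have hbt := e.hbt
  induction N using Finset.induction_on with
  | empty =>
    intro τ F hF u hu v hv
    rw [Finset.union_empty] at hu hv ⊢
    set M : Finset α := {e.a, e.b, e.t} with hM
    have hMc : (M.image τ).card = 3 := by
      rw [Finset.card_image_of_injective _ τ.injective, hM, Finset.card_eq_three]
      exact ⟨_, _, _, hab, hat, hbt, rfl⟩
    obtain ⟨d, hd, hdF⟩ := Finset.exists_mem_notMem_of_card_lt_card
      (s := F.image fun σ => σ e.t) (t := M.image τ)
      (Finset.card_image_le.trans_lt (by simpa [hMc] using hF))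
    have hdF' : ∀ σ : Perm α, σ e.t = d → σ ∉ F := fun σ hσ hσF =>
      hdF (Finset.mem_image.2 ⟨σ, hσF, hσ⟩)
    have key : ∀ w ∈ Coset M τ \ F, ∃ w' ∈ Coset M τ, w' e.t = d ∧
        Linked e.graph (Coset M τ \ F) w w' := by
      intro w hw
      have h1 : e.nb w d ∈ Coset M τ :=
        nb_mem_coset (by simp [M]) (by simp [M]) (by simp [M]) hw.1 hd
      exact ⟨_, h1, nb_t e _ _, .of_adj (adj_nb e _ _) hw ⟨h1, hdF' _ (nb_t e _ _)⟩⟩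
    obtain ⟨u', hu', hut, hul⟩ := key u hu
    obtain ⟨v', hv', hvt, hvl⟩ := key v hv
    refine hul.trans (Linked.trans ?_ hvl.symm)
    have hfree : ∀ q, e.Free q → v' q = u' q := by
      intro q hq
      have hqM : q ∉ M := by
        simp only [M, Finset.mem_insert, Finset.mem_singleton]
        have := hq.1; have := hq.2.1; have := hq.2.2
        tauto
      rw [hv' q hqM, hu' q hqM]
    rcases eq_or_eq_sw (hvt.trans hut.symm) hfree with h | h
    · exact h ▸ hul.symm.trans hul
    · rw [h]
      exact .of_adj (adj_sw _) ⟨hu', hdF' _ hut⟩ ⟨h ▸ hv', hdF' _ ((sw_t _).trans hut)⟩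
  | insert k N hkN ih =>
    intro τ F hF u hu v hv
    have hk : e.Free k := hN k (by simp)
    have ih := ih fun q hq => hN q (Finset.mem_insert_of_mem hq)
    rw [Finset.card_insert_of_notMem hkN] at hF
    set M' : Finset α := {e.a, e.b, e.t} ∪ N with hM'
    have hMM : {e.a, e.b, e.t} ∪ insert k N = insert k M' := by rw [Finset.union_insert]
    rw [hMM] at hu hv ⊢
    set M := insert k M' with hM
    have hkM' : k ∉ M' := by
      have := hk.1; have := hk.2.1; have := hk.2.2
      simp [M', *]
    have hM'c : M'.card = N.card + 3 := by
      rw [hM', Finset.card_union_of_disjoint, add_comm,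
        Finset.card_eq_three.2 ⟨_, _, _, hab, hat, hbt, rfl⟩]
      rw [Finset.disjoint_right]
      intro q hq
      have := hN q (Finset.mem_insert_of_mem hq)
      simp [this.1, this.2.1, this.2.2]
    have hMc : (M.image τ).card = N.card + 4 := by
      rw [Finset.card_image_of_injective _ τ.injective, hM, Finset.card_insert_of_notMem hkM', hM'c]
    have haM : e.a ∈ M := by simp [M, M']
    have hbM : e.b ∈ M := by simp [M, M']
    have htM : e.t ∈ M := by simp [M, M']
    have hkM : k ∈ M := by simp [M]
    have hsub : M' ⊆ M := Finset.subset_insert _ _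
    have hlink : ∀ c, (F.filter fun σ => σ k = c).card < N.card + 3 →
        ∀ u ∈ Coset M τ \ F, ∀ v ∈ Coset M τ \ F, u k = v k → u k = c →
          Linked e.graph (Coset M τ \ F) u v := by
      intro c hc u hu v hv huv huc
      have hvu : v ∈ Coset M' u := by
        intro q hq
        by_cases hqk : q = k
        · rw [hqk, huv]
        · have : q ∉ M := by simp [M, hqk, hq]
          rw [hv.1 q this, hu.1 q this]
      refine (ih u (F.filter fun σ => σ k = c) hc u ⟨mem_coset_self _ _, fun h => hu.2 ?_⟩ v
        ⟨hvu, fun h => hv.2 ?_⟩).mono le_rfl ?_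
      · exact (Finset.mem_filter.1 h).1
      · exact (Finset.mem_filter.1 h).1
      · intro w hw
        refine ⟨coset_mono hsub hu.1 hw.1, fun hwF => hw.2 ?_⟩
        exact Finset.mem_filter.2 ⟨hwF, (hw.1 k hkM').trans huc⟩
    have hcross : ∀ c ∈ M.image τ, ∀ d ∈ M.image τ, c ≠ d →
        ∃ σ ∈ Coset M τ, σ k = c ∧ σ e.t = d := by
      intro c hc d hd hcd
      obtain ⟨σ, h1, h2, h3⟩ := exists_perm_apply_eq τ hk.2.2 hcd
      refine ⟨σ, fun q hq => h3 q (fun h => hq (h ▸ hkM)) (fun h => hq (h ▸ htM)) ?_ ?_, h1, h2⟩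
      · rintro rfl
        obtain ⟨r, hr, hrq⟩ := Finset.mem_image.1 hc
        exact hq (τ.injective hrq ▸ hr)
      · rintro rfl
        obtain ⟨r, hr, hrq⟩ := Finset.mem_image.1 hd
        exact hq (τ.injective hrq ▸ hr)
    have hnb : ∀ σ ∈ Coset M τ, e.sw σ ∈ Coset M τ ∧ e.nb σ (σ k) ∈ Coset M τ := fun σ hσ =>
      ⟨nb_mem_coset haM hbM htM hσ (apply_mem_image_of_mem_coset hσ htM),
        nb_mem_coset haM hbM htM hσ (apply_mem_image_of_mem_coset hσ hkM)⟩
    by_cases hall : ∀ c, (F.filter fun σ => σ k = c).card < N.card + 3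
    · refine linked_of_clusters hk (Γ := M.image τ) (fun u hu v hv h _ => hlink _ (hall _) u hu v hv
        h rfl) hcross (fun σ hσ _ _ => hnb σ hσ) ?_ hu hv
        (apply_mem_image_of_mem_coset hu.1 hkM) (apply_mem_image_of_mem_coset hv.1 hkM)
      have := Finset.card_filter_le F fun σ => σ e.t ∈ M.image τ
      omega
    · push Not at hall
      obtain ⟨c, hc⟩ := hall
      have hFc : ∀ σ ∈ F, σ k = c := by
        have : F.filter (fun σ => σ k = c) = F :=
          Finset.eq_of_subset_of_card_le (Finset.filter_subset _ _) (by omega)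
        intro σ hσ
        rw [← this] at hσ
        exact (Finset.mem_filter.1 hσ).2
      have hex : ∀ w ∈ Coset M τ \ F, ∃ w' ∈ Coset M τ \ F, w' k ∈ (M.image τ).erase c ∧
          Linked e.graph (Coset M τ \ F) w w' := by
        intro w hw
        by_cases hwc : w k = c
        · have h1 := (hnb w hw.1).2
          have h2 : e.nb w (w k) k = w e.t := nb_apply_self hk w
          have h3 : w e.t ≠ c := fun h => hk.2.2 (w.injective (hwc.trans h.symm))
          have h4 : e.nb w (w k) ∉ F := fun h => h3 (h2 ▸ hFc _ h)
          have h5 := Finset.mem_erase.2 ⟨h3, apply_mem_image_of_mem_coset hw.1 htM⟩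
          exact ⟨_, ⟨h1, h4⟩, h2.symm ▸ h5, .of_adj (adj_nb e _ _) hw ⟨h1, h4⟩⟩
        · exact ⟨w, hw, Finset.mem_erase.2 ⟨hwc, apply_mem_image_of_mem_coset hw.1 hkM⟩, .refl hw⟩
      obtain ⟨u', hu', huk, hul⟩ := hex u hu
      obtain ⟨v', hv', hvk, hvl⟩ := hex v hv
      refine hul.trans (Linked.trans ?_ hvl.symm)
      refine linked_of_clusters hk (Γ := (M.image τ).erase c) (fun u hu v hv h h' => hlink (u k) ?_
        u hu v hv h rfl) (fun c hc d hd => hcross c (Finset.mem_of_mem_erase hc) d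
        (Finset.mem_of_mem_erase hd)) (fun σ hσ _ _ => hnb σ hσ) ?_ hu' hv' huk hvk
      · rw [Finset.filter_false_of_mem fun σ hσ h => (Finset.mem_erase.1 h').1
          (h.symm.trans (hFc σ hσ))]
        simp
      · have h1 := Finset.card_filter_le F fun σ => σ e.t ∈ (M.image τ).erase c
        have h2 := Finset.pred_card_le_card_erase (s := M.image τ) (a := c)
        omega

end Frame

lemma forall_mem_verts_of_connected {V : Type*} {G : SimpleGraph V} {K : G.Subgraph}
    (hK : K.Connected) {p : V → Prop} {x : V} (hx : x ∈ K.verts) (hpx : p x)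
    (hp : ∀ u v, K.Adj u v → p u → p v) : ∀ y ∈ K.verts, p y := by
  intro y hy
  obtain ⟨w⟩ := hK.coe.preconnected ⟨x, hx⟩ ⟨y, hy⟩
  have : ∀ {u v : K.verts}, K.coe.Walk u v → p u → p v := by
    intro u v w
    induction w with
    | nil => exact id
    | cons h w ih => exact fun hu => ih (hp _ _ h hu)
  exact this w hpx

lemma exists_apply_notMem {ι β : Type*} [Fintype ι] {f : ι → β} (hf : f.Injective)
    {F : Finset β} (hF : F.card < Fintype.card ι) : ∃ s, f s ∉ F := by
  obtain ⟨v, hv, hvF⟩ := Finset.exists_mem_notMem_of_card_lt_card (s := F)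
    (t := Finset.univ.map ⟨f, hf⟩) (by simpa using hF)
  obtain ⟨s, -, rfl⟩ := Finset.mem_map.1 hv
  exact ⟨s, hvF⟩

namespace Frame

lemma apply_t_ne {α : Type*} {e : Frame α} {k i : α} (hk : e.Free k) {u : Perm α} (hu : u k = i) :
    u e.t ≠ i := by
  rw [← hu]
  exact u.injective.ne hk.2.2.symm

variable {α : Type*} [DecidableEq α] {e : Frame α} {k i j : α}

variable (e) in
/-- Connected subgraphs containing `x` and `y`, disjoint otherwise, lying in the clusters
`i` and `j`, and rooted at vertices that have a neighbour outside these clusters. -/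
structure Fan (k i j : α) (x y : Perm α) {ι : Type*} (P : ι → e.graph.Subgraph)
    (ρ : ι → Perm α) : Prop where
  connected : ∀ s, (P s).Connected
  left_mem : ∀ s, x ∈ (P s).verts
  right_mem : ∀ s, y ∈ (P s).verts
  apply_eq : ∀ s, ∀ v ∈ (P s).verts, v k = i ∨ v k = j
  root_mem : ∀ s, ρ s ∈ (P s).verts
  root_apply : ∀ s, ρ s e.t ≠ i ∧ ρ s e.t ≠ j
  compat : ∀ s s', s ≠ s' → Compat {x, y} (P s) (P s')
  inj : ρ.Injective

namespace Fan

variable {x y : Perm α} {ι : Type*} {P : ι → e.graph.Subgraph} {ρ : ι → Perm α}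

lemma comp (h : e.Fan k i j x y P ρ) {κ : Type*} {f : κ → ι} (hf : f.Injective) :
    e.Fan k i j x y (P ∘ f) (ρ ∘ f) :=
  ⟨fun _ => h.1 _, fun _ => h.2 _, fun _ => h.3 _, fun _ => h.4 _, fun _ => h.5 _,
    fun _ => h.6 _, fun _ _ hs => h.7 _ _ (hf.ne hs), h.inj.comp hf⟩

lemma swap_ends (h : e.Fan k i j x y P ρ) : e.Fan k i j y x P ρ :=
  ⟨h.1, h.3, h.2, h.4, h.5, h.6, Set.pair_comm x y ▸ h.7, h.8⟩

end Fan

lemma exists_fan_of_root (hk : e.Free k) (hij : i ≠ j) {x y : Perm α}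
    {P : α → e.graph.Subgraph}
    (hP : ∀ c, c ≠ i → (P c).Connected ∧ (∀ v ∈ (P c).verts, v k = i) ∧ x ∈ (P c).verts ∧
        y ∈ (P c).verts ∧ e.nb x c ∈ (P c).verts)
    (hPP : ∀ c d, c ≠ i → d ≠ i → c ≠ d → Compat {x, y} (P c) (P d)) {r : Perm α}
    (hr : r ∈ (P j).verts) (hrt : r e.t ≠ j) (hrn : ∀ c, c ≠ i → c ≠ j → e.nb x c ≠ r) :
    ∃ (P : {c // c ≠ i} → e.graph.Subgraph) (ρ : {c // c ≠ i} → Perm α),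
      e.Fan k i j x y P ρ ∧ (∀ s, ∀ v ∈ (P s).verts, v k = i) ∧
      ∀ s, s.1 ≠ j → ρ s e.t = s.1 := by
  refine ⟨fun s => P s, fun s => if s.1 = j then r else e.nb x s, ⟨fun s => (hP _ s.2).1,
    fun s => (hP _ s.2).2.2.1, fun s => (hP _ s.2).2.2.2.1,
    fun s v hv => Or.inl ((hP _ s.2).2.1 v hv), fun s => ?_, fun s => ?_, fun s s' hs =>
    hPP _ _ s.2 s'.2 (Subtype.coe_injective.ne hs), fun s s' hs => ?_⟩,
    fun s => (hP _ s.2).2.1, fun s hs => ?_⟩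
  · by_cases h : s.1 = j
    · simpa [h] using hr
    · simpa [h] using (hP _ s.2).2.2.2.2
  · by_cases h : s.1 = j
    · simpa [h] using ⟨apply_t_ne hk ((hP j hij.symm).2.1 r hr), hrt⟩
    · simpa [h] using s.2
  · by_cases h : s.1 = j <;> by_cases h' : s'.1 = j
    · exact Subtype.ext (h.trans h'.symm)
    · simp only [h, h', if_true, if_false] at hs
      exact absurd hs.symm (hrn _ s'.2 h')
    · simp only [h, h', if_true, if_false] at hs
      exact absurd hs (hrn _ s.2 h)
    · simp only [h, h', if_false] at hs
      refine Subtype.ext ?_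
      rw [← nb_t e x s.1, hs, nb_t]
  · simp [hs]

variable [Fintype α]

lemma three_lt_card (hk : e.Free k) : 4 ≤ Fintype.card α := by
  have h : ({e.a, e.b, e.t, k} : Finset α).card = 4 := by
    have := e.hab; have := e.hat; have := e.hbt
    have h1 := hk.1.symm; have h2 := hk.2.1.symm; have h3 := hk.2.2.symm
    rw [Finset.card_insert_of_notMem, Finset.card_eq_three.2 ⟨_, _, _, _, _, _, rfl⟩] <;> simp [*]
  exact h ▸ Finset.card_le_univ _

/-- A cluster is connected after the removal of fewer than `#α - 1` vertices. -/
lemma linked_cluster (hk : e.Free k) {F : Finset (Perm α)} (hF : F.card < Fintype.card α - 1)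
    {u v : Perm α} (hu : u ∉ F) (hv : v ∉ F) (huv : u k = v k) :
    Linked e.graph ({σ | σ k = u k} \ F) u v := by
  have hab := e.hab
  have hat := e.hat
  have hbt := e.hbt
  have hk1 := hk.1; have hk2 := hk.2.1; have hk3 := hk.2.2
  have hM : ({e.a, e.b, e.t} ∪ ({e.a, e.b, e.t, k} : Finset α)ᶜ) = Finset.univ.erase k := by
    ext q
    simp only [Finset.mem_union, Finset.mem_insert, Finset.mem_singleton, Finset.mem_compl,
      Finset.mem_erase, Finset.mem_univ, and_true]
    by_cases q = k <;> grind
  have hC : Coset (Finset.univ.erase k) u = {σ | σ k = u k} := by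
    ext σ
    simp [Coset]
  have hcard : (({e.a, e.b, e.t, k} : Finset α)ᶜ).card + 3 = Fintype.card α - 1 := by
    have h4 := three_lt_card hk
    rw [Finset.card_compl, Finset.card_insert_of_notMem,
      Finset.card_eq_three.2 ⟨_, _, _, hbt, hk2.symm, hk3.symm, rfl⟩]
    · omega
    · simp [hab, hat, hk1.symm]
  have h := linked_coset (e := e) ({e.a, e.b, e.t, k} : Finset α)ᶜ (fun q hq => by
    simp at hq; exact ⟨hq.1, hq.2.1, hq.2.2.1⟩) u F (by omega) u
  rw [hM, hC] at h
  exact h ⟨rfl, hu⟩ v ⟨huv.symm, hv⟩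

/-- The subgraphs joining `x` to `y` inside their cluster. -/
lemma exists_cluster_paths (hk : e.Free k) {x y : Perm α} (hxy : x ≠ y) (hx : x k = i)
    (hy : y k = i) : ∃ P : α → e.graph.Subgraph,
      (∀ c, c ≠ i → (P c).Connected ∧ (∀ v ∈ (P c).verts, v k = i) ∧ x ∈ (P c).verts ∧
        y ∈ (P c).verts ∧ e.nb x c ∈ (P c).verts) ∧
      ∀ c d, c ≠ i → d ≠ i → c ≠ d → Compat {x, y} (P c) (P d) := by
  have hinj : Function.Injective (e.nb x) := fun c d h => by
    rw [← nb_t e x c, h, nb_t]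
  obtain ⟨P, hP, hPP⟩ := exists_internally_disjoint (G := e.graph) {σ | σ k = i}
    (Fintype.card α - 1) (fun F hF u hu v hv => by
      have := linked_cluster hk hF hu.2 hv.2 (hu.1.trans hv.1.symm)
      rwa [show u k = i from hu.1] at this) hxy hx hy ((Finset.univ.erase i).image (e.nb x))
    (fun m => by
      simp only [Finset.mem_image, Finset.mem_erase, Finset.mem_univ, and_true]
      constructor
      · rintro ⟨c, hc, rfl⟩
        exact ⟨(nb_apply hk (hx ▸ hc)).trans hx, adj_nb e _ _⟩
      · rintro ⟨hm, hadj⟩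
        refine ⟨m e.t, ?_, (eq_nb_of_adj e hadj).symm⟩
        rw [← show m k = i from hm]
        exact m.injective.ne hk.2.2.symm)
    (by rw [Finset.card_image_of_injective _ hinj]; simp)
  have hmem : ∀ c, c ≠ i → e.nb x c ∈ (Finset.univ.erase i).image (e.nb x) := fun c hc =>
    Finset.mem_image_of_mem _ (by simp [hc])
  refine ⟨fun c => P (e.nb x c), fun c hc => ?_, fun c d hc hd hcd =>
    hPP _ (hmem c hc) _ (hmem d hd) (hinj.ne hcd)⟩
  obtain ⟨h1, h2, h3, h4, h5⟩ := hP _ (hmem c hc)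
  exact ⟨h1, fun v hv => h2 hv, h3, h4, h5⟩

/-- Linkage through the clusters other than `i` and `j`. -/
lemma exists_linkage (hk : e.Free k) (hij : i ≠ j) {ι ι' : Type*} [Fintype ι] [Fintype ι']
    (hcard : Fintype.card ι = Fintype.card ι') {src : ι → Perm α} {snk : ι' → Perm α}
    (hsrc : src.Injective) (hsnk : snk.Injective) (hsrck : ∀ s, src s k ≠ i ∧ src s k ≠ j)
    (hsnkk : ∀ s, snk s k ≠ i ∧ snk s k ≠ j)
    (h : Fintype.card ι + 2 ≤ Fintype.card α ∨ (Fintype.card ι + 1 = Fintype.card α ∧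
      (∀ s, src s e.t = i ∨ src s e.t = j) ∧ (∀ s, snk s e.t = i ∨ snk s e.t = j) ∧
      ∀ c, c ≠ i → c ≠ j → (∃ s, src s k = c) ∧ ∃ s, snk s k = c)) :
    ∃ (π : ι → ι') (R : ι → e.graph.Subgraph), π.Injective ∧ (∀ s, (R s).Connected) ∧
      (∀ s, src s ∈ (R s).verts) ∧ (∀ s, snk (π s) ∈ (R s).verts) ∧
      (∀ s, (R s).verts ⊆ {σ | σ k ≠ i ∧ σ k ≠ j}) ∧
      ∀ s s' v, v ∈ (R s).verts → v ∈ (R s').verts → s = s' := by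
  have h4 := three_lt_card hk
  have hle : Fintype.card ι + 1 ≤ Fintype.card α := by omega
  let Γ : Finset α := {i, j}ᶜ
  have hΓ : ∀ c, c ∈ Γ ↔ c ≠ i ∧ c ≠ j := fun c => by simp [Γ]
  have hΓc : Γ.card = Fintype.card α - 2 := by
    rw [Finset.card_compl, Finset.card_pair hij]
  obtain ⟨a, b, R, ha, hb, hR, haR, hbR, hRW, hRd⟩ := exists_disjoint_subgraphs e.graph
    {σ | σ k ≠ i ∧ σ k ≠ j} (Set.range src) (Set.range snk) (Fintype.card ι)
    (by rintro _ ⟨s, rfl⟩; exact hsrck s) (by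
    intro F hF
    have hcl : ∀ u ∈ {σ : Perm α | σ k ≠ i ∧ σ k ≠ j} \ F,
        ∀ v ∈ {σ : Perm α | σ k ≠ i ∧ σ k ≠ j} \ F, u k = v k →
        Linked e.graph ({σ : Perm α | σ k ≠ i ∧ σ k ≠ j} \ F) u v := by
      intro u hu v hv huv
      refine (linked_cluster hk (by omega) hu.2 hv.2 huv).mono le_rfl ?_
      rintro w ⟨hw, hwF⟩
      refine ⟨?_, hwF⟩
      rw [Set.mem_ofPred_eq] at hw ⊢
      rw [hw]
      exact hu.1
    by_cases hfew : (F.filter fun σ => σ e.t ∈ Γ).card < 2 * (Γ.card - 1)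
    · obtain ⟨s, hs⟩ := exists_apply_notMem hsrc hF
      obtain ⟨s', hs'⟩ := exists_apply_notMem hsnk (hcard ▸ hF)
      refine ⟨_, ⟨s, rfl⟩, _, ⟨s', rfl⟩, ?_⟩
      refine linked_of_clusters hk (Γ := Γ) (fun u hu v hv huv _ => hcl u hu v hv huv) ?_ ?_ hfew
        ⟨hsrck s, hs⟩ ⟨hsnkk s', hs'⟩ ((hΓ _).2 (hsrck s)) ((hΓ _).2 (hsnkk s'))
      · intro c hc d hd hcd
        obtain ⟨σ, h1, h2, -⟩ := exists_perm_apply_eq (1 : Perm α) hk.2.2 hcd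
        refine ⟨σ, ?_, h1, h2⟩
        rw [Set.mem_ofPred_eq, h1]
        exact (hΓ _).1 hc
      · intro σ hσ h1 h2
        rw [Set.mem_ofPred_eq, Set.mem_ofPred_eq, sw_apply hk, nb_apply_self hk]
        exact ⟨hσ, (hΓ _).1 h2⟩
    · have h1 := Finset.card_filter_le F fun σ => σ e.t ∈ Γ
      rcases h with h | ⟨h, hsrct, hsnkt, hcov⟩
      · omega
      · have hFΓ : F.filter (fun σ => σ e.t ∈ Γ) = F :=
          Finset.eq_of_subset_of_card_le (Finset.filter_subset _ _) (by omega)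
        have hFt : ∀ σ : Perm α, (σ e.t = i ∨ σ e.t = j) → σ ∉ F := by
          intro σ hσ hσF
          rw [← hFΓ, Finset.mem_filter, hΓ] at hσF
          tauto
        obtain ⟨c, hc⟩ : Γ.Nonempty := Finset.card_pos.1 (by omega)
        rw [hΓ] at hc
        obtain ⟨⟨s, hs⟩, s', hs'⟩ := hcov c hc.1 hc.2
        exact ⟨_, ⟨s, rfl⟩, _, ⟨s', rfl⟩, hcl _ ⟨hsrck s, hFt _ (hsrct s)⟩ _
          ⟨hsnkk s', hFt _ (hsnkt s')⟩ (hs.trans hs'.symm)⟩)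
  choose s hs using ha
  choose s' hs' using hb
  have hsinj : s.Injective := fun r r' hr =>
    hRd r r' (a r) (haR r) (by rw [← hs, hr, hs]; exact haR r')
  have hsinj' : s'.Injective := fun r r' hr =>
    hRd r r' (b r) (hbR r) (by rw [← hs', hr, hs']; exact hbR r')
  let f : Fin (Fintype.card ι) ≃ ι :=
    Equiv.ofBijective s ((Fintype.bijective_iff_injective_and_card s).2 ⟨hsinj, by simp⟩)
  have hf : ∀ r, s (f.symm r) = r := f.apply_symm_apply
  refine ⟨fun r => s' (f.symm r), fun r => R (f.symm r), hsinj'.comp f.symm.injective,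
    fun r => hR _, fun r => ?_, fun r => ?_, fun r => hRW _, fun r r' v hv hv' =>
    f.symm.injective (hRd _ _ v hv hv')⟩
  · have := haR (f.symm r)
    rwa [← hs, hf] at this
  · rw [hs']
    exact hbR _

namespace Fan

variable {x y z w : Perm α} {ι ι' : Type*} {P : ι → e.graph.Subgraph} {ρ : ι → Perm α}
  {Q : ι' → e.graph.Subgraph} {ρ' : ι' → Perm α}

lemma join [Fintype ι] [Fintype ι'] (hP : e.Fan k i j x y P ρ) (hQ : e.Fan k i j z w Q ρ')
    (hk : e.Free k) (hij : i ≠ j) (hcard : Fintype.card ι = Fintype.card ι')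
    (hPQ : ∀ s s', Compat {x, y, z, w} (P s) (Q s'))
    (h : Fintype.card ι + 2 ≤ Fintype.card α ∨ (Fintype.card ι + 1 = Fintype.card α ∧
      ∀ c, c ≠ i → c ≠ j → (∃ s, ρ s e.t = c) ∧ ∃ s, ρ' s e.t = c)) :
    ∃ T : ι → e.graph.Subgraph,
      (∀ s, (T s).Connected ∧ ({x, y, z, w} : Set (Perm α)) ⊆ (T s).verts) ∧
      (∀ s s', s ≠ s' → Compat {x, y, z, w} (T s) (T s')) ∧
      ∀ K : e.graph.Subgraph, (∀ v ∈ K.verts, v k = i ∨ v k = j) →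
        (∀ s, Compat {x, y, z, w} K (P s)) → (∀ s, Compat {x, y, z, w} K (Q s)) →
        ∀ s, Compat {x, y, z, w} K (T s) := by
  have hnot : ∀ v : Perm α, v k = i ∨ v k = j → v ∉ {σ : Perm α | σ k ≠ i ∧ σ k ≠ j} := by
    intro v hv hv'
    rw [Set.mem_ofPred_eq] at hv'
    tauto
  have hout : Function.Injective fun v : Perm α => e.nb v (v k) :=
    Function.LeftInverse.injective (g := fun v : Perm α => e.nb v (v k)) (nb_nb_self hk)
  obtain ⟨π, R, h1, h2, h3, h4, h5, h6⟩ := exists_linkage (e := e) hk hij hcard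
    (src := fun s => e.nb (ρ s) (ρ s k)) (snk := fun s => e.nb (ρ' s) (ρ' s k))
    (hout.comp hP.inj) (hout.comp hQ.inj)
    (fun s => by simpa only [nb_apply_self hk] using hP.root_apply s)
    (fun s => by simpa only [nb_apply_self hk] using hQ.root_apply s) (by
      refine h.imp id fun h => ⟨h.1, fun s => ?_, fun s => ?_, fun c hc hc' => ?_⟩
      · simpa only [nb_t] using hP.apply_eq s _ (hP.root_mem s)
      · simpa only [nb_t] using hQ.apply_eq s _ (hQ.root_mem s)
      · simpa only [nb_apply_self hk] using h.2 c hc hc')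
  have hS1 : ({x, y} : Set (Perm α)) ⊆ {x, y, z, w} := by grind
  have hS2 : ({z, w} : Set (Perm α)) ⊆ {x, y, z, w} := by grind
  obtain ⟨T, hT, hTT, hK⟩ := exists_joined_family (G := e.graph)
    (H := {σ : Perm α | σ k ≠ i ∧ σ k ≠ j}) (S := {x, y, z, w}) (π := π)
    (src := fun s => e.nb (ρ s) (ρ s k)) (snk := fun s => e.nb (ρ' s) (ρ' s k)) hP.connected
    hQ.connected h2 (fun s s' => by
      have := hP.left_mem s; have := hP.right_mem s
      have := hQ.left_mem s'; have := hQ.right_mem s'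
      simp [Set.insert_subset_iff, *])
    hP.root_mem hQ.root_mem (fun s => adj_nb e _ _) (fun s => adj_nb e _ _)
    (fun s v hv => hnot v (hP.apply_eq s v hv)) (fun s v hv => hnot v (hQ.apply_eq s v hv))
    (fun s s' hs => (hP.compat s s' hs).mono hS1) (fun s s' hs => (hQ.compat s s' hs).mono hS2)
    hPQ h1 h3 h4 h5 h6
  exact ⟨T, hT, hTT, fun K hK' => hK K fun v hv => hnot v (hK' v hv)⟩

end Fan

/-- Unless `y = sw x` and both have third symbol `j`, the cluster of `x` and `y` contains a
full fan. -/
lemma exists_fan (hk : e.Free k) (hij : i ≠ j) {x y : Perm α} (hxy : x ≠ y) (hx : x k = i)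
    (hy : y k = i) (h : ¬ (x e.t = j ∧ y = e.sw x)) :
    ∃ (P : {c // c ≠ i} → e.graph.Subgraph) (ρ : {c // c ≠ i} → Perm α),
      e.Fan k i j x y P ρ ∧ (∀ s, ∀ v ∈ (P s).verts, v k = i) ∧
      ∀ s, s.1 ≠ j → ρ s e.t = s.1 := by
  by_cases hxt : x e.t = j
  · by_cases hyt : y e.t = j
    · obtain ⟨P, hP, hPP⟩ := exists_cluster_paths hk hxy hx hy
      obtain ⟨r, hr, hrt⟩ : ∃ r ∈ (P j).verts, r e.t ≠ j := by
        by_contra! hcon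
        obtain ⟨h1, h2, h3, h4, h5⟩ := hP j hij.symm
        have := forall_mem_verts_of_connected h1 (p := fun v => v = x ∨ v = e.sw x) h3
          (Or.inl rfl) (fun u v huv hu => by
            have h6 := eq_nb_of_adj e ((P j).adj_sub huv)
            rw [hcon v ((P j).edge_vert huv.symm), ← hcon u ((P j).edge_vert huv)] at h6
            change v = e.sw u at h6
            rcases hu with rfl | rfl
            · exact Or.inr h6
            · exact Or.inl (h6.trans (sw_sw _))) y h4
        rcases this with rfl | h6
        exacts [hxy rfl, h ⟨hxt, h6⟩]
      refine exists_fan_of_root hk hij hP hPP hr hrt fun c hc hcj hcr => hrt ?_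
      have := (hPP j c hij.symm hc hcj.symm).1 ⟨hr, hcr ▸ (hP c hc).2.2.2.2⟩
      rcases this with rfl | rfl
      exacts [hxt, hyt]
    · obtain ⟨P, hP, hPP⟩ := exists_cluster_paths hk hxy.symm hy hx
      obtain ⟨P', ρ, h1, h2⟩ := exists_fan_of_root hk hij hP hPP (hP j hij.symm).2.2.1 hyt
        fun c _ _ => nb_ne e _ _
      exact ⟨P', ρ, h1.swap_ends, h2⟩
  · obtain ⟨P, hP, hPP⟩ := exists_cluster_paths hk hxy hx hy
    exact exists_fan_of_root hk hij hP hPP (hP j hij.symm).2.2.1 hxt fun c _ _ => nb_ne e _ _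

end Frame

section Packing

variable {V : Type*} {G : SimpleGraph V}

/-- There are `r` connected subgraphs containing `S` that share neither edges nor vertices
outside `S`. -/
def HasPacking (G : SimpleGraph V) (S : Set V) (r : ℕ) : Prop :=
  ∃ T : Fin r → G.Subgraph, (∀ t, (T t).Connected ∧ S ⊆ (T t).verts) ∧
    ∀ t u, t ≠ u → Compat S (T t) (T u)

lemma HasPacking.of_fintype {ι : Type*} [Fintype ι] {S : Set V} {r : ℕ}
    (hr : Fintype.card ι = r) (T : ι → G.Subgraph)
    (hT : ∀ t, (T t).Connected ∧ S ⊆ (T t).verts)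
    (hTT : ∀ t u, t ≠ u → Compat S (T t) (T u)) : HasPacking G S r :=
  ⟨fun t => T ((Fintype.equivFinOfCardEq hr).symm t), fun _ => hT _,
    fun _ _ h => hTT _ _ ((Fintype.equivFinOfCardEq hr).symm.injective.ne h)⟩

lemma exists_connected_hit {W U : Set V} {o z : V} (h : Linked G W o z) (hz : z ∈ U) :
    ∃ L : G.Subgraph, L.Connected ∧ L.verts ⊆ W ∧ o ∈ L.verts ∧
      ∃ u ∈ U, u ∈ L.verts ∧ ∀ v ∈ L.verts, v ∈ U → v = u := by
  obtain ⟨p, hp⟩ := h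
  induction p with
  | nil =>
    exact ⟨G.singletonSubgraph _, SimpleGraph.Subgraph.singletonSubgraph_connected,
      by simpa using hp, by simp, _, hz, by simp, by simp⟩
  | cons h p ih =>
    rename_i o b z
    by_cases ho : o ∈ U
    · exact ⟨G.singletonSubgraph o, SimpleGraph.Subgraph.singletonSubgraph_connected,
        by simpa using hp o (by simp), by simp, _, ho, by simp, by simp⟩
    obtain ⟨L, hL, hLW, hbL, u, hu, huL, hLu⟩ := ih hz fun v hv => hp v (by simp [hv])
    refine ⟨G.subgraphOfAdj h ⊔ L, connected_sup_of_mem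
      (SimpleGraph.Subgraph.subgraphOfAdj_connected _) hL (by simp) hbL, ?_, by simp, u, hu,
      Or.inr huL, ?_⟩
    · rintro v (hv | hv)
      · simp only [SimpleGraph.subgraphOfAdj_verts, Set.mem_insert_iff,
          Set.mem_singleton_iff] at hv
        rcases hv with rfl | rfl
        exacts [hp v (by simp), hLW hbL]
      · exact hLW hv
    · rintro v (hv | hv) hvU
      · simp only [SimpleGraph.subgraphOfAdj_verts, Set.mem_insert_iff,
          Set.mem_singleton_iff] at hv
        rcases hv with rfl | rfl
        exacts [absurd hvU ho, hLu v hbL hvU]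
      · exact hLu v hv hvU

end Packing

namespace Frame

variable {α : Type*} [DecidableEq α] {e : Frame α} {k i j : α}

lemma Fan.swap_clusters {x y : Perm α} {ι : Type*} {P : ι → e.graph.Subgraph} {ρ : ι → Perm α}
    (h : e.Fan k i j x y P ρ) : e.Fan k j i x y P ρ :=
  ⟨h.1, h.2, h.3, fun s v hv => (h.4 s v hv).symm, h.5, fun s => (h.6 s).symm, h.7, h.8⟩

lemma nb_sw {x : Perm α} {c : α} : e.nb (e.sw x) c = e.sw (e.nb x c) := by
  by_cases hc : c = x e.t
  · subst hc
    change e.nb (e.sw x) (x e.t) = e.sw (e.sw x)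
    rw [← sw_t, sw_sw]
    exact sw_sw x
  have h := eq_or_eq_sw (e := e) (v := e.nb (e.sw x) c) (w := e.nb x c) (by simp) (by
    intro q hq
    by_cases hcq : c = x q
    · subst hcq
      rw [(nb_sw_self hq x).1, nb_apply_self hq]
    · rw [nb_apply hq hcq, nb_apply hq (by rwa [sw_apply hq]), sw_apply hq])
  refine h.resolve_left fun h => sw_ne (e := e) x ?_
  rw [← nb_nb e x c, ← h]
  conv_rhs => rw [← sw_t (e := e) x, nb_nb]
  rw [h, nb_nb]

lemma nb_inj {x y : Perm α} {c : α} (h : e.nb x c = e.nb y c) (ht : x e.t = y e.t) : x = y := by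
  rw [← nb_nb e x c, h, ht, nb_nb]

/-- `v` is one of `x`, `sw x`, or a neighbour of these with third symbol not `i` or `j`. -/
def Near (e : Frame α) (i j : α) (x v : Perm α) : Prop :=
  (v = x ∨ v = e.sw x) ∨ ∃ c, c ≠ i ∧ c ≠ j ∧ (v = e.nb x c ∨ v = e.nb (e.sw x) c)

lemma Near.false {x o v : Perm α} {c : α} (h : Near e i j x v) (hx : x e.t = j) (ho : o e.t = j)
    (hox : o ≠ x) (hox' : o ≠ e.sw x) (hc : c ≠ j) (hv : v = o ∨ v = e.nb o c) : False := by
  rcases h with h | ⟨d, hd, hd', h⟩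
  · rcases hv with rfl | rfl
    · exact h.elim hox hox'
    · have : e.nb o c e.t = j := by rcases h with h | h <;> simp [h, hx]
      exact hc (by simpa using this)
  · have hvd : v e.t = d := by rcases h with rfl | rfl <;> simp
    rcases hv with rfl | rfl
    · exact hd' (hvd.symm.trans ho)
    · rw [nb_t] at hvd
      subst hvd
      rcases h with h | h
      · exact hox (nb_inj h (ho.trans hx.symm))
      · exact hox' (nb_inj h (ho.trans (hx.symm.trans (sw_t x).symm)))

lemma exists_near_fan (hk : e.Free k) (hij : i ≠ j) {x : Perm α} (hx : x k = i)
    (hxt : x e.t = j) {c₀ : α} (hi : c₀ ≠ i) (hj : c₀ ≠ j) :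
    ∃ (P : {c // c ≠ i} → e.graph.Subgraph) (ρ : {c // c ≠ i} → Perm α),
      e.Fan k i j x (e.sw x) P ρ ∧ (∀ s, s.1 ≠ j → ρ s e.t = s.1) ∧
      ∀ s, ∀ v ∈ (P s).verts, (v k = i ∧ Near e i j x v) ∨
        (v k = j ∧ (v = e.nb x i ∨ v = e.nb (e.nb x i) c₀)) := by
  set o := e.nb x i with ho
  have hok : o k = j := by rw [ho, ← hx, nb_apply_self hk, hxt]
  have hvk : e.nb o c₀ k = j := (nb_apply hk (hok.symm ▸ hj)).trans hok
  have hxk : e.sw x k = i := (sw_apply hk x).trans hx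
  have hnk : ∀ c, c ≠ i → e.nb x c k = i := fun c hc => (nb_apply hk (hx.symm ▸ hc)).trans hx
  have hnk' : ∀ c, c ≠ i → e.sw (e.nb x c) k = i := fun c hc => (sw_apply hk _).trans (hnk c hc)
  have hadj : ∀ c, e.graph.Adj (e.sw (e.nb x c)) (e.sw x) := fun c =>
    nb_sw (x := x) (c := c) ▸ (adj_nb e (e.sw x) c).symm
  let A : α → e.graph.Subgraph := fun c => (e.graph.subgraphOfAdj (adj_nb e x c) ⊔
    e.graph.subgraphOfAdj (adj_sw (e.nb x c))) ⊔ e.graph.subgraphOfAdj (hadj c)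
  let B : e.graph.Subgraph := (e.graph.subgraphOfAdj (adj_sw x).symm ⊔
    e.graph.subgraphOfAdj (adj_nb e x i)) ⊔ e.graph.subgraphOfAdj (adj_nb e o c₀)
  have hA : ∀ c, (A c).Connected := fun c => connected_sup_of_mem (connected_sup_of_mem
    (SimpleGraph.Subgraph.subgraphOfAdj_connected _)
    (SimpleGraph.Subgraph.subgraphOfAdj_connected _) (v := e.nb x c) (by simp) (by simp))
    (SimpleGraph.Subgraph.subgraphOfAdj_connected _) (v := e.sw (e.nb x c)) (by simp) (by simp)
  have hB : B.Connected := connected_sup_of_mem (connected_sup_of_mem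
    (SimpleGraph.Subgraph.subgraphOfAdj_connected _)
    (SimpleGraph.Subgraph.subgraphOfAdj_connected _) (v := x) (by simp) (by simp))
    (SimpleGraph.Subgraph.subgraphOfAdj_connected _) (v := o) (by simp [o]) (by simp)
  have hAv : ∀ c v, v ∈ (A c).verts ↔ v = x ∨ v = e.sw x ∨ v = e.nb x c ∨ v = e.sw (e.nb x c) := by
    intro c v
    simp only [A, SimpleGraph.Subgraph.verts_sup, SimpleGraph.subgraphOfAdj_verts, Set.mem_union,
      Set.mem_insert_iff, Set.mem_singleton_iff]
    tauto
  have hBv : ∀ v, v ∈ B.verts ↔ v = x ∨ v = e.sw x ∨ v = o ∨ v = e.nb o c₀ := by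
    intro v
    simp only [B, SimpleGraph.Subgraph.verts_sup, SimpleGraph.subgraphOfAdj_verts, Set.mem_union,
      Set.mem_insert_iff, Set.mem_singleton_iff]
    tauto
  have hAt : ∀ c v, v ∈ (A c).verts → v = x ∨ v = e.sw x ∨ v e.t = c := by
    intro c v hv
    rcases (hAv c v).1 hv with h | h | rfl | rfl <;> simp [*]
  have hAk : ∀ c, c ≠ i → ∀ v ∈ (A c).verts, v k = i := by
    intro c hc v hv
    rcases (hAv c v).1 hv with rfl | rfl | rfl | rfl
    exacts [hx, hxk, hnk c hc, hnk' c hc]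
  have hAadj : ∀ c, c ≠ j → ¬ (A c).Adj x (e.sw x) := by
    intro c hc h
    have h1 : e.nb x c ≠ e.sw x := fun h => hc (by
      rw [← nb_t e x c, h, sw_t, hxt])
    have h2 := nb_ne e x c
    have h3 := sw_ne (e := e) x
    have h4 : e.sw (e.nb x c) ≠ x := fun h => hc (by
      rw [← nb_t e x c, ← sw_t, h, hxt])
    simp [A, h1, h2, h3, h4, h3.symm] at h
  have hAA : ∀ c d, c ≠ j → c ≠ d → Compat {x, e.sw x} (A c) (A d) := by
    intro c d hc hcd
    refine .of_not_adj ?_ (hAadj c hc)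
    rintro v ⟨hv, hv'⟩
    rcases hAt c v hv with h | h | h
    · exact Or.inl h
    · exact Or.inr h
    · rcases hAt d v hv' with h' | h' | h'
      · exact Or.inl h'
      · exact Or.inr h'
      · exact absurd (h.symm.trans h') hcd
  have hAB : ∀ c, c ≠ i → c ≠ j → Compat {x, e.sw x} (A c) B := by
    intro c hc hcj
    refine .of_not_adj ?_ (hAadj c hcj)
    rintro v ⟨hv, hv'⟩
    have := hAk c hc v hv
    rcases (hBv v).1 hv' with h | h | rfl | rfl
    · exact Or.inl h
    · exact Or.inr h
    · exact absurd (this.symm.trans hok) hij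
    · exact absurd (this.symm.trans hvk) hij
  have hBk : ∀ v ∈ B.verts, (v k = i ∧ Near e i j x v) ∨ (v k = j ∧ (v = o ∨ v = e.nb o c₀)) := by
    intro v hv
    rcases (hBv v).1 hv with rfl | rfl | rfl | rfl
    exacts [.inl ⟨hx, .inl (.inl rfl)⟩, .inl ⟨hxk, .inl (.inr rfl)⟩, .inr ⟨hok, .inl rfl⟩,
      .inr ⟨hvk, .inr rfl⟩]
  refine ⟨fun s => if s.1 = j then B else A s, fun s => if s.1 = j then e.nb o c₀ else e.nb x s,
    ⟨fun s => ?_, fun s => ?_, fun s => ?_, fun s => ?_, fun s => ?_, fun s => ?_,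
      fun s s' hs => ?_, fun s s' hs => ?_⟩, fun s hs => ?_, fun s => ?_⟩
  · split_ifs
    exacts [hB, hA _]
  · split_ifs
    exacts [(hBv _).2 (by simp), (hAv _ _).2 (by simp)]
  · split_ifs
    exacts [(hBv _).2 (by simp), (hAv _ _).2 (by simp)]
  · split_ifs
    exacts [fun v hv => (hBk v hv).imp And.left And.left, fun v hv => Or.inl (hAk _ s.2 v hv)]
  · split_ifs
    exacts [(hBv _).2 (by simp), (hAv _ _).2 (by simp)]
  · split_ifs with h
    · simpa using ⟨hi, hj⟩
    · simpa using ⟨s.2, h⟩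
  · by_cases h : s.1 = j <;> by_cases h' : s'.1 = j <;> simp only [h, h', if_true, if_false]
    · exact absurd (Subtype.ext (h.trans h'.symm)) hs
    · exact (hAB _ s'.2 h').symm
    · exact hAB _ s.2 h
    · exact hAA _ _ h (Subtype.coe_injective.ne hs)
  · by_cases h : s.1 = j <;> by_cases h' : s'.1 = j <;> simp only [h, h', if_true, if_false] at hs
    · exact Subtype.ext (h.trans h'.symm)
    · exact absurd ((hnk _ s'.2).symm.trans (hs ▸ hvk)) hij
    · exact absurd ((hnk _ s.2).symm.trans (hs ▸ hvk)) hij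
    · exact Subtype.ext (by rw [← nb_t e x s.1, hs, nb_t])
  · simp [hs]
  · dsimp only
    split_ifs with h
    · exact hBk
    · intro v hv
      refine Or.inl ⟨hAk _ s.2 v hv, ?_⟩
      rcases (hAv _ v).1 hv with rfl | rfl | rfl | rfl
      exacts [.inl (.inl rfl), .inl (.inr rfl), .inr ⟨_, s.2, h, .inl rfl⟩,
        .inr ⟨_, s.2, h, .inr nb_sw.symm⟩]

lemma fan_of_cluster_paths {x y : Perm α} {P : α → e.graph.Subgraph}
    (hP : ∀ c, c ≠ i → (P c).Connected ∧ (∀ v ∈ (P c).verts, v k = i) ∧ x ∈ (P c).verts ∧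
        y ∈ (P c).verts ∧ e.nb x c ∈ (P c).verts)
    (hPP : ∀ c d, c ≠ i → d ≠ i → c ≠ d → Compat {x, y} (P c) (P d)) :
    e.Fan k i j x y (fun s : {c // c ≠ i ∧ c ≠ j} => P s) fun s => e.nb x s :=
  ⟨fun s => (hP _ s.2.1).1, fun s => (hP _ s.2.1).2.2.1, fun s => (hP _ s.2.1).2.2.2.1,
    fun s v hv => .inl ((hP _ s.2.1).2.1 v hv), fun s => (hP _ s.2.1).2.2.2.2,
    fun s => by simpa using s.2, fun s s' hs => hPP _ _ s.2.1 s'.2.1 (Subtype.coe_injective.ne hs),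
    fun s s' hs => Subtype.ext (by
      change e.nb x s = e.nb x s' at hs
      rw [← nb_t e x s.1, hs, nb_t])⟩

variable [Fintype α]

lemma card_ne_and_ne (hij : i ≠ j) : Fintype.card {c // c ≠ i ∧ c ≠ j} + 2 = Fintype.card α := by
  have h : ({i, j}ᶜ : Finset α).card = Fintype.card {c // c ≠ i ∧ c ≠ j} := by
    rw [Fintype.card_subtype]
    congr 1
    ext c
    simp
  rw [← h, ← Finset.card_pair hij, add_comm, Finset.card_add_card_compl]

lemma hasPacking_of_full_fans (hk : e.Free k) (hij : i ≠ j) {x y z w : Perm α}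
    {P : {c // c ≠ i} → e.graph.Subgraph} {ρ : {c // c ≠ i} → Perm α}
    {Q : {c // c ≠ j} → e.graph.Subgraph} {ρ' : {c // c ≠ j} → Perm α}
    (hP : e.Fan k i j x y P ρ) (hQ : e.Fan k j i z w Q ρ') (hρ : ∀ s, s.1 ≠ j → ρ s e.t = s.1)
    (hρ' : ∀ s, s.1 ≠ i → ρ' s e.t = s.1) (hPQ : ∀ s s', ∀ v ∈ (P s).verts, v ∉ (Q s').verts) :
    HasPacking e.graph {x, y, z, w} (Fintype.card α - 1) := by
  have h4 := three_lt_card hk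
  have hc : ∀ c : α, Fintype.card {d // d ≠ c} = Fintype.card α - 1 := fun c => by
    simp [Fintype.card_subtype_compl]
  obtain ⟨T, hT, hTT, -⟩ := hP.join hQ.swap_clusters hk hij (by rw [hc, hc])
    (fun s s' => .of_disjoint (hPQ s s')) (Or.inr ⟨by rw [hc]; omega, fun c hci hcj =>
      ⟨⟨⟨c, hci⟩, hρ ⟨c, hci⟩ hcj⟩, ⟨⟨c, hcj⟩, hρ' ⟨c, hcj⟩ hci⟩⟩⟩)
  exact .of_fintype (hc i) T hT hTT

/-- If `nb x i` lies in cluster `j`, one of the trees uses the edge from `x` to `nb x i` and the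
subgraph `Q₀`. -/
lemma hasPacking_of_partial_fan (hk : e.Free k) (hij : i ≠ j) {x y z w : Perm α} (hxy : x ≠ y)
    (hx : x k = i) (hy : y k = i) {κ : Type*} [Fintype κ]
    (hκ : Fintype.card κ + 2 = Fintype.card α) {Q₀ : e.graph.Subgraph}
    {Q : κ → e.graph.Subgraph} {ρ' : κ → Perm α} (hQ : e.Fan k j i z w Q ρ')
    (hQk : ∀ s, ∀ v ∈ (Q s).verts, v k = j) (hQ₀ : Q₀.Connected) (hQ₀k : ∀ v ∈ Q₀.verts, v k = j)
    (ho : e.nb x i ∈ Q₀.verts) (hz : z ∈ Q₀.verts) (hw : w ∈ Q₀.verts)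
    (hQQ : ∀ s, Compat {z, w} Q₀ (Q s)) :
    HasPacking e.graph {x, y, z, w} (Fintype.card α - 1) := by
  have hcard := card_ne_and_ne (α := α) hij
  have hS1 : ({x, y} : Set (Perm α)) ⊆ {x, y, z, w} := by grind
  have hS2 : ({z, w} : Set (Perm α)) ⊆ {x, y, z, w} := by grind
  obtain ⟨P, hP, hPP⟩ := exists_cluster_paths hk hxy hx hy
  have hdisj : ∀ {K L : e.graph.Subgraph}, (∀ v ∈ K.verts, v k = i) → (∀ v ∈ L.verts, v k = j) →
      Compat {x, y, z, w} K L := fun hK hL =>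
    .of_disjoint fun v hv hv' => hij ((hK v hv).symm.trans (hL v hv'))
  obtain ⟨T, hT, hTT, hK⟩ := (fan_of_cluster_paths (j := j) hP hPP).join hQ.swap_clusters hk hij
    (by omega) (fun s s' => hdisj (hP _ s.2.1).2.1 (hQk s')) (Or.inl (by omega))
  obtain ⟨h1, h2, h3, h4, -⟩ := hP j hij.symm
  let E := e.graph.subgraphOfAdj (adj_nb e x i)
  have hE : ∀ v ∈ E.verts, v = x ∨ v = e.nb x i := by simp [E]
  have hok := hQ₀k _ ho
  have hT₀ : ∀ s, Compat {x, y, z, w} ((P j ⊔ E) ⊔ Q₀) (T s) := by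
    refine hK _ ?_ (fun s => ?_) (fun s => ?_)
    · rintro v ((hv | hv) | hv)
      · exact Or.inl (h2 v hv)
      · rcases hE v hv with rfl | rfl
        exacts [Or.inl hx, Or.inr hok]
      · exact Or.inr (hQ₀k v hv)
    · refine Compat.sup_left (Compat.sup_left
        ((hPP _ _ hij.symm s.2.1 s.2.2.symm).mono hS1) ?_) (hdisj (hP _ s.2.1).2.1 hQ₀k).symm
      have : E.verts ∩ (P s).verts ⊆ {x} := by
        rintro v ⟨hv, hv'⟩
        rcases hE v hv with rfl | rfl
        · rfl
        · exact absurd (((hP _ s.2.1).2.1 _ hv').symm.trans hok) hij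
      exact .of_subsingleton (this.trans (by simp)) (Set.subsingleton_singleton.anti this)
    · refine Compat.sup_left (Compat.sup_left (hdisj h2 (hQk s)) ?_) ((hQQ s).mono hS2)
      have : E.verts ∩ (Q s).verts ⊆ {e.nb x i} := by
        rintro v ⟨hv, hv'⟩
        rcases hE v hv with rfl | rfl
        · exact absurd (hx.symm.trans (hQk s _ hv')) hij
        · rfl
      refine .of_subsingleton (fun v hv => ?_) (Set.subsingleton_singleton.anti this)
      have hvo : v = e.nb x i := this hv
      exact hS2 ((hQQ s).1 ⟨hvo ▸ ho, hv.2⟩)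
  refine .of_fintype (ι := Option {c // c ≠ i ∧ c ≠ j}) (by rw [Fintype.card_option]; omega)
    (fun s => s.elim ((P j ⊔ E) ⊔ Q₀) T) ?_ ?_
  · rintro (_ | s)
    · refine ⟨connected_sup_of_mem (connected_sup_of_mem h1
        (SimpleGraph.Subgraph.subgraphOfAdj_connected _) h3 (by simp [E])) hQ₀
        (Or.inr (by simp [E])) ho, ?_⟩
      simp [Set.insert_subset_iff, h3, h4, hz, hw]
    · exact hT s
  · rintro (_ | s) (_ | s') hs
    · exact absurd rfl hs
    · exact hT₀ s'
    · exact (hT₀ s).symm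
    · exact hTT s s' fun h => hs (h ▸ rfl)

lemma hasPacking_of_fan (hk : e.Free k) (hij : i ≠ j) {x y z w : Perm α} (hxy : x ≠ y)
    (hx : x k = i) (hy : y k = i) (hxt : x e.t = j) {Q : {c // c ≠ j} → e.graph.Subgraph}
    {ρ' : {c // c ≠ j} → Perm α} (hQ : e.Fan k j i z w Q ρ')
    (hQk : ∀ s, ∀ v ∈ (Q s).verts, v k = j) :
    HasPacking e.graph {x, y, z, w} (Fintype.card α - 1) := by
  have h4 := three_lt_card hk
  have hok : e.nb x i k = j := by rw [← hx, nb_apply_self hk, hxt]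
  have hzk : z k = j := hQk ⟨i, hij⟩ z (hQ.left_mem _)
  obtain ⟨L, hL, hLk, hoL, u, ⟨l, hul⟩, huL, hLu⟩ := exists_connected_hit
    (U := {v | ∃ s, v ∈ (Q s).verts}) (linked_cluster hk (F := ∅) (u := e.nb x i) (v := z)
      (by rw [Finset.card_empty]; omega) (by simp) (by simp) (hok.trans hzk.symm))
    ⟨⟨i, hij⟩, hQ.left_mem _⟩
  have hLk' : ∀ v ∈ L.verts, v k = j := fun v hv => (hLk hv).1.trans hok
  refine hasPacking_of_partial_fan hk hij hxy hx hy (κ := {s : {c // c ≠ j} // s ≠ l})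
    (Q₀ := L ⊔ Q l) ?_ (hQ.comp Subtype.coe_injective) (fun s => hQk _)
    (connected_sup_of_mem hL (hQ.connected l) huL hul) ?_ (Or.inl hoL) (Or.inr (hQ.left_mem l))
    (Or.inr (hQ.right_mem l)) fun s => Compat.sup_left ?_ (hQ.compat _ _ s.2.symm)
  · simp only [ne_eq, Fintype.card_subtype_compl, Fintype.card_unique]
    omega
  · rintro v (hv | hv)
    exacts [hLk' v hv, hQk l v hv]
  · have : L.verts ∩ (Q s).verts ⊆ {u} := fun v hv => hLu v hv.1 ⟨_, hv.2⟩
    refine .of_subsingleton (fun v hv => ?_) (Set.subsingleton_singleton.anti this)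
    have hvu : v = u := this hv
    exact (hQ.compat l s s.2.symm).1 ⟨hvu ▸ hul, hv.2⟩

lemma hasPacking_two_two (hk : e.Free k) (hij : i ≠ j) {x y z w : Perm α} (hxy : x ≠ y)
    (hzw : z ≠ w) (hx : x k = i) (hy : y k = i) (hz : z k = j) (hw : w k = j) :
    HasPacking e.graph {x, y, z, w} (Fintype.card α - 1) := by
  have h4 := three_lt_card hk
  have hS : ({x, y, z, w} : Set (Perm α)) = {z, w, x, y} := by grind
  by_cases hP : x e.t = j ∧ y = e.sw x
  · by_cases hQ : z e.t = i ∧ w = e.sw z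
    · obtain ⟨hxt, rfl⟩ := hP
      obtain ⟨hzt, rfl⟩ := hQ
      by_cases ho : e.nb x i = z ∨ e.nb x i = e.sw z
      · obtain ⟨Q, hQ, hQQ⟩ := exists_cluster_paths hk hzw hz hw
        obtain ⟨h1, h2, h3, h4, -⟩ := hQ i hij
        refine hasPacking_of_partial_fan hk hij hxy hx hy (Q₀ := Q i) (card_ne_and_ne hij.symm)
          (fan_of_cluster_paths (j := i) hQ hQQ) (fun s => (hQ _ s.2.1).2.1) h1 h2 ?_ h3 h4
          fun s => hQQ _ _ hij s.2.1 s.2.2.symm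
        rcases ho with ho | ho <;> rwa [ho]
      · rw [not_or] at ho
        obtain ⟨c₀, hc₀⟩ : (({i, j} : Finset α)ᶜ).Nonempty := by
          rw [← Finset.card_pos, Finset.card_compl, Finset.card_pair hij]
          omega
        simp only [Finset.mem_compl, Finset.mem_insert, Finset.mem_singleton, not_or] at hc₀
        obtain ⟨P, ρ, hP, hρ, hPv⟩ := exists_near_fan hk hij hx hxt hc₀.1 hc₀.2
        obtain ⟨Q, ρ', hQ, hρ', hQv⟩ := exists_near_fan hk hij.symm hz hzt hc₀.2 hc₀.1
        have ho1 : e.nb z j ≠ x := fun h => ho.1 (by rw [← h, ← hzt, nb_nb])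
        have ho2 : e.nb z j ≠ e.sw x := fun h => ho.2 (by
          rw [← sw_sw (e := e) x, ← h, nb_sw, ← hzt, nb_nb])
        refine hasPacking_of_full_fans hk hij hP hQ hρ hρ' fun s s' v hv hv' => ?_
        rcases hPv s v hv with ⟨h1, h2⟩ | ⟨h1, h2⟩
        · rcases hQv s' v hv' with ⟨h1', h2'⟩ | ⟨h1', h2'⟩
          · exact hij (h1.symm.trans h1')
          · exact h2.false hxt (nb_t e _ _) ho1 ho2 hc₀.2 h2'
        · rcases hQv s' v hv' with ⟨h1', h2'⟩ | ⟨h1', h2'⟩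
          · exact h2'.false hzt (nb_t e _ _) ho.1 ho.2 hc₀.1 h2
          · exact hij (h1'.symm.trans h1)
    · obtain ⟨Q, ρ', h1, h2, -⟩ := exists_fan hk hij.symm hzw hz hw hQ
      exact hasPacking_of_fan hk hij hxy hx hy hP.1 h1 h2
  · obtain ⟨P, ρ, h1, h2, h3⟩ := exists_fan hk hij hxy hx hy hP
    by_cases hQ : z e.t = i ∧ w = e.sw z
    · rw [hS]
      exact hasPacking_of_fan hk hij.symm hzw hz hw hQ.1 h1 h2
    · obtain ⟨Q, ρ', h1', h2', h3'⟩ := exists_fan hk hij.symm hzw hz hw hQ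
      exact hasPacking_of_full_fans hk hij h1 h1' h3 h3' fun s s' v hv hv' =>
        hij ((h2 s v hv).symm.trans (h2' s' v hv'))

end Frame

end

/-- The positions that all generators of the godan graph may move. -/
def godanFrame (n : ℕ) (hn : 3 ≤ n) : Frame (Fin n) where
  a := ⟨0, by omega⟩
  b := ⟨1, by omega⟩
  t := ⟨2, by omega⟩
  hab := by simp
  hat := by simp
  hbt := by simp

lemma mem_OmegaStar_iff {n : ℕ} (hn : 3 ≤ n) {s : Equiv.Perm (Fin n)} :
    s ∈ OmegaStar n hn ↔ ∃ q, s = (godanFrame n hn).gen q := by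
  have ha : (godanFrame n hn).gen ⟨0, by omega⟩ = perm123 n hn := by
    simp [Frame.gen, godanFrame, perm123]
  have hb : (godanFrame n hn).gen ⟨1, by omega⟩ = perm132 n hn := by
    simp [Frame.gen, godanFrame, perm132]
  have ht : (godanFrame n hn).gen ⟨2, by omega⟩ = perm12 n hn :=
    (godanFrame n hn).gen_at
  have hq : ∀ q : Fin n, 3 ≤ (q : ℕ) →
      (godanFrame n hn).gen q = perm12 n hn * Equiv.swap ⟨2, by omega⟩ q := by
    intro q hq
    have h0 : q ≠ ⟨0, by omega⟩ := by simp [Fin.ext_iff]; omega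
    have h1 : q ≠ ⟨1, by omega⟩ := by simp [Fin.ext_iff]; omega
    simp [Frame.gen, godanFrame, perm12, h0, h1]
  constructor
  · rintro ((rfl | rfl | rfl) | ⟨q, h, rfl⟩)
    exacts [⟨_, ht.symm⟩, ⟨_, ha.symm⟩, ⟨_, hb.symm⟩, ⟨q, (hq q h).symm⟩]
  · rintro ⟨⟨q, hqn⟩, rfl⟩
    match q, hqn with
    | 0, _ => exact Or.inl (Or.inr (Or.inl ha))
    | 1, _ => exact Or.inl (Or.inr (Or.inr hb))
    | 2, _ => exact Or.inl (Or.inl ht)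
    | q + 3, h => exact Or.inr ⟨⟨q + 3, h⟩, by simp, hq _ (by simp)⟩

lemma godanGraph_eq {n : ℕ} (hn : 3 ≤ n) : godanGraph n hn = (godanFrame n hn).graph := by
  ext u v
  have h : ∀ u v, (∃ s ∈ OmegaStar n hn, u = v * s) ↔ (godanFrame n hn).graph.Adj v u := by
    intro u v
    constructor
    · rintro ⟨s, hs, rfl⟩
      obtain ⟨q, rfl⟩ := (mem_OmegaStar_iff hn).1 hs
      exact ⟨q, rfl⟩
    · rintro ⟨q, rfl⟩
      exact ⟨_, (mem_OmegaStar_iff hn).2 ⟨q, rfl⟩, rfl⟩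
  simp only [godanGraph, SimpleGraph.fromRel_adj, h]
  exact ⟨fun h => h.2.elim .symm id, fun h => ⟨h.ne, Or.inr h⟩⟩

/-- Let n ≥ 4, 4 ≤ m ≤ n, and let S be a set of four distinct vertices of EA_n
such that for distinct i, j exactly two vertices of S have m-th symbol i and
exactly two have m-th symbol j (symbols and positions 0-based). Then there exist
n − 1 pairwise internally edge disjoint S-trees in EA_n. -/
theorem IDSTs_two_two (n m : ℕ) (hn : 4 ≤ n) (hm4 : 4 ≤ m) (hmn : m ≤ n)
    (S : Finset (Equiv.Perm (Fin n))) (hS : S.card = 4) (i j : Fin n) (hij : i ≠ j)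
    (h2i : (S.filter (fun σ => σ (⟨m - 1, by omega⟩ : Fin n) = i)).card = 2)
    (h2j : (S.filter (fun σ => σ (⟨m - 1, by omega⟩ : Fin n) = j)).card = 2) :
    ∃ T : Fin (n - 1) → (godanGraph n (by omega)).Subgraph,
      IsIDSTFamily (godanGraph n (by omega)) (↑S : Set (Equiv.Perm (Fin n))) T := by
  have hk : (godanFrame n (by omega)).Free ⟨m - 1, by omega⟩ := by
    refine ⟨?_, ?_, ?_⟩ <;> simp [godanFrame, Fin.ext_iff] <;> omega
  have hunion : S.filter (fun σ => σ (⟨m - 1, by omega⟩ : Fin n) = i) ∪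
      S.filter (fun σ => σ (⟨m - 1, by omega⟩ : Fin n) = j) = S := by
    refine Finset.eq_of_subset_of_card_le
      (Finset.union_subset (Finset.filter_subset _ _) (Finset.filter_subset _ _)) ?_
    rw [Finset.card_union_of_disjoint, h2i, h2j, hS]
    exact Finset.disjoint_filter.2 fun σ _ h h' => hij (h.symm.trans h')
  obtain ⟨x, y, hxy, hi⟩ := Finset.card_eq_two.1 h2i
  obtain ⟨z, w, hzw, hj⟩ := Finset.card_eq_two.1 h2j
  have hi' : ∀ σ ∈ ({x, y} : Finset (Equiv.Perm (Fin n))), σ ⟨m - 1, by omega⟩ = i :=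
    fun σ hσ => by rw [← hi] at hσ; exact (Finset.mem_filter.1 hσ).2
  have hj' : ∀ σ ∈ ({z, w} : Finset (Equiv.Perm (Fin n))), σ ⟨m - 1, by omega⟩ = j :=
    fun σ hσ => by rw [← hj] at hσ; exact (Finset.mem_filter.1 hσ).2
  have hT := Frame.hasPacking_two_two hk hij hxy hzw (hi' x (by simp))
    (hi' y (by simp)) (hj' z (by simp)) (hj' w (by simp))
  rw [Fintype.card_fin] at hT
  obtain ⟨T, hT, hTT⟩ := hT
  have hSS : (S : Set (Equiv.Perm (Fin n))) = {x, y, z, w} := by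
    rw [← hunion, hi, hj]
    ext σ
    simp
    tauto
  rw [hSS, godanGraph_eq]
  exact exists_isIDSTFamily_of_compat T hT hTT

end Godan
end

section
/- Let n ≥ 4, let m be an integer with 4 ≤ m ≤ n, and let S be a set of four distinct vertices of the godan graph EA_n such that for some pairwise distinct i, j, k ∈ {1,…,n} exactly two vertices of S have m-th symbol i, exactly one vertex of S has m-th symbol j, and exactly one vertex of S has m-th symbol k (i.e., |S ∩ V(EA_n^{m:i})| = 2 and |S ∩ V(EA_n^{m:j})| = |S ∩ V(EA_n^{m:k})| = 1). Then there exist n − 1 pairwise internally edge disjoint S-trees in EA_n. -/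
namespace Godan

section Coloring

variable {V ι : Type*}

/-- The edges of `G` available to the colour `c`, when the vertices outside `S` are coloured by
`κ`, the vertices of `S` carry every colour, and the edges inside `S` are coloured by `ε`. -/
def colorGraph (G : SimpleGraph V) (S : Set V) (κ : V → ι) (ε : Sym2 V → ι) (c : ι) :
    SimpleGraph V where
  Adj a b := G.Adj a b ∧ (a ∈ S ∨ κ a = c) ∧ (b ∈ S ∨ κ b = c) ∧
    (a ∈ S → b ∈ S → ε s(a, b) = c)
  symm := ⟨fun a b ⟨h, ha, hb, hab⟩ =>
    ⟨h.symm, hb, ha, fun h₁ h₂ => by rw [Sym2.eq_swap]; exact hab h₂ h₁⟩⟩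
  loopless := ⟨fun a h => G.loopless.irrefl a h.1⟩

theorem mem_or_color_eq_of_reachable {G : SimpleGraph V} {S : Set V} {κ : V → ι}
    {ε : Sym2 V → ι} {c : ι} {s a : V} (hs : s ∈ S)
    (h : (colorGraph G S κ ε c).Reachable s a) : a ∈ S ∨ κ a = c := by
  rw [SimpleGraph.reachable_iff_reflTransGen] at h
  cases h with
  | refl => exact .inl hs
  | tail _ h => exact h.2.2.1

/-- A connected graph on a vertex set contains a tree on that vertex set. -/
theorem exists_isTree_subgraph [Finite V] {G K : SimpleGraph V} (hK : K ≤ G) (s : V) :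
    ∃ T : G.Subgraph, T.verts = {a | K.Reachable s a} ∧ T.coe.IsTree ∧
      ∀ a b, T.Adj a b → K.Adj a b := by
  obtain ⟨t, ht, htree⟩ :=
    (K.connectedComponentMk s).connected_toSimpleGraph.exists_isTree_le
  have hmem (a : V) : a ∈ K.connectedComponentMk s ↔ K.Reachable s a := by
    change K.connectedComponentMk a = K.connectedComponentMk s ↔ _
    rw [SimpleGraph.ConnectedComponent.eq, SimpleGraph.reachable_comm]
  let T : G.Subgraph := ⟨(K.connectedComponentMk s).supp, fun a b => ∃ ha hb, t.Adj ⟨a, ha⟩ ⟨b, hb⟩,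
    fun ⟨_, _, h⟩ => hK (ht h), fun ⟨h, _⟩ => h, ⟨fun a b ⟨ha, hb, h⟩ => ⟨hb, ha, h.symm⟩⟩⟩
  have hT : T.coe = t := by
    ext a b
    exact ⟨fun ⟨_, _, h⟩ => h, fun h => ⟨a.2, b.2, h⟩⟩
  refine ⟨T, Set.ext hmem, ?_, ?_⟩
  · rw [hT]
    exact htree
  · rintro a b ⟨ha, hb, h⟩
    exact ht h

/-- A colouring all of whose colour graphs join the vertices of `S` yields internally edge
disjoint `S`-trees, one for each colour. -/
theorem exists_isIDSTFamily_of_coloring [Finite V] (G : SimpleGraph V) {S : Set V} (κ : V → ι)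
    (ε : Sym2 V → ι) {r : ℕ} (f : Fin r → ι) (hf : f.Injective) {s : V} (hs : s ∈ S)
    (h : ∀ l, ∀ a ∈ S, (colorGraph G S κ ε (f l)).Reachable s a) :
    ∃ T : Fin r → G.Subgraph, IsIDSTFamily G S T := by
  choose T hTv hTt hTe using fun l =>
    exists_isTree_subgraph (show colorGraph G S κ ε (f l) ≤ G from fun _ _ h => h.1) s
  have hST (l : Fin r) : S ⊆ (T l).verts := fun a ha => by
    rw [hTv]
    exact h l a ha
  have hinter {l l' : Fin r} (hl : l ≠ l') {a : V} (ha : a ∈ (T l).verts)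
      (ha' : a ∈ (T l').verts) : a ∈ S := by
    rw [hTv] at ha ha'
    rcases mem_or_color_eq_of_reachable hs ha with h₁ | h₁
    · exact h₁
    rcases mem_or_color_eq_of_reachable hs ha' with h₂ | h₂
    · exact h₂
    exact absurd (hf (h₁.symm.trans h₂)) hl
  refine ⟨T, fun l => ⟨hST l, hTt l⟩, fun l l' hl => ⟨?_, ?_⟩⟩
  · exact Set.Subset.antisymm (fun a ha => hinter hl ha.1 ha.2)
      fun a ha => ⟨hST l ha, hST l' ha⟩
  · rw [Set.eq_empty_iff_forall_notMem]
    rintro ⟨a, b⟩ ⟨h₁, h₂⟩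
    replace h₁ : (T l).Adj a b := h₁
    replace h₂ : (T l').Adj a b := h₂
    have ha := hinter hl h₁.fst_mem h₂.fst_mem
    have hb := hinter hl h₁.snd_mem h₂.snd_mem
    exact hl (hf (((hTe l a b h₁).2.2.2 ha hb).symm.trans ((hTe l' a b h₂).2.2.2 ha hb)))

end Coloring

section Slices

open Equiv

variable {α : Type*} [DecidableEq α] (e : Fin 3 ↪ α)

/-- The neighbour of `p` with symbol `c` at the position `e 2`. -/
def nbr (p : Perm α) (c : α) : Perm α :=
  swap (p (e 2)) c * p * swap (e 0) (e 1)

@[simp]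
theorem nbr_apply_two (p : Perm α) (c : α) : nbr e p c (e 2) = c := by
  have h₀ : e 2 ≠ e 0 := e.injective.ne (by decide)
  have h₁ : e 2 ≠ e 1 := e.injective.ne (by decide)
  simp [nbr, swap_apply_of_ne_of_ne h₀ h₁]

theorem nbr_apply {b : α} (hb : ∀ i, e i ≠ b) (p : Perm α) (c : α) :
    nbr e p c b = swap (p (e 2)) c (p b) := by
  simp [nbr, swap_apply_of_ne_of_ne (hb 0).symm (hb 1).symm]

theorem nbr_apply_of_ne {b : α} (hb : ∀ i, e i ≠ b) {p : Perm α} {c : α} (hc : p b ≠ c) :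
    nbr e p c b = p b := by
  rw [nbr_apply e hb, swap_apply_of_ne_of_ne (p.injective.ne (hb 2).symm) hc]

@[simp]
theorem nbr_nbr (p : Perm α) (c : α) : nbr e (nbr e p c) (p (e 2)) = p := by
  rw [nbr, nbr_apply_two, nbr, swap_comm c]
  simp [mul_assoc]

theorem nbr_self (p : Perm α) : nbr e p (p (e 2)) = p * swap (e 0) (e 1) := by
  rw [nbr, swap_self]
  rfl

theorem nbr_right_injective (p : Perm α) : (nbr e p).Injective := fun c d h => by
  rw [← nbr_apply_two e p c, h, nbr_apply_two]

theorem nbr_left_cancel {p q : Perm α} {c : α} (h : p (e 2) = q (e 2))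
    (hpq : nbr e p c = nbr e q c) : p = q := by
  rw [← nbr_nbr e p c, hpq, h, nbr_nbr]

theorem nbr_ne (p : Perm α) (c : α) : nbr e p c ≠ p := by
  intro h
  have hc : c = p (e 2) := by rw [← nbr_apply_two e p c, h]
  have h₀ : e 0 ≠ e 1 := e.injective.ne (by decide)
  have := congrArg (fun q : Perm α => q (e 0)) h
  simp only [nbr, hc, swap_self, Perm.mul_apply, swap_apply_left, refl_apply] at this
  exact h₀ (p.injective this).symm

/-- The neighbour of `p` in which the symbol at the position `b` has moved to `e 2`. -/
def out (b : α) (p : Perm α) : Perm α := nbr e p (p b)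

@[simp]
theorem out_apply_two (b : α) (p : Perm α) : out e b p (e 2) = p b := nbr_apply_two ..

theorem out_apply {b : α} (hb : ∀ i, e i ≠ b) (p : Perm α) : out e b p b = p (e 2) := by
  rw [out, nbr_apply e hb, swap_apply_right]

theorem out_out {b : α} (hb : ∀ i, e i ≠ b) (p : Perm α) : out e b (out e b p) = p := by
  rw [out, out_apply e hb, out, nbr_nbr]

theorem out_mul_swap {b : α} (hb : ∀ i, e i ≠ b) (p : Perm α) :
    out e b (p * swap (e 0) (e 1)) = out e b p * swap (e 0) (e 1) := by
  have h₂ : swap (e 0) (e 1) (e 2) = e 2 :=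
    swap_apply_of_ne_of_ne (e.injective.ne (by decide)) (e.injective.ne (by decide))
  have h₃ : swap (e 0) (e 1) b = b := swap_apply_of_ne_of_ne (hb 0).symm (hb 1).symm
  simp only [out, nbr, Perm.mul_apply, h₂, h₃, mul_assoc]

theorem out_injective {b : α} (hb : ∀ i, e i ≠ b) : (out e b).Injective :=
  (show Function.LeftInverse (out e b) (out e b) from out_out e hb).injective

/-- The graph on the permutations in `X` joining each of them to its neighbours in `X`. -/
def within (X : Set (Perm α)) : SimpleGraph (Perm α) where
  Adj p q := p ∈ X ∧ q ∈ X ∧ ∃ c, q = nbr e p c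
  symm := ⟨fun p q ⟨hp, hq, c, h⟩ => ⟨hq, hp, p (e 2), by rw [h, nbr_nbr]⟩⟩
  loopless := ⟨fun p ⟨_, _, c, h⟩ => nbr_ne e p c h.symm⟩

theorem within_mono {X Y : Set (Perm α)} (h : X ⊆ Y) : within e X ≤ within e Y :=
  fun _ _ ⟨hp, hq, hc⟩ => ⟨h hp, h hq, hc⟩

/-- The permutations agreeing with `r` at the positions in `B`. -/
def slice (B : Finset α) (r : Perm α) : Set (Perm α) := {p | ∀ b ∈ B, p b = r b}

variable {e}

theorem reachable_nbr {X : Set (Perm α)} {p : Perm α} {c : α} (hp : p ∈ X) (h : nbr e p c ∈ X) :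
    (within e X).Reachable p (nbr e p c) :=
  SimpleGraph.Adj.reachable ⟨hp, h, c, rfl⟩

theorem nbr_mem_slice {B : Finset α} (hB : ∀ i, e i ∉ B) {r p : Perm α} (hp : p ∈ slice B r)
    {c : α} (hc : ∀ b ∈ B, r b ≠ c) : nbr e p c ∈ slice B r := fun b hb => by
  rw [nbr_apply_of_ne e (fun i h => hB i (h ▸ hb)) (by rw [hp b hb]; exact hc b hb), hp b hb]

omit [DecidableEq α] in
theorem ne_of_mem_slice {B : Finset α} {r p : Perm α} (hp : p ∈ slice B r) {a : α} (ha : a ∉ B) :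
    ∀ b ∈ B, r b ≠ p a := fun b hb h => by
  rw [← hp b hb] at h
  exact ha (p.injective h ▸ hb)

/-- When only the positions in the range of `e` are free, edges are pairwise at distance at most
one. -/
theorem reachable_of_three_free [Fintype α] {B : Finset α} (hB : ∀ i, e i ∉ B)
    (hcard : B.card + 3 = Fintype.card α) {r : Perm α} {X : Set (Perm α)} (hX : X ⊆ slice B r)
    {p q : Perm α} (hp : p ∈ X) (hq : q ∈ X) (hp' : ∃ c, nbr e p c ∈ X)
    (hq' : ∃ c, nbr e q c ∈ X) : (within e X).Reachable p q := by
  have hcompl (b : α) (hb : b ∉ B) : ∃ i, e i = b := by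
    have h₁ : Finset.univ.map e = Bᶜ := by
      refine Finset.eq_of_subset_of_card_le (fun a ha => ?_) ?_
      · obtain ⟨i, -, rfl⟩ := Finset.mem_map.1 ha
        exact Finset.mem_compl.2 (hB i)
      · rw [Finset.card_compl, Finset.card_map, Finset.card_univ, Fintype.card_fin]
        omega
    have h₂ : b ∈ Finset.univ.map e := h₁ ▸ Finset.mem_compl.2 hb
    simpa using h₂
  have heq {u v : Perm α} (hu : u ∈ slice B r) (hv : v ∈ slice B r) (h : u (e 2) = v (e 2)) :
      v = u ∨ v = nbr e u (u (e 2)) := by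
    have hag (b : α) (h₀ : b ≠ e 0) (h₁ : b ≠ e 1) : u b = v b := by
      by_cases hb : b ∈ B
      · rw [hu b hb, hv b hb]
      obtain ⟨i, rfl⟩ := hcompl b hb
      fin_cases i
      · exact absurd rfl h₀
      · exact absurd rfl h₁
      · exact h
    have hval (b b' : α) (hb : b = e 0 ∧ b' = e 1 ∨ b = e 1 ∧ b' = e 0) :
        v b = u b ∨ v b = u b' := by
      obtain ⟨w, hw⟩ := u.surjective (v b)
      by_contra! hcon
      have h₁ : w ≠ b := fun h => hcon.1 (by rw [← hw, h])
      have h₂ : w ≠ b' := fun h => hcon.2 (by rw [← hw, h])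
      refine h₁ (v.injective ?_)
      rw [← hw]
      rcases hb with ⟨rfl, rfl⟩ | ⟨rfl, rfl⟩
      · exact (hag w h₁ h₂).symm
      · exact (hag w h₂ h₁).symm
    have h₀₁ : e 0 ≠ e 1 := e.injective.ne (by decide)
    have hne : v (e 0) ≠ v (e 1) := v.injective.ne h₀₁
    have hne' : u (e 0) ≠ u (e 1) := u.injective.ne h₀₁
    rcases hval _ _ (.inl ⟨rfl, rfl⟩) with h₀ | h₀ <;>
      rcases hval _ _ (.inr ⟨rfl, rfl⟩) with h₁ | h₁
    · left
      ext b
      by_cases hb₀ : b = e 0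
      · rw [hb₀, h₀]
      by_cases hb₁ : b = e 1
      · rw [hb₁, h₁]
      exact (hag b hb₀ hb₁).symm
    · exact absurd (h₀.trans h₁.symm) hne
    · exact absurd (h₀.trans h₁.symm) hne
    · right
      ext b
      by_cases hb₀ : b = e 0
      · simp [nbr, hb₀, h₀]
      by_cases hb₁ : b = e 1
      · simp [nbr, hb₁, h₁]
      · simp [nbr, swap_apply_of_ne_of_ne hb₀ hb₁, hag b hb₀ hb₁]
  have hthird {u v : Perm α} (hu : u ∈ X) (hv : v ∈ X) (h : u (e 2) = v (e 2)) :
      (within e X).Reachable u v := by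
    rcases heq (hX hu) (hX hv) h with h | h
    · rw [h]
    · rw [h] at hv ⊢
      exact reachable_nbr hu hv
  have hflip {u v : Perm α} (hu : u ∈ X) (hu' : nbr e u (u (e 2)) ∈ X) (hv : v ∈ X) :
      (within e X).Reachable u v := by
    by_cases h : u (e 2) = v (e 2)
    · exact hthird hu hv h
    have hs : nbr e u (v (e 2)) ∈ slice B r :=
      nbr_mem_slice hB (hX hu) (ne_of_mem_slice (hX hv) (hB 2))
    rcases heq hs (hX hv) (by simp) with h₁ | h₁
    · rw [h₁] at hv ⊢
      exact reachable_nbr hu hv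
    · have h₂ : v = nbr e (nbr e u (u (e 2))) (v (e 2)) := by
        refine h₁.trans ?_
        rw [nbr_self, nbr_self, nbr, nbr, Perm.mul_apply u, swap_apply_of_ne_of_ne
          (e.injective.ne (by decide)) (e.injective.ne (by decide)), mul_assoc _ u]
      refine (reachable_nbr hu hu').trans ?_
      rw [h₂] at hv ⊢
      exact reachable_nbr hu' hv
  obtain ⟨c, hc⟩ := hp'
  obtain ⟨d, hd⟩ := hq'
  by_cases hpc : c = p (e 2)
  · exact hflip hp (hpc ▸ hc) hq
  by_cases hqd : d = q (e 2)
  · exact (hflip hq (hqd ▸ hd) hp).symm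
  have hsym {u : Perm α} (hu : u ∈ X) : ∃ i, r (e i) = u (e 2) := by
    obtain ⟨b, hb⟩ := r.surjective (u (e 2))
    by_cases hbB : b ∈ B
    · exact absurd hb (ne_of_mem_slice (hX hu) (hB 2) b hbB)
    · obtain ⟨i, rfl⟩ := hcompl b hbB
      exact ⟨i, hb⟩
  have hpc' := reachable_nbr hp hc
  have hqd' := reachable_nbr hq hd
  obtain ⟨i, hi⟩ := hsym hp
  obtain ⟨i', hi'⟩ := hsym hc
  obtain ⟨j, hj⟩ := hsym hq
  obtain ⟨j', hj'⟩ := hsym hd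
  have hii : i ≠ i' := by
    rintro rfl
    rw [hi, nbr_apply_two] at hi'
    exact hpc hi'.symm
  have hjj : j ≠ j' := by
    rintro rfl
    rw [hj, nbr_apply_two] at hj'
    exact hqd hj'.symm
  have hmeet : i = j ∨ i = j' ∨ i' = j ∨ i' = j' := by omega
  rcases hmeet with rfl | rfl | rfl | rfl
  · exact hthird hp hq (hi.symm.trans hj)
  · exact (hthird hp hd (hi.symm.trans hj')).trans hqd'.symm
  · exact hpc'.trans (hthird hc hq (hi'.symm.trans hj))
  · exact (hpc'.trans (hthird hc hd (hi'.symm.trans hj'))).trans hqd'.symm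


/-- The number of vertices of `F` on the edges between the two parts of a slice with the symbols
`c` and `d` at the position `b` is at least two when `F` meets all of these edges. -/
theorem two_le_card_of_forall_mem {B : Finset α} (hB : ∀ i, e i ∉ B) {b : α}
    (hb : ∀ i, e i ≠ b) (hbB : b ∉ B) {r : Perm α} {F : Finset (Perm α)} {c d : α} (hcd : c ≠ d)
    (hc : ∀ a ∈ B, r a ≠ c) (hd : ∀ a ∈ B, r a ≠ d)
    (h : ∀ p ∈ slice B r, p b = c → p (e 2) = d → p ∈ F ∨ out e b p ∈ F) :
    2 ≤ (F.filter fun p => p b = c ∧ p (e 2) = d ∨ p b = d ∧ p (e 2) = c).card := by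
  have hr : r ∈ slice B r := fun _ _ => rfl
  have h₁ := nbr_mem_slice hB hr hc
  have h₂ := nbr_mem_slice hB h₁ (ne_of_mem_slice h₁ hbB)
  obtain ⟨p, hp, hpb, hpd⟩ : ∃ p ∈ slice B r, p b = c ∧ p (e 2) = d := by
    refine ⟨_, nbr_mem_slice hB h₂ hd, ?_, nbr_apply_two e _ _⟩
    have : nbr e (nbr e r c) (nbr e r c b) b = c := by
      rw [← out, out_apply e hb, nbr_apply_two]
    rw [nbr_apply_of_ne e hb (by rwa [this]), this]
  have hp' := nbr_mem_slice hB hp (ne_of_mem_slice hp (hB 2))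
  have hpb' : nbr e p (p (e 2)) b = c := by
    rw [nbr_apply_of_ne e hb (by rw [hpb, hpd]; exact hcd), hpb]
  have hne : nbr e p (p (e 2)) ≠ p := nbr_ne e _ _
  have hout {u v : Perm α} (hu : u b = c) (hv : v (e 2) = d) : u ≠ out e b v := fun huv => by
    rw [huv, out_apply e hb, hv] at hu
    exact hcd hu.symm
  have key {u : Perm α} (hu : u ∈ F ∨ out e b u ∈ F) (hub : u b = c) (hud : u (e 2) = d) :
      ∃ v, (v = u ∨ v = out e b u) ∧
        v ∈ F.filter fun p => p b = c ∧ p (e 2) = d ∨ p b = d ∧ p (e 2) = c := by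
    rcases hu with hu | hu
    · exact ⟨u, .inl rfl, by simp [hu, hub, hud]⟩
    · exact ⟨_, .inr rfl, by simp [hu, out_apply e hb, hub, hud]⟩
  obtain ⟨v, hv, hvF⟩ := key (h _ hp hpb hpd) hpb hpd
  obtain ⟨v', hv', hvF'⟩ :=
    key (h _ hp' hpb' (by rw [nbr_apply_two, hpd])) hpb' (by rw [nbr_apply_two, hpd])
  refine Finset.one_lt_card.2 ⟨v, hvF, v', hvF', ?_⟩
  rintro rfl
  rcases hv with rfl | rfl <;> rcases hv' with hv' | hv'
  · exact hne hv'.symm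
  · exact hout hpb (by rw [nbr_apply_two, hpd]) hv'
  · exact hout hpb' hpd hv'.symm
  · exact hne (out_injective e hb hv').symm

omit e in
/-- Few pairs of values cannot cover twice a pair `c`, `d` and one side of every triangle on it. -/
theorem exists_card_pairs_lt_two {β : Type*} {A : Finset α} {F : Finset β} {f g : β → α}
    {c d : α} (hA : 3 ≤ A.card) (hc : c ∈ A) (hcd : c ≠ d) (hF : F.card ≤ A.card)
    (h : 2 ≤ (F.filter fun w => f w = c ∧ g w = d ∨ f w = d ∧ g w = c).card) :
    ∃ k ∈ A, k ≠ c ∧ k ≠ d ∧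
      (F.filter fun w => f w = c ∧ g w = k ∨ f w = k ∧ g w = c).card < 2 ∧
      (F.filter fun w => f w = k ∧ g w = d ∨ f w = d ∧ g w = k).card < 2 := by
  by_contra! hcon
  let φ (w : β) : α := if f w = c ∨ f w = d then if g w = c then d else g w else f w
  have hfiber : ∀ k ∈ A.erase c, 2 ≤ (F.filter fun w => φ w = k).card := by
    intro k hk
    obtain ⟨hkc, hk⟩ := Finset.mem_erase.1 hk
    by_cases hkd : k = d
    · refine h.trans (Finset.card_le_card fun w hw => ?_)
      simp only [Finset.mem_filter, φ] at hw ⊢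
      grind
    by_cases h₁ : (F.filter fun w => f w = c ∧ g w = k ∨ f w = k ∧ g w = c).card < 2
    · refine (hcon k hk hkc hkd h₁).trans (Finset.card_le_card fun w hw => ?_)
      simp only [Finset.mem_filter, φ] at hw ⊢
      grind
    · refine (not_lt.1 h₁).trans (Finset.card_le_card fun w hw => ?_)
      simp only [Finset.mem_filter, φ] at hw ⊢
      grind
  have hsum := Finset.card_nsmul_le_sum _ _ _ hfiber
  rw [Finset.sum_card_fiberwise_eq_card_filter, Finset.card_erase_of_mem hc, smul_eq_mul] at hsum
  have := Finset.card_filter_le F fun w => φ w ∈ A.erase c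
  omega

/-- Deleting at most as many vertices as the degree from a slice leaves at most one component
that is not an isolated vertex. -/
theorem slice_reachable [Fintype α] {N : ℕ} (hN : 3 ≤ N) {B : Finset α} (hB : ∀ i, e i ∉ B)
    (hcard : B.card + N = Fintype.card α) {r : Perm α} {F : Finset (Perm α)} (hF : F.card ≤ N)
    {p q : Perm α} (hp : p ∈ slice B r \ F) (hq : q ∈ slice B r \ F)
    (hp' : ∃ c, nbr e p c ∈ slice B r \ (F : Set (Perm α)))
    (hq' : ∃ c, nbr e q c ∈ slice B r \ (F : Set (Perm α))) :
    (within e (slice B r \ F)).Reachable p q := by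
  induction N, hN using Nat.le_induction generalizing B r F p q with
  | base => exact reachable_of_three_free hB hcard Set.sdiff_subset hp hq hp' hq'
  | succ N hN ih =>
    obtain ⟨b, hb⟩ : ∃ b, b ∉ B ∪ Finset.univ.map e := by
      by_contra! h
      have h₁ := Finset.card_le_card (fun a _ => h a : (Finset.univ : Finset α) ⊆ _)
      have h₂ := Finset.card_union_le B (Finset.univ.map e)
      rw [Finset.card_map, Finset.card_univ, Fintype.card_fin] at h₂
      rw [Finset.card_univ] at h₁
      omega
    obtain ⟨hbB, hbe⟩ : b ∉ B ∧ ∀ i, e i ≠ b := by simpa using hb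
    set X : Set (Perm α) := slice B r \ F with hX
    let part (d : α) : Finset (Perm α) := F.filter fun u => u b = d
    let symbols : Finset α := Finset.univ.filter fun d => ∀ a ∈ B, r a ≠ d
    have hsymbols : symbols.card = N + 1 := by
      have : symbols = (B.map r.toEmbedding)ᶜ := by
        ext d
        simp [symbols, ← Equiv.eq_symm_apply]
      rw [this, Finset.card_compl, Finset.card_map]
      omega
    have mem_symbols {d : α} : d ∈ symbols ↔ ∀ a ∈ B, r a ≠ d := by simp [symbols]
    have value_mem {u : Perm α} (hu : u ∈ X) : u b ∈ symbols :=
      mem_symbols.2 (ne_of_mem_slice hu.1 hbB)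
    have third_mem {u : Perm α} (hu : u ∈ X) : u (e 2) ∈ symbols :=
      mem_symbols.2 (ne_of_mem_slice hu.1 (hB 2))
    have out_mem {u : Perm α} (hu : u ∈ X) (h : out e b u ∉ F) : out e b u ∈ X :=
      ⟨nbr_mem_slice hB hu.1 (ne_of_mem_slice hu.1 hbB), h⟩
    have within_part {u v : Perm α} (hu : u ∈ X) (hv : v ∈ X) (huv : u b = v b)
        (hgood : (part (u b)).card < N) : (within e X).Reachable u v := by
      have hB' (i : Fin 3) : e i ∉ insert b B := by simp [hbe i, hB i]
      have hsub : slice (insert b B) u \ (part (u b) : Set (Perm α)) ⊆ X := by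
        rintro w ⟨hw, hwF⟩
        have hwb : w b = u b := hw b (Finset.mem_insert_self _ _)
        refine ⟨fun a ha => (hw a (Finset.mem_insert_of_mem ha)).trans (hu.1 a ha), fun h => ?_⟩
        exact hwF (by simpa [part, hwb] using h)
      have hmem {w : Perm α} (hw : w ∈ X) (hwb : w b = u b) :
          w ∈ slice (insert b B) u \ (part (u b) : Set (Perm α)) := by
        refine ⟨fun a ha => ?_, fun h => hw.2 (Finset.mem_filter.1 h).1⟩
        rcases Finset.mem_insert.1 ha with rfl | ha
        · exact hwb
        · rw [hw.1 a ha, hu.1 a ha]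
      have hnbr {w : Perm α} (hw : w ∈ X) (hwb : w b = u b) :
          ∃ c, nbr e w c ∈ slice (insert b B) u \ (part (u b) : Set (Perm α)) := by
        have hcard' : (part (u b)).card < ((symbols.erase (u b)).image (nbr e w)).card := by
          rw [Finset.card_image_of_injective _ (nbr_right_injective e w),
            Finset.card_erase_of_mem (value_mem hu), hsymbols]
          exact hgood
        obtain ⟨w', hw', hwF⟩ := Finset.exists_mem_notMem_of_card_lt_card hcard'
        obtain ⟨c, hc, rfl⟩ := Finset.mem_image.1 hw'
        refine ⟨c, nbr_mem_slice hB' (hmem hw hwb).1 fun a ha => ?_, hwF⟩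
        rcases Finset.mem_insert.1 ha with rfl | ha
        · exact (Finset.ne_of_mem_erase hc).symm
        · rw [hu.1 a ha]
          exact mem_symbols.1 (Finset.mem_of_mem_erase hc) a ha
      refine (ih hB' ?_ hgood.le (hmem hu rfl) (hmem hv huv.symm) (hnbr hu rfl)
        (hnbr hv huv.symm)).mono (within_mono e hsub)
      rw [Finset.card_insert_of_notMem hbB]
      omega
    have bad_unique {c d : α} (hc : N ≤ (part c).card) (hdc : d ≠ c) {u v : Perm α}
        (hu : u ∈ F) (hv : v ∈ F) (huc : u b ≠ c) (hvc : v b ≠ c) : u = v := by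
      by_contra huv
      have hdisj : Disjoint (part c) {u, v} := by
        rw [Finset.disjoint_left]
        intro w hw hw'
        rcases Finset.mem_insert.1 hw' with rfl | hw'
        · exact huc (Finset.mem_filter.1 hw).2
        · rw [Finset.mem_singleton.1 hw'] at hw
          exact hvc (Finset.mem_filter.1 hw).2
      have hle := Finset.card_le_card (s := part c ∪ {u, v}) (t := F) (by
        refine Finset.union_subset (Finset.filter_subset _ _) ?_
        simp [Finset.insert_subset_iff, hu, hv])
      rw [Finset.card_union_of_disjoint hdisj, Finset.card_pair huv] at hle
      omega
    have good_of_bad {c d : α} (hc : N ≤ (part c).card) (hdc : d ≠ c) : (part d).card < N := by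
      have : (part d).card ≤ 1 := Finset.card_le_one.2 fun u hu v hv => by
        rw [Finset.mem_filter] at hu hv
        exact bad_unique hc hdc hu.1 hv.1 (hu.2 ▸ hdc) (hv.2 ▸ hdc)
      omega
    have linked {c d : α} (h : ¬∃ u ∈ X, u b = c ∧ out e b u ∈ X ∧ out e b u b = d)
        (hcd : c ≠ d) (hc : c ∈ symbols) (hd : d ∈ symbols) :
        2 ≤ (F.filter fun p => p b = c ∧ p (e 2) = d ∨ p b = d ∧ p (e 2) = c).card := by
      refine two_le_card_of_forall_mem hB hbe hbB hcd (mem_symbols.1 hc) (mem_symbols.1 hd) ?_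
      intro u hu huc hud
      by_contra! hcon
      exact h ⟨u, ⟨hu, hcon.1⟩, huc, out_mem ⟨hu, hcon.1⟩ hcon.2, by rw [out_apply e hbe, hud]⟩
    have step {u v : Perm α} (hu : u ∈ X) (hgu : (part (u b)).card < N)
        (h : ∃ w ∈ X, w b = u b ∧ out e b w ∈ X ∧ out e b w b = v b) (hv : v ∈ X)
        (hgv : (part (v b)).card < N) : (within e X).Reachable u v := by
      obtain ⟨w, hw, hwu, hw', hwv⟩ := h
      exact (within_part hu hw hwu.symm hgu).trans
        ((reachable_nbr hw hw').trans (within_part hw' hv hwv (hwv ▸ hgv)))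
    have good_good {u v : Perm α} (hu : u ∈ X) (hgu : (part (u b)).card < N) (hv : v ∈ X)
        (hgv : (part (v b)).card < N) : (within e X).Reachable u v := by
      by_cases huv : u b = v b
      · exact within_part hu hv huv hgu
      by_cases hlink : ∃ w ∈ X, w b = u b ∧ out e b w ∈ X ∧ out e b w b = v b
      · exact step hu hgu hlink hv hgv
      have htwo := linked hlink huv (value_mem hu) (value_mem hv)
      have hall (d : α) : (part d).card < N := by
        by_contra! hbad
        obtain ⟨f, hf, g, hg, hfg⟩ := Finset.one_lt_card.1 htwo
        rw [Finset.mem_filter] at hf hg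
        have hud : u b ≠ d := by
          rintro rfl
          omega
        have hvd : v b ≠ d := by
          rintro rfl
          omega
        refine hfg (bad_unique hbad hud hf.1 hg.1 ?_ ?_)
        · rcases hf.2 with h | h <;> rwa [h.1]
        · rcases hg.2 with h | h <;> rwa [h.1]
      obtain ⟨d, hd, hdu, hdv, h₁, h₂⟩ := exists_card_pairs_lt_two (F := F)
        (f := fun w : Perm α => w b) (g := fun w : Perm α => w (e 2)) (by omega) (value_mem hu) huv
        (by omega) htwo
      replace h₁ : ∃ w ∈ X, w b = u b ∧ out e b w ∈ X ∧ out e b w b = d := by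
        by_contra h
        exact absurd (linked h hdu.symm (value_mem hu) hd) (not_le.2 h₁)
      replace h₂ : ∃ w ∈ X, w b = d ∧ out e b w ∈ X ∧ out e b w b = v b := by
        by_contra h
        exact absurd (linked h hdv hd (value_mem hv)) (not_le.2 h₂)
      obtain ⟨w, hw, hwd, -⟩ := id h₂
      exact (step hu hgu (hwd ▸ h₁) hw (hall _)).trans (step hw (hall _) (hwd ▸ h₂) hv hgv)
    have to_good {u : Perm α} (hu : u ∈ X) (hu' : ∃ c, nbr e u c ∈ X) :
        ∃ v ∈ X, (part (v b)).card < N ∧ (within e X).Reachable u v := by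
      by_cases hgood : (part (u b)).card < N
      · exact ⟨u, hu, hgood, .rfl⟩
      rw [not_lt] at hgood
      have hthird {w : Perm α} : w (e 2) ≠ w b := w.injective.ne (hbe 2)
      by_cases hout : out e b u ∈ F
      · obtain ⟨c, hc⟩ := hu'
        have hcu : u b ≠ c := by
          rintro rfl
          exact hc.2 hout
        have hwb : nbr e u c b = u b := nbr_apply_of_ne e hbe hcu
        have hw' : out e b (nbr e u c) ∉ F := fun h => by
          refine nbr_ne e u c
            (out_injective e hbe (bad_unique hgood (d := c) hcu.symm h hout ?_ ?_))
          · rw [out_apply e hbe, ← hwb]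
            exact hthird
          · rw [out_apply e hbe]
            exact hthird
        refine ⟨_, out_mem hc hw', good_of_bad hgood ?_,
          (reachable_nbr hu hc).trans (reachable_nbr hc (out_mem hc hw'))⟩
        rw [out_apply e hbe, ← hwb]
        exact hthird
      · refine ⟨_, out_mem hu hout, good_of_bad hgood ?_, reachable_nbr hu (out_mem hu hout)⟩
        rw [out_apply e hbe]
        exact hthird
    obtain ⟨u, hu, hgu, hpu⟩ := to_good hp hp'
    obtain ⟨v, hv, hgv, hqv⟩ := to_good hq hq'
    exact (hpu.trans (good_good hu hgu hv hgv)).trans hqv.symm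

end Slices

section Configuration

open Equiv

/-- Four permutations `x`, `y`, `z`, `w`, of which exactly `x` and `y` have the same symbol at the
position `m`. -/
structure Config (α : Type*) [DecidableEq α] where
  (e : Fin 3 ↪ α)
  (m i j k : α)
  (x y z w : Perm α)
  e_ne : ∀ l, e l ≠ m
  i_ne_j : i ≠ j
  i_ne_k : i ≠ k
  j_ne_k : j ≠ k
  x_m : x m = i
  y_m : y m = i
  z_m : z m = j
  w_m : w m = k
  y_ne : y ≠ out e m (nbr e z (z (e 2)))

variable {α : Type*} [DecidableEq α]

/-- The permutation with symbol `c` at the position `e 2` that is `p` or a neighbour of `p`. -/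
def goto (e : Fin 3 ↪ α) (p : Perm α) (c : α) : Perm α :=
  if p (e 2) = c then p else nbr e p c

theorem goto_of_eq {e : Fin 3 ↪ α} {p : Perm α} {c : α} (h : p (e 2) = c) : goto e p c = p :=
  if_pos h

theorem goto_of_ne {e : Fin 3 ↪ α} {p : Perm α} {c : α} (h : p (e 2) ≠ c) :
    goto e p c = nbr e p c :=
  if_neg h

@[simp]
theorem goto_apply_two (e : Fin 3 ↪ α) (p : Perm α) (c : α) : goto e p c (e 2) = c := by
  rw [goto]
  split_ifs with h
  · exact h
  · exact nbr_apply_two ..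

theorem goto_apply_of_ne {e : Fin 3 ↪ α} {b : α} (hb : ∀ l, e l ≠ b) {p : Perm α} {c : α}
    (hc : p b ≠ c) : goto e p c b = p b := by
  rw [goto]
  split_ifs
  · rfl
  · exact nbr_apply_of_ne e hb hc

theorem goto_symm {e : Fin 3 ↪ α} {p q : Perm α} (h : goto e p (q (e 2)) = q) :
    goto e q (p (e 2)) = p := by
  by_cases hpq : p (e 2) = q (e 2)
  · rw [goto_of_eq hpq] at h
    rw [h, goto_of_eq rfl]
  · rw [goto_of_ne hpq] at h
    rw [goto_of_ne (Ne.symm hpq), ← h]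
    simp

namespace Config

variable (C : Config α)

/-- The four vertices of the configuration. -/
def S : Set (Perm α) := {C.x, C.y, C.z, C.w}

/-- The vertex through which the tree coloured `k` leaves `z`. -/
def z₁ [Fintype α] : Perm α :=
  if out C.e C.m (goto C.e C.z C.k) = goto C.e C.w C.j then nbr C.e C.z (C.z (C.e 2)) else C.z

/-- The colours of the vertices outside `S`. -/
def vertexColor [Fintype α] (p : Perm α) : α :=
  if p C.m = C.i then
    if goto C.e C.y (C.x (C.e 2)) = C.x ∧ p = nbr C.e C.y (C.y (C.e 2)) then C.x (C.e 2)
    else p (C.e 2)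
  else if p C.m = C.j then
    if p = C.z₁ ∨ p = goto C.e C.z₁ C.k then C.k
    else if p (C.e 2) ≠ C.i ∧ p (C.e 2) ≠ C.k ∧ p = goto C.e C.z (p (C.e 2)) then p (C.e 2)
    else C.j
  else if p C.m = C.k then
    if p (C.e 2) ≠ C.i ∧ p = goto C.e C.w (p (C.e 2)) then p (C.e 2) else C.k
  else p C.m

open Classical in
/-- The colours of the edges inside `S`. -/
noncomputable def edgeColor (t : Sym2 (Perm α)) : α :=
  if ∀ a ∈ t, a C.m = C.i then C.y (C.e 2) else if ∃ a ∈ t, a C.m = C.j then C.j else C.k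

variable [Fintype α] (G : SimpleGraph (Perm α))

/-- The graph of the edges available to the colour `c`. -/
noncomputable def graph (c : α) : SimpleGraph (Perm α) :=
  colorGraph G C.S C.vertexColor C.edgeColor c

variable {C G} (hG : ∀ p c, G.Adj p (nbr C.e p c)) {c : α} {p q u : Perm α}

omit [Fintype α] in
theorem eq_or_eq_of_mem (h : p ∈ C.S) (hp : p C.m = C.i) : p = C.x ∨ p = C.y := by
  have := C.i_ne_j; have := C.i_ne_k; have := C.z_m; have := C.w_m
  rcases h with rfl | rfl | rfl | rfl <;> simp_all

omit [Fintype α] in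
theorem eq_z_of_mem (h : p ∈ C.S) (hp : p C.m = C.j) : p = C.z := by
  have := C.i_ne_j; have := C.j_ne_k; have := C.x_m; have := C.y_m; have := C.w_m
  rcases h with rfl | rfl | rfl | rfl <;> simp_all

omit [Fintype α] in
theorem eq_w_of_mem (h : p ∈ C.S) (hp : p C.m = C.k) : p = C.w := by
  have := C.i_ne_k; have := C.j_ne_k; have := C.x_m; have := C.y_m; have := C.z_m
  rcases h with rfl | rfl | rfl | rfl <;> simp_all

omit [Fintype α] in
theorem notMem_of_ne (hi : p C.m ≠ C.i) (hj : p C.m ≠ C.j) (hk : p C.m ≠ C.k) : p ∉ C.S := by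
  have := C.x_m; have := C.y_m; have := C.z_m; have := C.w_m
  rintro (rfl | rfl | rfl | rfl) <;> simp_all

omit [Fintype α] in
theorem x_mem : C.x ∈ C.S := .inl rfl

omit [Fintype α] in
theorem y_mem : C.y ∈ C.S := .inr (.inl rfl)

omit [Fintype α] in
theorem z_mem : C.z ∈ C.S := .inr (.inr (.inl rfl))

omit [Fintype α] in
theorem w_mem : C.w ∈ C.S := .inr (.inr (.inr rfl))

include hG in
theorem reachable_nbr_of_not_both {d : α} (hu : u ∈ C.S ∨ C.vertexColor u = c)
    (hv : nbr C.e u d ∈ C.S ∨ C.vertexColor (nbr C.e u d) = c)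
    (h : u ∈ C.S → nbr C.e u d ∉ C.S) : (C.graph G c).Reachable u (nbr C.e u d) :=
  SimpleGraph.Adj.reachable ⟨hG u d, hu, hv, fun h₁ h₂ => absurd h₂ (h h₁)⟩

include hG in
theorem reachable_nbr_of_eq_i {d : α} (hu : u ∈ C.S ∨ C.vertexColor u = c)
    (hv : nbr C.e u d ∈ C.S ∨ C.vertexColor (nbr C.e u d) = c) (hi : u C.m = C.i)
    (hd : d ≠ C.i) (h : u ∈ C.S → nbr C.e u d ∈ C.S → C.y (C.e 2) = c) :
    (C.graph G c).Reachable u (nbr C.e u d) := by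
  refine SimpleGraph.Adj.reachable ⟨hG u d, hu, hv, fun h₁ h₂ => ?_⟩
  rw [edgeColor, if_pos]
  · exact h h₁ h₂
  · have := nbr_apply_of_ne C.e C.e_ne (hi.trans_ne hd.symm)
    simp [this, hi]

include hG in
/-- Edges from the cluster of `x` and `y` to the cluster of the colour. -/
theorem reachable_out (hu : u ∈ C.S ∨ C.vertexColor u = c)
    (hv : out C.e C.m u ∈ C.S ∨ C.vertexColor (out C.e C.m u) = c) (hi : u C.m = C.i)
    (hc : u (C.e 2) = c) (hci : c ≠ C.i) : (C.graph G c).Reachable u (out C.e C.m u) := by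
  refine SimpleGraph.Adj.reachable ⟨hG u _, hu, hv, fun h₁ h₂ => ?_⟩
  have hm : out C.e C.m u C.m = c := by rw [out_apply C.e C.e_ne, hc]
  change C.edgeColor s(u, out C.e C.m u) = c
  rw [edgeColor, if_neg (by simp [hm, hci])]
  by_cases hj : c = C.j
  · rw [if_pos (by simp [hm, hj]), hj]
  · rw [if_neg (by simp [hm, hj, hi, C.i_ne_j])]
    by_contra hk
    exact notMem_of_ne (by rwa [hm]) (by rwa [hm]) (by rwa [hm, ne_comm]) h₂

include hG in
theorem exists_path_x (hc : c ≠ C.i) : ∃ u, u C.m = C.i ∧ u (C.e 2) = c ∧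
    (u ∈ C.S ∨ C.vertexColor u = c) ∧ (C.graph G c).Reachable C.x u := by
  have hm : goto C.e C.x c C.m = C.i := by
    rw [goto_apply_of_ne C.e_ne (by rw [C.x_m]; exact hc.symm), C.x_m]
  by_cases hx : C.x (C.e 2) = c
  · exact ⟨C.x, C.x_m, hx, .inl x_mem, .rfl⟩
  rw [goto_of_ne hx] at hm
  have hok : nbr C.e C.x c ∈ C.S ∨ C.vertexColor (nbr C.e C.x c) = c := by
    rw [or_iff_not_imp_left]
    intro hS
    rw [vertexColor, if_pos hm, if_neg, nbr_apply_two]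
    rintro ⟨h₁, h₂⟩
    have h₃ := congrArg (fun u : Perm α => u (C.e 2)) h₂
    simp only [nbr_apply_two] at h₃
    have h₄ := goto_symm h₁
    rw [goto_of_ne (h₃ ▸ hx), ← h₃] at h₄
    exact hS (h₄ ▸ y_mem)
  refine ⟨_, hm, nbr_apply_two .., hok,
    reachable_nbr_of_eq_i hG (.inl x_mem) hok C.x_m hc fun _ h => ?_⟩
  rcases eq_or_eq_of_mem h hm with h | h
  · exact absurd h (nbr_ne _ _ _)
  · rw [← h, nbr_apply_two]

include hG in
theorem exists_path_y (hc : c ≠ C.i) : ∃ u, u C.m = C.i ∧ u (C.e 2) = c ∧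
    (u ∈ C.S ∨ C.vertexColor u = c) ∧ (C.graph G c).Reachable C.y u := by
  by_cases hy : C.y (C.e 2) = c
  · exact ⟨C.y, C.y_m, hy, .inl y_mem, .rfl⟩
  have hyi : C.y (C.e 2) ≠ C.i := by
    rw [← C.y_m]
    exact C.y.injective.ne (C.e_ne 2)
  by_cases hdetour : goto C.e C.y (C.x (C.e 2)) = C.x ∧ c = C.x (C.e 2)
  · obtain ⟨h₁, rfl⟩ := hdetour
    rw [goto_of_ne hy] at h₁
    set v := nbr C.e C.y (C.y (C.e 2)) with hv
    have hvm : v C.m = C.i := by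
      rw [hv, nbr_apply_of_ne C.e C.e_ne (by rw [C.y_m]; exact hyi.symm), C.y_m]
    have hvt : v (C.e 2) = C.y (C.e 2) := nbr_apply_two ..
    have hvS : v ∉ C.S := fun h => by
      rcases eq_or_eq_of_mem h hvm with h | h
      · exact hy (by rw [← hvt, h])
      · exact nbr_ne _ _ _ h
    have hok : v ∈ C.S ∨ C.vertexColor v = C.x (C.e 2) := by
      right
      rw [vertexColor, if_pos hvm, if_pos ⟨by rw [goto_of_ne hy, h₁], rfl⟩]
    have hum : nbr C.e v (C.x (C.e 2)) C.m = C.i := by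
      rw [nbr_apply_of_ne C.e C.e_ne (by rw [hvm]; exact hc.symm), hvm]
    have hok' : nbr C.e v (C.x (C.e 2)) ∈ C.S ∨
        C.vertexColor (nbr C.e v (C.x (C.e 2))) = C.x (C.e 2) := by
      right
      rw [vertexColor, if_pos hum]
      simp
    exact ⟨_, hum, nbr_apply_two .., hok',
      (reachable_nbr_of_not_both hG (.inl y_mem) hok fun _ => hvS).trans
        (reachable_nbr_of_not_both hG hok hok' fun h => absurd h hvS)⟩
  have hm : nbr C.e C.y c C.m = C.i := by
    rw [nbr_apply_of_ne C.e C.e_ne (by rw [C.y_m]; exact hc.symm), C.y_m]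
  have hok : nbr C.e C.y c ∈ C.S ∨ C.vertexColor (nbr C.e C.y c) = c := by
    right
    rw [vertexColor, if_pos hm, if_neg, nbr_apply_two]
    exact fun h => hy (nbr_right_injective _ _ h.2).symm
  refine ⟨_, hm, nbr_apply_two .., hok,
    reachable_nbr_of_eq_i hG (.inl y_mem) hok C.y_m hc fun _ h => ?_⟩
  rcases eq_or_eq_of_mem h hm with h | h
  · have hcx : c = C.x (C.e 2) := by rw [← h, nbr_apply_two]
    exact absurd ⟨by rw [← hcx, goto_of_ne hy, h], hcx⟩ hdetour
  · exact absurd h (nbr_ne _ _ _)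

include hG in
/-- A cluster with few deleted vertices and at most one vertex of `S` serves as a hub. -/
theorem reachable_of_cluster {a : α} {F : Finset (Perm α)} (hF : F.card + 1 ≤ Fintype.card α)
    (hcol : ∀ p, p C.m = a → p ∉ F → p ∈ C.S ∨ C.vertexColor p = c)
    (hS : ∀ p ∈ C.S, ∀ q ∈ C.S, p C.m = a → q C.m = a → p = q)
    (hp : p C.m = a) (hpF : p ∉ F) (hp' : ∃ d ≠ a, nbr C.e p d ∉ F)
    (hq : q C.m = a) (hqF : q ∉ F) (hq' : ∃ d ≠ a, nbr C.e q d ∉ F) :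
    (C.graph G c).Reachable p q := by
  have hB (l : Fin 3) : C.e l ∉ ({C.m} : Finset α) := by simpa using C.e_ne l
  have hcard : 4 ≤ Fintype.card α := by
    have := Finset.card_le_univ (Finset.cons C.m (Finset.univ.map C.e) (by simpa using C.e_ne))
    rwa [Finset.card_cons, Finset.card_map, Finset.card_univ, Fintype.card_fin] at this
  have hmem {u : Perm α} : u ∈ slice {C.m} p ↔ u C.m = a := by simp [slice, hp]
  have hnbr {u : Perm α} (hu : u C.m = a) (hu' : ∃ d ≠ a, nbr C.e u d ∉ F) :
      ∃ d, nbr C.e u d ∈ slice {C.m} p \ (F : Set (Perm α)) := by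
    obtain ⟨d, hd, h⟩ := hu'
    exact ⟨d, hmem.2 (by rw [nbr_apply_of_ne C.e C.e_ne (hu.trans_ne hd.symm), hu]), h⟩
  refine (slice_reachable (N := Fintype.card α - 1) (by omega) hB ?_ (by omega)
    ⟨hmem.2 hp, hpF⟩ ⟨hmem.2 hq, hqF⟩ (hnbr hp hp') (hnbr hq hq')).mono ?_
  · rw [Finset.card_singleton]
    omega
  · rintro u v ⟨⟨hu, huF⟩, ⟨hv, hvF⟩, d, rfl⟩
    rw [hmem] at hu hv
    exact ⟨hG u d, hcol u hu huF, hcol _ hv hvF,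
      fun h₁ h₂ => absurd (hS _ h₂ _ h₁ hv hu) (nbr_ne _ _ _)⟩

theorem z₁_eq : C.z₁ = C.z ∨ C.z₁ = nbr C.e C.z (C.z (C.e 2)) := by
  rw [z₁]
  split_ifs
  · exact .inr rfl
  · exact .inl rfl

theorem z₁_apply_two : C.z₁ (C.e 2) = C.z (C.e 2) := by
  rcases C.z₁_eq with h | h <;> simp [h]

theorem z₁_m : C.z₁ C.m = C.j := by
  rcases C.z₁_eq with h | h
  · rw [h, C.z_m]
  · rw [h, nbr_apply_of_ne C.e C.e_ne (C.z.injective.ne (C.e_ne 2).symm), C.z_m]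

theorem goto_z₁_m : goto C.e C.z₁ C.k C.m = C.j := by
  rw [goto_apply_of_ne C.e_ne (by rw [z₁_m]; exact C.j_ne_k), z₁_m]

theorem out_goto_z₁_ne : out C.e C.m (goto C.e C.z₁ C.k) ≠ goto C.e C.w C.j := by
  rw [z₁]
  split_ifs with h
  · intro h'
    have h₁ := out_injective C.e C.e_ne (h'.trans h.symm)
    by_cases hk : C.z (C.e 2) = C.k
    · rw [goto_of_eq (by simpa using hk), goto_of_eq hk] at h₁
      exact nbr_ne _ _ _ h₁
    · rw [goto_of_ne (by simpa using hk), goto_of_ne hk] at h₁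
      exact nbr_ne _ _ _ (nbr_left_cancel C.e (by simp) h₁)
  · exact h

theorem vertexColor_of_ne (hi : p C.m ≠ C.i) (hj : p C.m ≠ C.j) (hk : p C.m ≠ C.k) :
    C.vertexColor p = p C.m := by
  rw [vertexColor, if_neg hi, if_neg hj, if_neg hk]

theorem vertexColor_of_m_eq_j (h : p C.m = C.j) (h₁ : p ≠ C.z₁) (h₂ : p ≠ goto C.e C.z₁ C.k)
    (h₃ : p (C.e 2) ≠ C.i → p (C.e 2) ≠ C.k → p ≠ goto C.e C.z (p (C.e 2))) :
    C.vertexColor p = C.j := by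
  rw [vertexColor, if_neg (by rw [h]; exact C.i_ne_j.symm), if_pos h, if_neg (not_or.2 ⟨h₁, h₂⟩),
    if_neg fun h => h₃ h.1 h.2.1 h.2.2]

theorem vertexColor_goto_z (hi : c ≠ C.i) (hj : c ≠ C.j) (hk : c ≠ C.k) :
    goto C.e C.z c ∈ C.S ∨ C.vertexColor (goto C.e C.z c) = c := by
  by_cases hz : C.z (C.e 2) = c
  · rw [goto_of_eq hz]
    exact .inl z_mem
  right
  have ht : goto C.e C.z c (C.e 2) = c := goto_apply_two ..
  have hm : goto C.e C.z c C.m = C.j := by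
    rw [goto_apply_of_ne C.e_ne (by rw [C.z_m]; exact hj.symm), C.z_m]
  rw [vertexColor, if_neg (by rw [hm]; exact C.i_ne_j.symm), if_pos hm, if_neg, ht,
    if_pos ⟨hi, hk, rfl⟩]
  rintro (h | h)
  · rw [h, z₁_apply_two] at ht
    exact hz ht
  · rw [h, goto_apply_two] at ht
    exact hk ht.symm

theorem vertexColor_goto_w (hi : c ≠ C.i) (hk : c ≠ C.k) :
    goto C.e C.w c ∈ C.S ∨ C.vertexColor (goto C.e C.w c) = c := by
  by_cases hw : C.w (C.e 2) = c
  · rw [goto_of_eq hw]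
    exact .inl w_mem
  right
  have ht : goto C.e C.w c (C.e 2) = c := goto_apply_two ..
  have hm : goto C.e C.w c C.m = C.k := by
    rw [goto_apply_of_ne C.e_ne (by rw [C.w_m]; exact hk.symm), C.w_m]
  rw [vertexColor, if_neg (by rw [hm]; exact C.i_ne_k.symm),
    if_neg (by rw [hm]; exact C.j_ne_k.symm), if_pos hm, ht, if_pos ⟨hi, rfl⟩]

include hG in
theorem reachable_goto {d : α} (hu : u ∈ C.S ∨ C.vertexColor u = c)
    (hv : goto C.e u d ∈ C.S ∨ C.vertexColor (goto C.e u d) = c)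
    (h : u ∈ C.S → goto C.e u d ∈ C.S → goto C.e u d = u) :
    (C.graph G c).Reachable u (goto C.e u d) := by
  by_cases hd : u (C.e 2) = d
  · rw [goto_of_eq hd]
  · rw [goto_of_ne hd] at hv h ⊢
    exact reachable_nbr_of_not_both hG hu hv fun h₁ h₂ => nbr_ne _ _ _ (h h₁ h₂)

include hG in
theorem reachable_out_of_ne (hu : u ∈ C.S ∨ C.vertexColor u = c) (ht : u (C.e 2) = c)
    (hi : c ≠ C.i) (hj : c ≠ C.j) (hk : c ≠ C.k) :
    (C.graph G c).Reachable u (out C.e C.m u) := by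
  have hm : out C.e C.m u C.m = c := by rw [out_apply C.e C.e_ne, ht]
  rw [← hm] at hi hj hk
  exact reachable_nbr_of_not_both hG hu (.inr ((vertexColor_of_ne hi hj hk).trans hm))
    fun _ => notMem_of_ne hi hj hk

include hG in
theorem exists_path_z (hi : c ≠ C.i) (hj : c ≠ C.j) (hk : c ≠ C.k) :
    ∃ u, u C.m = c ∧ (C.graph G c).Reachable C.z u := by
  have hok := C.vertexColor_goto_z hi hj hk
  have hm : goto C.e C.z c C.m = C.j := by
    rw [goto_apply_of_ne C.e_ne (by rw [C.z_m]; exact hj.symm), C.z_m]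
  exact ⟨_, by rw [out_apply C.e C.e_ne, goto_apply_two],
    (reachable_goto hG (.inl z_mem) hok fun _ h => eq_z_of_mem h hm).trans
      (reachable_out_of_ne hG hok (goto_apply_two ..) hi hj hk)⟩

include hG in
theorem exists_path_w (hi : c ≠ C.i) (hj : c ≠ C.j) (hk : c ≠ C.k) :
    ∃ u, u C.m = c ∧ (C.graph G c).Reachable C.w u := by
  have hok := C.vertexColor_goto_w hi hk
  have hm : goto C.e C.w c C.m = C.k := by
    rw [goto_apply_of_ne C.e_ne (by rw [C.w_m]; exact hk.symm), C.w_m]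
  exact ⟨_, by rw [out_apply C.e C.e_ne, goto_apply_two],
    (reachable_goto hG (.inl w_mem) hok fun _ h => eq_w_of_mem h hm).trans
      (reachable_out_of_ne hG hok (goto_apply_two ..) hi hj hk)⟩

include hG in
theorem reachable_of_m_eq (hi : c ≠ C.i) (hj : c ≠ C.j) (hk : c ≠ C.k) (hp : p C.m = c)
    (hq : q C.m = c) : (C.graph G c).Reachable p q := by
  have : ∃ d, d ≠ c := ⟨_, hi.symm⟩
  refine reachable_of_cluster hG (a := c) (F := ∅) ?_ ?_ ?_ hp (Finset.notMem_empty _) ?_ hq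
    (Finset.notMem_empty _) ?_
  · rw [Finset.card_empty]
    exact Fintype.card_pos_iff.2 ⟨c⟩
  · exact fun p hp _ =>
      .inr ((vertexColor_of_ne (by rwa [hp]) (by rwa [hp]) (by rwa [hp])).trans hp)
  · exact fun p hp _ _ h _ => absurd hp (notMem_of_ne (by rwa [h]) (by rwa [h]) (by rwa [h]))
  · simpa using this
  · simpa using this

variable (C) in
/-- The vertices of the cluster of `w` used by the paths leaving `w`. -/
def usedW : Finset (Perm α) := (Finset.univ \ {C.i, C.k, C.w (C.e 2)}).image (nbr C.e C.w)

theorem nbr_w_mem_usedW {d : α} :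
    nbr C.e C.w d ∈ C.usedW ↔ d ≠ C.i ∧ d ≠ C.k ∧ d ≠ C.w (C.e 2) := by
  simp [usedW, (nbr_right_injective C.e C.w).eq_iff]

theorem eq_nbr_of_mem_usedW (h : p ∈ C.usedW) : p = nbr C.e C.w (p (C.e 2)) := by
  obtain ⟨d, -, rfl⟩ := Finset.mem_image.1 h
  simp

theorem notMem_usedW_of_apply_two (h : p (C.e 2) = C.i) : p ∉ C.usedW := fun hp => by
  have h₁ := eq_nbr_of_mem_usedW hp
  rw [h₁, nbr_w_mem_usedW] at hp
  exact hp.1 h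

theorem w_notMem_usedW : C.w ∉ C.usedW := fun h => nbr_ne _ _ _ (eq_nbr_of_mem_usedW h).symm

theorem mem_or_vertexColor_eq_k (h : p C.m = C.k) (hp : p ∉ C.usedW) :
    p ∈ C.S ∨ C.vertexColor p = C.k := by
  rw [or_iff_not_imp_left]
  intro hS
  rw [vertexColor, if_neg (by rw [h]; exact C.i_ne_k.symm),
    if_neg (by rw [h]; exact C.j_ne_k.symm), if_pos h, if_neg]
  rintro ⟨hi, h₁⟩
  have hk : p (C.e 2) ≠ C.k := h ▸ p.injective.ne (C.e_ne 2)
  by_cases hw : C.w (C.e 2) = p (C.e 2)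
  · rw [goto_of_eq hw] at h₁
    exact hS (h₁ ▸ w_mem)
  · rw [goto_of_ne hw] at h₁
    rw [h₁, nbr_w_mem_usedW] at hp
    exact hp ⟨hi, hk, Ne.symm hw⟩

include hG in
theorem reachable_w (hp : p C.m = C.k) (hpF : p ∉ C.usedW)
    (hp' : ∃ d ≠ C.k, nbr C.e p d ∉ C.usedW) : (C.graph G C.k).Reachable p C.w := by
  refine reachable_of_cluster hG (a := C.k) (F := C.usedW) ?_ (fun _ => mem_or_vertexColor_eq_k)
    ?_ hp hpF hp' C.w_m w_notMem_usedW ⟨C.w (C.e 2), ?_, ?_⟩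
  · have h : ({C.i, C.k} : Finset α) ⊆ {C.i, C.k, C.w (C.e 2)} := by
      intro a; simp only [Finset.mem_insert, Finset.mem_singleton]; tauto
    have h₁ := Finset.card_le_card h
    rw [Finset.card_pair C.i_ne_k] at h₁
    have h₂ : C.usedW.card ≤ _ := Finset.card_image_le
    have h₃ := Finset.card_le_univ ({C.i, C.k, C.w (C.e 2)} : Finset α)
    rw [Finset.card_sdiff_of_subset (Finset.subset_univ _), Finset.card_univ] at h₂
    omega
  · exact fun p hp q hq h h' => (eq_w_of_mem hp h).trans (eq_w_of_mem hq h').symm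
  · exact C.w_m ▸ C.w.injective.ne (C.e_ne 2)
  · simp [nbr_w_mem_usedW]

include hG in
theorem reachable_w_of_m_eq_i (hu : u ∈ C.S ∨ C.vertexColor u = C.k) (hm : u C.m = C.i)
    (ht : u (C.e 2) = C.k) : (C.graph G C.k).Reachable u C.w := by
  have hm' : out C.e C.m u C.m = C.k := by rw [out_apply C.e C.e_ne, ht]
  have ht' : out C.e C.m u (C.e 2) = C.i := by rw [out_apply_two, hm]
  have hF := notMem_usedW_of_apply_two ht'
  exact (reachable_out hG hu (mem_or_vertexColor_eq_k hm' hF) hm ht C.i_ne_k.symm).trans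
    (reachable_w hG hm' hF ⟨C.i, C.i_ne_k, notMem_usedW_of_apply_two (nbr_apply_two ..)⟩)

include hG in
theorem reachable_z_w : (C.graph G C.k).Reachable C.z C.w := by
  have hz₁ : C.z₁ ∈ C.S ∨ C.vertexColor C.z₁ = C.k := by
    right
    rw [vertexColor, z₁_m, if_neg C.i_ne_j.symm, if_pos rfl, if_pos (.inl rfl)]
  have hg : goto C.e C.z₁ C.k ∈ C.S ∨ C.vertexColor (goto C.e C.z₁ C.k) = C.k := by
    right
    rw [vertexColor, goto_z₁_m, if_neg C.i_ne_j.symm, if_pos rfl, if_pos (.inr rfl)]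
  have hm : out C.e C.m (goto C.e C.z₁ C.k) C.m = C.k := by
    rw [out_apply C.e C.e_ne, goto_apply_two]
  have ht : out C.e C.m (goto C.e C.z₁ C.k) (C.e 2) = C.j := by rw [out_apply_two, goto_z₁_m]
  have hF : out C.e C.m (goto C.e C.z₁ C.k) ∉ C.usedW := fun h => by
    have h₁ := eq_nbr_of_mem_usedW h
    rw [h₁, nbr_w_mem_usedW, ht] at h
    rw [ht, ← goto_of_ne (Ne.symm h.2.2)] at h₁
    exact out_goto_z₁_ne h₁
  have h₁ : (C.graph G C.k).Reachable C.z C.z₁ := by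
    rcases C.z₁_eq with h | h
    · rw [h]
    · rw [h] at hz₁ ⊢
      exact reachable_nbr_of_not_both hG (.inl z_mem) hz₁ fun _ h' =>
        nbr_ne _ _ _ (eq_z_of_mem h' (h ▸ C.z₁_m))
  refine h₁.trans ((reachable_goto hG hz₁ hg fun h h' => ?_).trans
    ((reachable_nbr_of_not_both hG hg (mem_or_vertexColor_eq_k hm hF) fun _ h => ?_).trans
      (reachable_w hG hm hF ⟨C.i, C.i_ne_k, notMem_usedW_of_apply_two (nbr_apply_two ..)⟩)))
  · exact (eq_z_of_mem h' goto_z₁_m).trans (eq_z_of_mem h z₁_m).symm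
  · have h' := eq_w_of_mem h hm
    exact out_goto_z₁_ne (h'.trans (goto_of_eq (h' ▸ ht)).symm)

variable (C) in
/-- The vertices of the cluster of `z` used by the paths leaving `z`. -/
def usedZ : Finset (Perm α) :=
  (Finset.univ \ {C.i, C.j, C.k, C.z (C.e 2)}).image (nbr C.e C.z) ∪
    ({C.z₁, goto C.e C.z₁ C.k} : Finset (Perm α)).erase C.z

theorem mem_usedZ : p ∈ C.usedZ ↔
    (∃ d, d ≠ C.i ∧ d ≠ C.j ∧ d ≠ C.k ∧ d ≠ C.z (C.e 2) ∧ p = nbr C.e C.z d) ∨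
      p ≠ C.z ∧ (p = C.z₁ ∨ p = goto C.e C.z₁ C.k) := by
  simp [usedZ, and_assoc, eq_comm]

theorem z_notMem_usedZ : C.z ∉ C.usedZ := by
  simp [mem_usedZ, (nbr_ne _ _ _).symm]

theorem card_usedZ_add_one_le : C.usedZ.card + 1 ≤ Fintype.card α := by
  have h : ({C.i, C.j, C.k} : Finset α) ⊆ {C.i, C.j, C.k, C.z (C.e 2)} := by
    intro a; simp only [Finset.mem_insert, Finset.mem_singleton]; tauto
  have h₁ := Finset.card_le_card h
  rw [Finset.card_eq_three.2 ⟨_, _, _, C.i_ne_j, C.i_ne_k, C.j_ne_k, rfl⟩] at h₁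
  have h₂ := Finset.card_image_le (s := Finset.univ \ {C.i, C.j, C.k, C.z (C.e 2)})
    (f := nbr C.e C.z)
  have h₃ := Finset.card_le_univ ({C.i, C.j, C.k, C.z (C.e 2)} : Finset α)
  have h₄ : C.usedZ.card ≤ _ := Finset.card_union_le _ _
  have h₅ := Finset.card_erase_le (s := {C.z₁, goto C.e C.z₁ C.k}) (a := C.z)
  have h₆ := Finset.card_le_two (a := C.z₁) (b := goto C.e C.z₁ C.k)
  rw [Finset.card_sdiff_of_subset (Finset.subset_univ _), Finset.card_univ] at h₂
  omega

theorem mem_or_vertexColor_eq_j (h : p C.m = C.j) (hp : p ∉ C.usedZ) :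
    p ∈ C.S ∨ C.vertexColor p = C.j := by
  rw [or_iff_not_imp_left]
  intro hS
  have hz : p ≠ C.z := fun h => hS (h ▸ z_mem)
  simp only [mem_usedZ, hz, ne_eq, not_false_eq_true, true_and, not_or, not_exists, not_and] at hp
  obtain ⟨hp, h₁, h₂⟩ := hp
  refine vertexColor_of_m_eq_j h h₁ h₂ fun hi hk h₃ => ?_
  have hj : p (C.e 2) ≠ C.j := h ▸ p.injective.ne (C.e_ne 2)
  by_cases hw : C.z (C.e 2) = p (C.e 2)
  · rw [goto_of_eq hw] at h₃
    exact hz h₃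
  · rw [goto_of_ne hw] at h₃
    exact hp _ hi hj hk (Ne.symm hw) h₃

/-- Apart from `z₁`, no vertex with symbol `i` at the position `e 2` is used. -/
theorem notMem_usedZ_of_apply_two (h : p (C.e 2) = C.i) (hp : p ≠ C.z₁) : p ∉ C.usedZ := by
  rw [mem_usedZ]
  rintro (⟨d, hi, -, -, -, rfl⟩ | ⟨-, rfl | rfl⟩)
  · exact hi (by simpa using h)
  · exact hp rfl
  · exact C.i_ne_k.symm (by simpa using h)

theorem z_not_isolated : ∃ d ≠ C.j, nbr C.e C.z d ∉ C.usedZ := by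
  have hj : C.z (C.e 2) ≠ C.j := C.z_m ▸ C.z.injective.ne (C.e_ne 2)
  by_cases hi : C.z (C.e 2) = C.i
  · rcases C.z₁_eq with h | h
    · refine ⟨C.z (C.e 2), hj, notMem_usedZ_of_apply_two (by simpa using hi) ?_⟩
      rw [h]
      exact nbr_ne _ _ _
    · refine ⟨C.k, C.j_ne_k.symm, ?_⟩
      rw [mem_usedZ]
      rintro (⟨d, -, -, hk, -, h'⟩ | ⟨-, h' | h'⟩)
      · exact hk (nbr_right_injective _ _ h').symm
      · rw [h] at h'
        exact C.i_ne_k (hi.symm.trans (nbr_right_injective _ _ h').symm)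
      · rw [goto_of_ne (by rw [z₁_apply_two, hi]; exact C.i_ne_k)] at h'
        have h₁ := nbr_left_cancel C.e (by rw [z₁_apply_two]) h'
        rw [h] at h₁
        exact nbr_ne _ _ _ h₁.symm
  · refine ⟨C.i, C.i_ne_j, notMem_usedZ_of_apply_two (by simp) fun h => hi ?_⟩
    rw [← z₁_apply_two, ← h, nbr_apply_two]

include hG in
theorem reachable_z (hp : p C.m = C.j) (hpF : p ∉ C.usedZ)
    (hp' : ∃ d ≠ C.j, nbr C.e p d ∉ C.usedZ) : (C.graph G C.j).Reachable p C.z :=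
  reachable_of_cluster hG (a := C.j) card_usedZ_add_one_le (fun _ => mem_or_vertexColor_eq_j)
    (fun _ hp _ hq h h' => (eq_z_of_mem hp h).trans (eq_z_of_mem hq h').symm) hp hpF hp' C.z_m
    z_notMem_usedZ z_not_isolated

include hG in
theorem reachable_z_of_m_eq_i (hu : u ∈ C.S ∨ C.vertexColor u = C.j) (hm : u C.m = C.i)
    (ht : u (C.e 2) = C.j) : (C.graph G C.j).Reachable u C.z := by
  have hm' : out C.e C.m u C.m = C.j := by rw [out_apply C.e C.e_ne, ht]
  have ht' : out C.e C.m u (C.e 2) = C.i := by rw [out_apply_two, hm]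
  by_cases hz : out C.e C.m u = C.z
  · have := reachable_out hG hu (.inl (hz ▸ z_mem)) hm ht C.i_ne_j.symm
    rwa [hz] at this
  by_cases hz₁ : out C.e C.m u = C.z₁
  · have h₁ : C.z₁ = nbr C.e C.z (C.z (C.e 2)) :=
      C.z₁_eq.resolve_left fun h => hz (hz₁.trans h)
    have hu' : u = out C.e C.m (nbr C.e C.z (C.z (C.e 2))) := by
      rw [← h₁, ← hz₁, out_out C.e C.e_ne]
    have huy : u ≠ C.y := fun h => C.y_ne (h ▸ hu')
    set v := nbr C.e u C.j with hv
    have hvm : v C.m = C.i := by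
      rw [hv, nbr_apply_of_ne C.e C.e_ne (by rw [hm]; exact C.i_ne_j), hm]
    have hvt : v (C.e 2) = C.j := nbr_apply_two ..
    have hvc : C.vertexColor v = C.j := by
      rw [vertexColor, if_pos hvm, if_neg, hvt]
      rintro ⟨-, h⟩
      have h₂ : C.y (C.e 2) = C.j := by
        rw [← hvt, h, nbr_apply_two]
      rw [h₂] at h
      exact huy (nbr_left_cancel C.e (by rw [ht, h₂]) h)
    have hvz : out C.e C.m v = C.z := by
      rw [hv, ← ht, nbr_self, out_mul_swap C.e C.e_ne, hz₁, h₁, nbr_self, mul_assoc,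
        swap_mul_self, mul_one]
    refine (reachable_nbr_of_eq_i hG hu (.inr hvc) hm C.i_ne_j.symm fun h h' => ?_).trans
      (hvz ▸ reachable_out hG (.inr hvc) (.inl (hvz ▸ z_mem)) hvm hvt C.i_ne_j.symm)
    rw [← (eq_or_eq_of_mem h' hvm).resolve_left fun h'' => ?_, hvt]
    exact nbr_ne _ _ _ (h''.trans ((eq_or_eq_of_mem h hm).resolve_right huy).symm)
  have hF := notMem_usedZ_of_apply_two ht' hz₁
  refine (reachable_out hG hu (mem_or_vertexColor_eq_j hm' hF) hm ht C.i_ne_j.symm).trans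
    (reachable_z hG hm' hF ⟨C.i, C.i_ne_j, ?_⟩)
  rw [mem_usedZ]
  rintro (⟨d, hi, -, -, -, h⟩ | ⟨h, h₁ | h₁⟩)
  · exact hi (by simpa using (congrArg (fun p : Perm α => p (C.e 2)) h).symm)
  · have h₂ := C.z₁_eq.resolve_left fun h' => h (h₁.trans h')
    have h₃ : C.z (C.e 2) = C.i := by rw [← z₁_apply_two, ← h₁, nbr_apply_two]
    rw [h₂, h₃] at h₁
    exact hz (nbr_left_cancel C.e (by rw [ht', h₃]) h₁)
  · have h₂ := congrArg (fun p : Perm α => p (C.e 2)) h₁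
    simp only [nbr_apply_two, goto_apply_two] at h₂
    exact C.i_ne_k h₂

include hG in
theorem reachable_w_z : (C.graph G C.j).Reachable C.w C.z := by
  have hg := C.vertexColor_goto_w C.i_ne_j.symm C.j_ne_k
  have hgm : goto C.e C.w C.j C.m = C.k := by
    rw [goto_apply_of_ne C.e_ne (by rw [C.w_m]; exact C.j_ne_k.symm), C.w_m]
  have hm : out C.e C.m (goto C.e C.w C.j) C.m = C.j := by
    rw [out_apply C.e C.e_ne, goto_apply_two]
  have ht : out C.e C.m (goto C.e C.w C.j) (C.e 2) = C.k := by rw [out_apply_two, hgm]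
  set r := out C.e C.m (goto C.e C.w C.j) with hr
  have hout : out C.e C.m r = goto C.e C.w C.j := out_out C.e C.e_ne _
  have hne : r ≠ goto C.e C.z₁ C.k := fun h => out_goto_z₁_ne (h ▸ hout)
  have hF : r ∉ C.usedZ := by
    rw [mem_usedZ]
    rintro (⟨d, -, -, hk, -, h⟩ | ⟨-, h | h⟩)
    · exact hk (by rw [← ht, h, nbr_apply_two])
    · exact hne (h.trans (goto_of_eq (h ▸ ht)).symm)
    · exact hne h
  have hrS := mem_or_vertexColor_eq_j hm hF
  have h₁ : (C.graph G C.j).Reachable C.w r := by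
    refine (reachable_goto hG (.inl w_mem) hg fun _ h => eq_w_of_mem h hgm).trans
      (SimpleGraph.Adj.reachable ⟨hG _ _, hg, hrS, fun _ _ => ?_⟩)
    rw [edgeColor, if_neg (by simp [hm, C.i_ne_j.symm]), if_pos (by simp [hm])]
  by_cases hz : r = C.z
  · rwa [← hz]
  refine h₁.trans (reachable_z hG hm hF ?_)
  rcases C.z₁_eq with h | h
  · refine ⟨C.i, C.i_ne_j, ?_⟩
    rw [mem_usedZ]
    rintro (⟨d, hi, -, -, -, h₂⟩ | ⟨h₂, h₃ | h₃⟩)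
    · exact hi (by simpa using (congrArg (fun p : Perm α => p (C.e 2)) h₂).symm)
    · exact h₂ (h₃.trans h)
    · have h₄ := congrArg (fun p : Perm α => p (C.e 2)) h₃
      simp only [nbr_apply_two, goto_apply_two] at h₄
      exact C.i_ne_k h₄
  · have h₂ : r = goto C.e C.z C.k := by
      rw [z₁] at h
      split_ifs at h with h₃
      · rw [hr, ← h₃, out_out C.e C.e_ne]
      · exact absurd h.symm (nbr_ne _ _ _)
    have h₃ : C.z (C.e 2) ≠ C.k := fun h => hz (h₂.trans (goto_of_eq h))
    refine ⟨C.z (C.e 2), C.z_m ▸ C.z.injective.ne (C.e_ne 2), ?_⟩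
    rw [h₂, goto_of_ne h₃, nbr_nbr]
    exact z_notMem_usedZ

include hG in
theorem reachable_x (hc : c ≠ C.i) (hp : p ∈ C.S) : (C.graph G c).Reachable C.x p := by
  obtain ⟨u, hum, hut, hu, hxu⟩ := exists_path_x hG hc
  obtain ⟨v, hvm, hvt, hv, hyv⟩ := exists_path_y hG hc
  suffices h : ∃ a, (C.graph G c).Reachable u a ∧ (C.graph G c).Reachable v a ∧
      (C.graph G c).Reachable C.z a ∧ (C.graph G c).Reachable C.w a by
    obtain ⟨a, hua, hva, hza, hwa⟩ := h
    rcases hp with rfl | rfl | rfl | rfl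
    · rfl
    · exact (hxu.trans hua).trans (hyv.trans hva).symm
    · exact (hxu.trans hua).trans hza.symm
    · exact (hxu.trans hua).trans hwa.symm
  by_cases hj : c = C.j
  · subst hj
    exact ⟨C.z, reachable_z_of_m_eq_i hG hu hum hut, reachable_z_of_m_eq_i hG hv hvm hvt, .rfl,
      reachable_w_z hG⟩
  by_cases hk : c = C.k
  · subst hk
    exact ⟨C.w, reachable_w_of_m_eq_i hG hu hum hut, reachable_w_of_m_eq_i hG hv hvm hvt,
      reachable_z_w hG, .rfl⟩
  obtain ⟨a, ha, hza⟩ := exists_path_z hG hc hj hk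
  obtain ⟨b, hb, hwb⟩ := exists_path_w hG hc hj hk
  have key {u : Perm α} (hu : u ∈ C.S ∨ C.vertexColor u = c) (ht : u (C.e 2) = c) :
      (C.graph G c).Reachable u a :=
    (reachable_out_of_ne hG hu ht hc hj hk).trans
      (reachable_of_m_eq hG hc hj hk (by rw [out_apply C.e C.e_ne, ht]) ha)
  exact ⟨a, key hu hut, key hv hvt, hza, hwb.trans (reachable_of_m_eq hG hc hj hk hb ha)⟩

include hG in
theorem exists_isIDSTFamily {r : ℕ} (hr : r + 1 = Fintype.card α) :
    ∃ T : Fin r → G.Subgraph, IsIDSTFamily G C.S T := by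
  have h : Fintype.card {c // c ≠ C.i} = r := by
    rw [Fintype.card_subtype_compl, Fintype.card_subtype_eq, ← hr, Nat.add_sub_cancel]
  let f := (Fintype.equivFinOfCardEq h).symm
  exact exists_isIDSTFamily_of_coloring G C.vertexColor C.edgeColor (fun l => (f l : α))
    (Subtype.val_injective.comp f.injective) x_mem fun l _ hp => reachable_x hG (f l).2 hp

end Config

end Configuration

section Godan

open Equiv

variable {n : ℕ}

theorem nbr_castLEEmb_mem (hn : 3 ≤ n) (p : Perm (Fin n)) (c : Fin n) :
    ∃ s ∈ OmegaStar n hn, nbr (Fin.castLEEmb hn) p c = p * s := by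
  obtain ⟨l, rfl⟩ := p.surjective c
  let a : Fin n := ⟨0, by omega⟩
  let b : Fin n := ⟨1, by omega⟩
  let t : Fin n := ⟨2, by omega⟩
  have hta : t ≠ a := by simp [t, a]
  have htb : t ≠ b := by simp [t, b]
  refine ⟨swap t l * swap a b, ?_, ?_⟩
  · by_cases ha : l = a
    · left; right; left
      rw [ha, swap_comm t a]
      rfl
    by_cases hb : l = b
    · left; right; right
      change _ = swap a b * swap a t
      rw [mul_swap_eq_swap_mul (swap a b), swap_apply_left, swap_apply_of_ne_of_ne hta htb,
        hb, swap_comm b]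
    by_cases ht : l = t
    · left; left
      rw [ht, swap_self]
      rfl
    · right
      refine ⟨l, ?_, ?_⟩
      · simp only [Fin.ext_iff, a, b, t] at ha hb ht
        omega
      · change _ = swap a b * swap t l
        rw [mul_swap_eq_swap_mul (swap a b), swap_apply_of_ne_of_ne hta htb,
          swap_apply_of_ne_of_ne ha hb]
  · rw [← mul_assoc, mul_swap_eq_swap_mul p]
    rfl

theorem godanGraph_adj_nbr (hn : 3 ≤ n) (p : Perm (Fin n)) (c : Fin n) :
    (godanGraph n hn).Adj p (nbr (Fin.castLEEmb hn) p c) :=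
  (SimpleGraph.fromRel_adj _ _ _).2 ⟨(nbr_ne _ _ _).symm, .inr (nbr_castLEEmb_mem hn p c)⟩

end Godan

/-- Let n ≥ 4, 4 ≤ m ≤ n, and let S be a set of four distinct vertices of EA_n
such that for pairwise distinct i, j, k exactly two vertices of S have m-th
symbol i, one has m-th symbol j and one has m-th symbol k (symbols and positions
0-based). Then there exist n − 1 pairwise internally edge disjoint S-trees. -/
theorem IDSTs_two_one_one (n m : ℕ) (hn : 4 ≤ n) (hm4 : 4 ≤ m) (hmn : m ≤ n)
    (S : Finset (Equiv.Perm (Fin n))) (hS : S.card = 4) (i j k : Fin n)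
    (hij : i ≠ j) (hik : i ≠ k) (hjk : j ≠ k)
    (h2i : (S.filter (fun σ => σ (⟨m - 1, by omega⟩ : Fin n) = i)).card = 2)
    (h1j : (S.filter (fun σ => σ (⟨m - 1, by omega⟩ : Fin n) = j)).card = 1)
    (h1k : (S.filter (fun σ => σ (⟨m - 1, by omega⟩ : Fin n) = k)).card = 1) :
    ∃ T : Fin (n - 1) → (godanGraph n (by omega)).Subgraph,
      IsIDSTFamily (godanGraph n (by omega)) (↑S : Set (Equiv.Perm (Fin n))) T := by
  obtain ⟨x, y, hxy, hxy'⟩ := Finset.card_eq_two.1 h2i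
  obtain ⟨z, hz'⟩ := Finset.card_eq_one.1 h1j
  obtain ⟨w, hw'⟩ := Finset.card_eq_one.1 h1k
  have hn3 : 3 ≤ n := by omega
  set b : Fin n := ⟨m - 1, by omega⟩ with hb
  have he (l : Fin 3) : Fin.castLEEmb hn3 l ≠ b := fun h => by
    have := congrArg Fin.val h
    simp only [Fin.castLEEmb_apply, Fin.val_castLE, hb] at this
    omega
  obtain ⟨hx, hxi⟩ := Finset.mem_filter.1 (hxy' ▸ Finset.mem_insert_self x {y})
  obtain ⟨hy, hyi⟩ := Finset.mem_filter.1
    (hxy' ▸ Finset.mem_insert_of_mem (Finset.mem_singleton_self y))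
  obtain ⟨hz, hzj⟩ := Finset.mem_filter.1 (hz' ▸ Finset.mem_singleton_self z)
  obtain ⟨hw, hwk⟩ := Finset.mem_filter.1 (hw' ▸ Finset.mem_singleton_self w)
  have hxz : x ≠ z := fun h => hij (by rw [← hxi, h, hzj])
  have hxw : x ≠ w := fun h => hik (by rw [← hxi, h, hwk])
  have hyz : y ≠ z := fun h => hij (by rw [← hyi, h, hzj])
  have hyw : y ≠ w := fun h => hik (by rw [← hyi, h, hwk])
  have hzw : z ≠ w := fun h => hjk (by rw [← hzj, h, hwk])
  have hS' : ({x, y, z, w} : Finset (Equiv.Perm (Fin n))) = S :=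
    Finset.eq_of_subset_of_card_le (by simp [Finset.insert_subset_iff, hx, hy, hz, hw])
      (by rw [hS]; simp [hxy, hxz, hxw, hyz, hyw, hzw])
  wlog hne : y ≠ out (Fin.castLEEmb hn3) b
      (nbr (Fin.castLEEmb hn3) z (z (Fin.castLEEmb hn3 2))) generalizing x y
  · exact this y x hxy.symm (by rw [hxy', Finset.pair_comm]) hy hyi hx hxi hyz hyw hxz hxw
      (by rw [← hS', Finset.insert_comm]) fun h => hxy (h.trans (not_not.1 hne).symm)
  let C : Config (Fin n) :=
    { e := Fin.castLEEmb hn3, m := b, i := i, j := j, k := k, x := x, y := y, z := z, w := w,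
      e_ne := he, i_ne_j := hij, i_ne_k := hik, j_ne_k := hjk, x_m := hxi, y_m := hyi, z_m := hzj,
      w_m := hwk, y_ne := hne }
  have hC : C.S = (S : Set (Equiv.Perm (Fin n))) := by
    rw [← hS']
    simp [C, Config.S]
  rw [← hC]
  exact C.exists_isIDSTFamily (godanGraph_adj_nbr hn3) (by rw [Fintype.card_fin]; omega)

end Godan
end
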